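/- Let β ∈ {1,−1} and let f₀ : ℝ³×ℝ³ → [0,∞) be a C¹, compactly supported function. Then there exist a global classical solution f of the Vlasov–Poisson system with parameter β and initial datum f(0,·,·) = f₀, and a constant C > 0 depending on f₀, such that the momentum support function satisfies Q(t) ≤ C(1+t)log(2+t) for all t ≥ 0 (Horst's momentum support bound, valid for both the plasma and the gravitational case). -/

import Mathlib

open MeasureTheory Real Bornology

noncomputable section

/-- Three-dimensional Euclidean space. -/
abbrev E3 := EuclideanSpace ℝ (Fin 3)

/-- The spatial density `ρ(t,x) = ∫ f(t,x,v) dv` induced by a distribution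
function `F` on `ℝ × ℝ³ × ℝ³`. -/
def vpDensity (F : ℝ × E3 × E3 → ℝ) (t : ℝ) (x : E3) : ℝ :=
  ∫ v : E3, F (t, x, v)

/-- The field `E(t,x) = (1/4π) ∫ ρ(t,y)(x−y)/|x−y|³ dy` (so `E = ∇φ`, `Δφ = ρ`). -/
def vpField (F : ℝ × E3 × E3 → ℝ) (t : ℝ) (x : E3) : E3 :=
  (4 * π)⁻¹ • ∫ y : E3, (vpDensity F t y / ‖x - y‖ ^ 3) • (x - y)

/-- `F` is a global classical solution of the (nonrelativistic) Vlasov–Poisson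
system with parameter `β`: it is a nonnegative `C¹` function, it satisfies
`∂_t f + v·∇_x f + β E·∇_v f = 0` pointwise for `t ≥ 0`, and for each `t` the
set `{(s,x,v) : 0 ≤ s ≤ t, f(s,x,v) ≠ 0}` is bounded. -/
structure IsGlobalVPSolution (β : ℝ) (F : ℝ × E3 × E3 → ℝ) : Prop where
  nonneg : ∀ z, 0 ≤ F z
  smooth : ContDiff ℝ 1 F
  pde : ∀ t x v, 0 ≤ t →
    fderiv ℝ F (t, x, v) (1, v, β • vpField F t x) = 0
  support_bounded : ∀ t, 0 ≤ t →
    IsBounded {z : ℝ × E3 × E3 | 0 ≤ z.1 ∧ z.1 ≤ t ∧ F z ≠ 0}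

/-- The momentum support function
`Q(t) = sup{|v| : ∃ s ∈ [0,t], x ∈ ℝ³, f(s,x,v) ≠ 0}`. -/
def vpQ (F : ℝ × E3 × E3 → ℝ) (t : ℝ) : ℝ :=
  sSup {r : ℝ | ∃ s x v, 0 ≤ s ∧ s ≤ t ∧ F (s, x, v) ≠ 0 ∧ r = ‖v‖}


namespace VP

open Set Filter Topology

section ode
variable {F : Type*} [NormedAddCommGroup F] [NormedSpace ℝ F]

/-- Two-sided Gronwall inequality. -/
lemma gron2 {w w' : ℝ → F} {K η T : ℝ} (hK : 0 ≤ K) (hη : 0 ≤ η)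
    (hw : ∀ s, HasDerivAt w (w' s) s) (hb : ∀ s, |s| ≤ T → ‖w' s‖ ≤ K * ‖w s‖ + η)
    {t : ℝ} (ht : |t| ≤ T) : ‖w t‖ ≤ gronwallBound ‖w 0‖ K η T := by
  have hT : 0 ≤ T := (abs_nonneg t).trans ht
  have key : ∀ (u u' : ℝ → F), (∀ s, HasDerivAt u (u' s) s) →
      (∀ s, |s| ≤ T → ‖u' s‖ ≤ K * ‖u s‖ + η) → ∀ s, 0 ≤ s → s ≤ T →
      ‖u s‖ ≤ gronwallBound ‖u 0‖ K η T := by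
    intro u u' hu hub s hs hsT
    have h := norm_le_gronwallBound_of_norm_deriv_right_le (f := u) (f' := u') (δ := ‖u 0‖)
      (K := K) (ε := η) (a := 0) (b := T)
      (fun x _ => (hu x).continuousAt.continuousWithinAt)
      (fun x _ => (hu x).hasDerivWithinAt) le_rfl
      (fun x hx => hub x (by rw [abs_of_nonneg hx.1]; exact hx.2.le)) s ⟨hs, hsT⟩
    refine h.trans ?_
    apply gronwallBound_mono (norm_nonneg _) hη hK
    simpa using hsT
  rcases le_total 0 t with h0 | h0
  · exact key w w' hw hb t h0 (by rwa [abs_of_nonneg h0] at ht)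
  · have := key (fun s => w (-s)) (fun s => -w' (-s)) (fun s => by
      have := (hw (-s)).scomp s (hasDerivAt_neg s)
      simpa using! this) (fun s hs => by
      rw [norm_neg]; exact hb (-s) (by rwa [abs_neg])) (-t) (by linarith)
      (by rwa [abs_of_nonpos h0] at ht)
    simpa using this

/-- A field which is continuous, and Lipschitz in space with a continuous constant. -/
structure LipField (b : ℝ → F → F) (K : ℝ → ℝ) : Prop where
  cont : Continuous (Function.uncurry b)
  contK : Continuous K
  nonneg : ∀ t, 0 ≤ K t
  lip : ∀ t x y, ‖b t x - b t y‖ ≤ K t * ‖x - y‖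

lemma exists_bound_K {K : ℝ → ℝ} (hK : Continuous K) (T : ℝ) :
    ∃ C, 0 ≤ C ∧ ∀ s, |s| ≤ T → K s ≤ C := by
  obtain ⟨C, hC⟩ := (isCompact_Icc (a := -T) (b := T)).bddAbove_image hK.continuousOn
  refine ⟨max C 0, le_max_right _ _, fun s hs => (hC ⟨s, abs_le.1 hs, rfl⟩).trans (le_max_left _ _)⟩

lemma LipField.unique {b : ℝ → F → F} {K : ℝ → ℝ} (hb : LipField b K) {u v : ℝ → F}
    (hu : ∀ t, HasDerivAt u (b t (u t)) t) (hv : ∀ t, HasDerivAt v (b t (v t)) t)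
    {t₀ : ℝ} (h : u t₀ = v t₀) : u = v := by
  funext t
  obtain ⟨C, hC0, hC⟩ := exists_bound_K (K := fun s => K (s + t₀))
    (hb.contK.comp (continuous_add_const t₀)) (|t - t₀|)
  have := gron2 (w := fun s => u (s + t₀) - v (s + t₀))
    (w' := fun s => b (s + t₀) (u (s + t₀)) - b (s + t₀) (v (s + t₀))) (K := C) (η := 0)
    (T := |t - t₀|) hC0 le_rfl
    (fun s => ((hu _).comp_add_const s t₀).sub ((hv _).comp_add_const s t₀))
    (fun s hs => by
      rw [add_zero]
      refine (hb.lip _ _ _).trans ?_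
      gcongr
      exact hC s hs) (t := t - t₀) le_rfl
  simp [h, gronwallBound_ε0_δ0] at this
  exact sub_eq_zero.1 this

variable [CompleteSpace F]

lemma LipField.exists_sol₀ {b : ℝ → F → F} {K : ℝ → ℝ} (hb : LipField b K) (x₀ : F) :
    ∃ u : ℝ → F, u 0 = x₀ ∧ ∀ t, HasDerivAt u (b t (u t)) t := by
  set Q : ℝ → ℝ := fun t => K t + ‖b t 0‖ with hQ
  have hb0 : Continuous fun t => b t 0 := hb.cont.comp (by fun_prop : Continuous fun t : ℝ => (t, (0:F)))
  have hQc : Continuous Q := hb.contK.add hb0.norm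
  have hQ0 : ∀ t, 0 ≤ Q t := fun t => add_nonneg (hb.nonneg t) (norm_nonneg _)
  set κ : ℝ → ℝ := fun t => ∫ s in (0:ℝ)..t, Q s with hκ
  have hκd : ∀ t, HasDerivAt κ (Q t) t := fun t => hQc.integral_hasStrictDerivAt 0 t |>.hasDerivAt
  have hκc : Continuous κ := continuous_iff_continuousAt.2 fun t => (hκd t).continuousAt
  set W : ℝ → ℝ := fun t => cosh (2 * κ t) with hW
  have hWc : Continuous W := by fun_prop
  have hW1 : ∀ t, 1 ≤ W t := fun t => one_le_cosh _
  have hW0 : ∀ t, 0 < W t := fun t => cosh_pos _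
  have hintg : ∀ t, ∫ s in (0:ℝ)..t, Q s * W s = sinh (2 * κ t) / 2 := by
    intro t
    have : ∀ s ∈ uIcc 0 t, HasDerivAt (fun s => sinh (2 * κ s) / 2) (Q s * W s) s := by
      intro s _
      have := (((hκd s).const_mul 2).sinh).div_const 2
      convert! this using 1
      simp only [hW]; ring
    rw [intervalIntegral.integral_eq_sub_of_hasDerivAt this ((hQc.mul hWc).intervalIntegrable _ _)]
    simp [hκ]
  have hintg' : ∀ t, |∫ s in (0:ℝ)..t, Q s * W s| ≤ W t / 2 := by
    intro t
    rw [hintg, abs_div, abs_two]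
    gcongr
    rw [abs_le]
    constructor
    · have := exp_pos (2 * κ t); rw [← cosh_add_sinh] at this; simp only [hW]; linarith
    · exact (sinh_lt_cosh _).le
  -- the norm estimate used several times
  have hest : ∀ (g : ℝ → F) (C : ℝ), 0 ≤ C → (∀ s, ‖g s‖ ≤ C * (Q s * W s)) → ∀ t,
      ‖∫ s in (0:ℝ)..t, g s‖ ≤ C * (W t / 2) := by
    intro g C hC hg t
    have h1 : ‖∫ s in (0:ℝ)..t, g s‖ ≤ |∫ s in (0:ℝ)..t, C * (Q s * W s)| :=
      intervalIntegral.norm_integral_le_abs_of_norm_le (Eventually.of_forall fun s => hg s)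
        ((continuous_const.mul (hQc.mul hWc)).intervalIntegrable _ _)
    refine h1.trans ?_
    rw [intervalIntegral.integral_const_mul, abs_mul, abs_of_nonneg hC]
    exact mul_le_mul_of_nonneg_left (hintg' t) hC
  have hbw : ∀ t (x : F), ‖b t x‖ ≤ Q t * (1 + ‖x‖) := by
    intro t x
    have h1 := hb.lip t x 0
    have h2 : ‖b t x‖ ≤ ‖b t x - b t 0‖ + ‖b t 0‖ := by
      simpa using norm_add_le (b t x - b t 0) (b t 0)
    rw [sub_zero] at h1
    simp only [hQ]
    nlinarith [hb.nonneg t, norm_nonneg x, norm_nonneg (b t 0), mul_nonneg (norm_nonneg (b t 0)) (norm_nonneg x)]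
  have hgc : ∀ y : BoundedContinuousFunction ℝ F, Continuous fun s => b s (W s • y s) :=
    fun y => hb.cont.comp (by fun_prop : Continuous fun s => (s, W s • y s))
  have hgb : ∀ (y : BoundedContinuousFunction ℝ F) s,
      ‖b s (W s • y s)‖ ≤ (1 + ‖y‖) * (Q s * W s) := by
    intro y s
    refine (hbw _ _).trans ?_
    rw [norm_smul, Real.norm_of_nonneg (hW0 s).le]
    have h1 := y.norm_coe_le_norm s
    have : 1 + W s * ‖y s‖ ≤ (1 + ‖y‖) * W s := by nlinarith [hW1 s]
    calc Q s * (1 + W s * ‖y s‖) ≤ Q s * ((1 + ‖y‖) * W s) := mul_le_mul_of_nonneg_left this (hQ0 s)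
      _ = _ := by ring
  let Φ : BoundedContinuousFunction ℝ F → BoundedContinuousFunction ℝ F := fun y =>
    BoundedContinuousFunction.ofNormedAddCommGroup
      (fun t => (W t)⁻¹ • (x₀ + ∫ s in (0:ℝ)..t, b s (W s • y s)))
      ((hWc.inv₀ fun t => (hW0 t).ne').smul (continuous_const.add
        (intervalIntegral.continuous_primitive (fun a c => (hgc y).intervalIntegrable a c) 0)))
      (‖x₀‖ + (1 + ‖y‖)) (by
        intro t
        rw [norm_smul, norm_inv, Real.norm_of_nonneg (hW0 t).le, inv_mul_le_iff₀ (hW0 t)]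
        refine (norm_add_le _ _).trans ?_
        have := hest _ (1 + ‖y‖) (by positivity) (hgb y) t
        nlinarith [hW1 t, norm_nonneg x₀, norm_nonneg y, mul_nonneg (norm_nonneg y) (hW0 t).le])
  have hΦ : ContractingWith (1/2) Φ := by
    refine ⟨by
      rw [← NNReal.coe_lt_coe]; norm_num, LipschitzWith.of_dist_le_mul fun y z => ?_⟩
    rw [BoundedContinuousFunction.dist_le (by positivity)]
    intro t
    change dist ((W t)⁻¹ • (x₀ + ∫ s in (0:ℝ)..t, b s (W s • y s)))
      ((W t)⁻¹ • (x₀ + ∫ s in (0:ℝ)..t, b s (W s • z s))) ≤ _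
    rw [dist_eq_norm, ← smul_sub, add_sub_add_left_eq_sub, ← intervalIntegral.integral_sub
      ((hgc y).intervalIntegrable _ _) ((hgc z).intervalIntegrable _ _),
      norm_smul, norm_inv, Real.norm_of_nonneg (hW0 t).le, inv_mul_le_iff₀ (hW0 t)]
    have := hest (fun s => b s (W s • y s) - b s (W s • z s)) (dist y z) dist_nonneg (fun s => by
      refine (hb.lip _ _ _).trans ?_
      rw [← smul_sub, norm_smul, Real.norm_of_nonneg (hW0 s).le]
      have h1 : ‖y s - z s‖ ≤ dist y z := by
        rw [← dist_eq_norm]; exact BoundedContinuousFunction.dist_coe_le_dist s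
      have h2 : K s ≤ Q s := le_add_of_nonneg_right (norm_nonneg _)
      calc K s * (W s * ‖y s - z s‖) ≤ Q s * (W s * dist y z) := by
            have := hQ0 s; have := (hW0 s).le
            gcongr
        _ = _ := by ring) t
    refine this.trans (le_of_eq ?_)
    push_cast
    ring
  obtain ⟨y, hy, -⟩ := hΦ.exists_fixedPoint 0 (by simp [edist_ne_top])
  have hfix : ∀ t, W t • y t = x₀ + ∫ s in (0:ℝ)..t, b s (W s • y s) := by
    intro t
    have h1 : Φ y t = y t := by rw [hy.eq]
    have h2 : Φ y t = (W t)⁻¹ • (x₀ + ∫ s in (0:ℝ)..t, b s (W s • y s)) := rfl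
    rw [← h1, h2, smul_smul, mul_inv_cancel₀ (hW0 t).ne', one_smul]
  refine ⟨fun t => W t • y t, by simp [hfix 0], fun t => ?_⟩
  have h1 : HasDerivAt (fun t => x₀ + ∫ s in (0:ℝ)..t, b s (W s • y s)) (b t (W t • y t)) t :=
    ((hgc y).integral_hasStrictDerivAt 0 t).hasDerivAt.const_add x₀
  exact h1.congr_of_eventuallyEq (Eventually.of_forall hfix)

lemma LipField.exists_sol {b : ℝ → F → F} {K : ℝ → ℝ} (hb : LipField b K) (t₀ : ℝ) (x₀ : F) :
    ∃ u : ℝ → F, u t₀ = x₀ ∧ ∀ t, HasDerivAt u (b t (u t)) t := by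
  have hb' : LipField (fun t => b (t + t₀)) (fun t => K (t + t₀)) :=
    ⟨hb.cont.comp (by fun_prop : Continuous fun p : ℝ × F => (p.1 + t₀, p.2)),
      hb.contK.comp (by fun_prop), fun t => hb.nonneg _, fun t => hb.lip _⟩
  obtain ⟨u, hu0, hu⟩ := hb'.exists_sol₀ x₀
  refine ⟨fun t => u (t - t₀), by simpa using hu0, fun t => ?_⟩
  have := (hu (t - t₀)).comp_sub_const t t₀
  simpa using this

/-- Continuous dependence on parameters. -/
lemma cont_dep {P : Type*} [TopologicalSpace P] {B : ℝ → P → F → F} {K : ℝ → ℝ}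
    (hB : Continuous fun q : ℝ × P × F => B q.1 q.2.1 q.2.2) (hK : Continuous K)
    (hlip : ∀ t p x y, ‖B t p x - B t p y‖ ≤ K t * ‖x - y‖)
    {u : ℝ → P → F} (hu : ∀ t p, HasDerivAt (fun t => u t p) (B t p (u t p)) t)
    (hu0 : Continuous (u 0)) : Continuous fun q : ℝ × P => u q.1 q.2 := by
  rw [continuous_iff_continuousAt]
  rintro ⟨t₀, p₀⟩
  set T := |t₀| + 1
  have hT : 0 < T := by positivity
  obtain ⟨C, hC0, hC⟩ := exists_bound_K hK T
  have hup : Continuous fun t => u t p₀ := continuous_iff_continuousAt.2 fun t => (hu t p₀).continuousAt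
  rw [Metric.continuousAt_iff']
  intro e he
  -- the gronwall bound is continuous
  have hg : Tendsto (fun p : ℝ × ℝ => gronwallBound p.1 C p.2 T) (𝓝 (0, 0)) (𝓝 0) := by
    have : Continuous fun p : ℝ × ℝ => gronwallBound p.1 C p.2 T := by
      unfold gronwallBound
      split_ifs <;> fun_prop
    have h := this.tendsto (0, 0)
    simpa [gronwallBound_ε0_δ0] using h
  obtain ⟨δ, hδ, hδ'⟩ := Metric.eventually_nhds_iff.1 (hg.eventually (gt_mem_nhds (half_pos he)))
  have h1 : ∀ᶠ p in 𝓝 p₀, ‖u 0 p - u 0 p₀‖ < δ := by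
    have := (Metric.continuousAt_iff'.1 (hu0.continuousAt (x := p₀))) δ hδ
    simpa [dist_eq_norm] using this
  have h2 : ∀ᶠ p in 𝓝 p₀, ∀ s ∈ Icc (-T) T, ‖B s p (u s p₀) - B s p₀ (u s p₀)‖ < δ / 2 := by
    apply IsCompact.eventually_forall_of_forall_eventually isCompact_Icc
    intro s _
    have hc : Continuous fun q : P × ℝ => ‖B q.2 q.1 (u q.2 p₀) - B q.2 p₀ (u q.2 p₀)‖ := by
      apply Continuous.norm
      apply Continuous.sub
      · exact hB.comp (continuous_snd.prodMk (continuous_fst.prodMk (hup.comp continuous_snd)))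
      · exact hB.comp (continuous_snd.prodMk (continuous_const.prodMk (hup.comp continuous_snd)))
    have := hc.continuousAt.eventually_lt (x₀ := (p₀, s)) (g := fun _ => δ/2) continuousAt_const (by simpa using hδ)
    exact this
  have h3 : ∀ᶠ t in 𝓝 t₀, ‖u t p₀ - u t₀ p₀‖ < e / 2 := by
    have := (Metric.continuousAt_iff'.1 (hup.continuousAt (x := t₀))) (e/2) (half_pos he)
    simpa [dist_eq_norm] using this
  have h4 : ∀ᶠ t in 𝓝 t₀, |t| < T :=
    (continuous_abs.tendsto t₀).eventually (gt_mem_nhds (lt_add_one _))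
  rw [nhds_prod_eq]
  filter_upwards [(h3.and h4).prod_mk (h1.and h2)] with ⟨t, p⟩ ⟨⟨g3, g4⟩, g1, g2⟩
  simp only at g1 g2 g3 g4 ⊢
  have := gron2 (w := fun s => u s p - u s p₀) (w' := fun s => B s p (u s p) - B s p₀ (u s p₀))
    (K := C) (η := δ / 2) (T := T) hC0 (by positivity) (fun s => (hu s p).sub (hu s p₀))
    (fun s hs => by
      have e1 := hlip s p (u s p) (u s p₀)
      have e2 := g2 s (abs_le.1 hs)
      have e3 : K s * ‖u s p - u s p₀‖ ≤ C * ‖u s p - u s p₀‖ := by gcongr; exact hC s hs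
      calc _ = ‖(B s p (u s p) - B s p (u s p₀)) + (B s p (u s p₀) - B s p₀ (u s p₀))‖ := by
            congr 1; abel
        _ ≤ _ := (norm_add_le _ _).trans (by linarith)) g4.le
  have h5 := hδ' (y := (‖u 0 p - u 0 p₀‖, δ / 2)) (by
    rw [Prod.dist_eq]
    simp only [dist_zero_right, norm_norm, max_lt_iff]
    exact ⟨g1, by rw [Real.norm_of_nonneg (by positivity)]; linarith⟩)
  rw [dist_eq_norm]
  calc ‖u t p - u t₀ p₀‖ = ‖(u t p - u t p₀) + (u t p₀ - u t₀ p₀)‖ := by congr 1; abel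
    _ ≤ _ := norm_add_le _ _
    _ < e := by simp only at this h5; linarith

end ode
end VP

namespace VP

open Set Filter Topology

section flow
variable {F : Type*} [NormedAddCommGroup F] [NormedSpace ℝ F]

structure C1Field (b : ℝ → F → F) (Db : ℝ → F → F →L[ℝ] F) (K : ℝ → ℝ) : Prop where
  cont : Continuous (Function.uncurry b)
  contK : Continuous K
  nonneg : ∀ t, 0 ≤ K t
  hasFDeriv : ∀ t x, HasFDerivAt (b t) (Db t x) x
  contD : Continuous (Function.uncurry Db)
  bound : ∀ t x, ‖Db t x‖ ≤ K t

lemma C1Field.lipField {b : ℝ → F → F} {Db : ℝ → F → F →L[ℝ] F} {K : ℝ → ℝ}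
    (hb : C1Field b Db K) : LipField b K :=
  ⟨hb.cont, hb.contK, hb.nonneg, fun t x y =>
    convex_univ.norm_image_sub_le_of_norm_hasFDerivWithin_le
      (fun z _ => (hb.hasFDeriv t z).hasFDerivWithinAt) (fun z _ => hb.bound t z) (mem_univ y)
      (mem_univ x)⟩

/-- averaged derivative -/
def avgD (Db : ℝ → F → F →L[ℝ] F) (t : ℝ) (x y : F) : F →L[ℝ] F :=
  ∫ θ in (0:ℝ)..1, Db t (y + θ • (x - y))

variable [CompleteSpace F]

lemma avgD_apply {b : ℝ → F → F} {Db : ℝ → F → F →L[ℝ] F} {K : ℝ → ℝ}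
    (hb : C1Field b Db K) (t : ℝ) (x y : F) : avgD Db t x y (x - y) = b t x - b t y := by
  have hc : Continuous fun θ : ℝ => Db t (y + θ • (x - y)) :=
    hb.contD.comp (by fun_prop : Continuous fun θ : ℝ => (t, y + θ • (x - y)))
  rw [avgD, ContinuousLinearMap.intervalIntegral_apply (hc.intervalIntegrable _ _)]
  have : ∀ θ ∈ uIcc (0:ℝ) 1, HasDerivAt (fun θ : ℝ => b t (y + θ • (x - y)))
      (Db t (y + θ • (x - y)) (x - y)) θ := by
    intro θ _
    have h1 : HasDerivAt (fun θ : ℝ => y + θ • (x - y)) (x - y) θ := by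
      simpa using ((hasDerivAt_id θ).smul_const (x - y)).const_add y
    exact (hb.hasFDeriv t _).comp_hasDerivAt θ h1
  rw [intervalIntegral.integral_eq_sub_of_hasDerivAt this
    ((hc.clm_apply continuous_const).intervalIntegrable _ _)]
  simp

omit [CompleteSpace F] in
lemma avgD_norm {b : ℝ → F → F} {Db : ℝ → F → F →L[ℝ] F} {K : ℝ → ℝ}
    (hb : C1Field b Db K) (t : ℝ) (x y : F) : ‖avgD Db t x y‖ ≤ K t := by
  have := intervalIntegral.norm_integral_le_of_norm_le_const (a := (0:ℝ)) (b := 1) (C := K t)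
    (f := fun θ => Db t (y + θ • (x - y))) (fun θ _ => hb.bound t _)
  simpa [avgD] using this

omit [CompleteSpace F] in
lemma avgD_cont {b : ℝ → F → F} {Db : ℝ → F → F →L[ℝ] F} {K : ℝ → ℝ}
    (hb : C1Field b Db K) : Continuous fun q : ℝ × F × F => avgD Db q.1 q.2.1 q.2.2 := by
  unfold avgD
  apply intervalIntegral.continuous_parametric_intervalIntegral_of_continuous'
  exact hb.contD.comp (by fun_prop :
    Continuous fun p : (ℝ × F × F) × ℝ => (p.1.1, p.1.2.2 + p.2 • (p.1.2.1 - p.1.2.2)))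

omit [CompleteSpace F] in
lemma avgD_self (Db : ℝ → F → F →L[ℝ] F) [CompleteSpace F] (t : ℝ) (x : F) :
    avgD Db t x x = Db t x := by
  simp [avgD]

/-- The flow of a `C1Field`: existence and all its properties. -/
theorem C1Field.exists_flow {b : ℝ → F → F} {Db : ℝ → F → F →L[ℝ] F} {K : ℝ → ℝ}
    (hb : C1Field b Db K) : ∃ (G Ψ : ℝ → F → F) (J : ℝ → F → F →L[ℝ] F),
      (∀ z, G 0 z = z) ∧ (∀ t z, HasDerivAt (fun t => G t z) (b t (G t z)) t) ∧
      (∀ z, J 0 z = ContinuousLinearMap.id ℝ F) ∧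
      (∀ t z, HasDerivAt (fun t => J t z) ((Db t (G t z)).comp (J t z)) t) ∧
      (∀ t z, HasFDerivAt (G t) (J t z) z) ∧
      ContDiff ℝ 1 (Function.uncurry G) ∧ ContDiff ℝ 1 (Function.uncurry Ψ) ∧
      (∀ t z, Ψ t (G t z) = z) ∧ (∀ t z, G t (Ψ t z) = z) := by
  have hL := hb.lipField
  choose u hu0 hu using fun z => hL.exists_sol 0 z
  choose p hp0 hp using fun (t : ℝ) (z : F) => hL.exists_sol t z
  set G : ℝ → F → F := fun t z => u z t with hG
  set Ψ : ℝ → F → F := fun t z => p t z 0 with hΨ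
  have hGΨ : ∀ t z, G t (Ψ t z) = z := by
    intro t z
    have : u (Ψ t z) = p t z := hL.unique (hu _) (hp t z) (t₀ := 0) (by rw [hu0])
    simp only [hG, this, hp0]
  have hΨG : ∀ t z, Ψ t (G t z) = z := by
    intro t z
    have : u z = p t (G t z) := hL.unique (hu z) (hp _ _) (t₀ := t) (by rw [hp0])
    simp only [hΨ, ← this, hu0]
  have hGc : Continuous fun q : ℝ × F => G q.1 q.2 :=
    cont_dep (B := fun t _ x => b t x) (K := K)
      (hb.cont.comp (by fun_prop : Continuous fun q : ℝ × F × F => (q.1, q.2.2))) hb.contK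
      (fun t _ => hL.lip t) (fun t z => hu z t) (by
        simp only [hG, hu0]; exact continuous_id)
  -- the matrix ODE with parameters
  set A : ℝ → F × F → F →L[ℝ] F := fun t q => avgD Db t (G t q.1) (G t q.2) with hA
  have hAc : Continuous fun q : ℝ × F × F => A q.1 q.2 :=
    (avgD_cont hb).comp (continuous_fst.prodMk
      ((hGc.comp (continuous_fst.prodMk (continuous_fst.comp continuous_snd))).prodMk
      (hGc.comp (continuous_fst.prodMk (continuous_snd.comp continuous_snd)))))
  have hAb : ∀ t q, ‖A t q‖ ≤ K t := fun t q => avgD_norm hb _ _ _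
  have hAq : ∀ q, Continuous fun t => A t q := fun q =>
    hAc.comp (continuous_id.prodMk continuous_const)
  have hM : ∀ q, LipField (fun t (N : F →L[ℝ] F) => (A t q).comp N) K := fun q =>
    ⟨((hAq q).comp continuous_fst).clm_comp continuous_snd, hb.contK, hb.nonneg, fun t N N' => by
      rw [← ContinuousLinearMap.comp_sub]
      exact (ContinuousLinearMap.opNorm_comp_le _ _).trans (by gcongr; exact hAb t q)⟩
  choose M hM0 hMd using fun q => (hM q).exists_sol 0 (ContinuousLinearMap.id ℝ F)
  have hMc : Continuous fun q : ℝ × F × F => M q.2 q.1 :=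
    cont_dep (u := fun t q => M q t) (B := fun t q N => (A t q).comp N) (K := K)
      ((hAc.comp (by fun_prop : Continuous fun r : ℝ × (F × F) × (F →L[ℝ] F) => (r.1, r.2.1))).clm_comp
        (by fun_prop)) hb.contK
      (fun t q => (hM q).lip t) (fun t q => hMd q t) (by
        simp only [hM0]; exact continuous_const)
  -- difference formula
  have hdiff : ∀ x y t, G t x - G t y = M (x, y) t (x - y) := by
    intro x y
    have hlin : LipField (fun t (w : F) => A t (x, y) w) K :=
      ⟨((hAq _).comp continuous_fst).clm_apply continuous_snd, hb.contK, hb.nonneg,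
        fun t w w' => by
        rw [← map_sub]
        exact ((A t (x, y)).le_opNorm _).trans (by gcongr; exact hAb _ _)⟩
    have := hlin.unique (u := fun t => G t x - G t y) (v := fun t => M (x, y) t (x - y)) (t₀ := 0)
      (fun t => by
        have h := (hu x t).sub (hu y t)
        convert! h using 1
        simp only [hA]
        exact avgD_apply hb _ _ _)
      (fun t => by
        have h := (hMd (x, y) t).clm_apply (hasDerivAt_const t (x - y))
        simpa using! h)
      (by simp [hG, hu0, hM0])
    intro t
    exact congrFun this t
  set J : ℝ → F → F →L[ℝ] F := fun t z => M (z, z) t with hJ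
  have hJc : Continuous fun q : ℝ × F => J q.1 q.2 :=
    hMc.comp (by fun_prop : Continuous fun q : ℝ × F => (q.1, q.2, q.2))
  have hGd : ∀ t z, HasFDerivAt (G t) (J t z) z := by
    intro t z
    rw [hasFDerivAt_iff_isLittleO, Asymptotics.isLittleO_iff]
    intro c hc
    have hcont : Continuous fun x => M (x, z) t :=
      hMc.comp (by fun_prop : Continuous fun x : F => (t, x, z))
    have := Metric.continuousAt_iff'.1 (hcont.continuousAt (x := z)) c hc
    filter_upwards [this] with x hx
    rw [hdiff x z t, dist_eq_norm] at *
    have h2 : M (x, z) t (x - z) - (J t z) (x - z) = (M (x, z) t - M (z, z) t) (x - z) := by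
      simp [hJ]
    rw [h2]
    exact (ContinuousLinearMap.le_opNorm _ _).trans (by gcongr)
  have hJd : ∀ t z, HasDerivAt (fun t => J t z) ((Db t (G t z)).comp (J t z)) t := by
    intro t z
    have := hMd (z, z) t
    simp only [hA, avgD_self] at this
    exact this
  have hbG : Continuous fun q : ℝ × F => b q.1 (G q.1 q.2) :=
    hb.cont.comp (continuous_fst.prodMk hGc)
  set f₁ : ℝ → F → ℝ →L[ℝ] F := fun t z => ContinuousLinearMap.toSpanSingleton ℝ (b t (G t z)) with hf₁
  have hf₁c : Continuous fun q : ℝ × F => f₁ q.1 q.2 := by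
    simp only [hf₁]
    exact (ContinuousLinearMap.toSpanSingletonCLE (𝕜 := ℝ) (E := F)).continuous.comp hbG
  have hstrict : ∀ q : ℝ × F, HasStrictFDerivAt (Function.uncurry G)
      ((f₁ q.1 q.2).coprod (J q.1 q.2)) q := by
    intro q
    exact hasStrictFDerivAt_uncurry_coprod (f := G) (f₁ := f₁) (f₂ := J) (u := q)
      (Eventually.of_forall fun v => (hu v.2 v.1).hasFDerivAt)
      (Eventually.of_forall fun v => hGd v.1 v.2) hf₁c.continuousAt hJc.continuousAt
  have hGC1 : ContDiff ℝ 1 (Function.uncurry G) := by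
    rw [contDiff_one_iff_hasFDerivAt]
    exact ⟨_, hf₁c.continuousLinearMapCoprod hJc, fun q => (hstrict q).hasFDerivAt⟩
  -- inverse of J
  have hinv : ∀ z, ∃ N : ℝ → F →L[ℝ] F, ∀ t, (N t).comp (J t z) = ContinuousLinearMap.id ℝ F ∧
      (J t z).comp (N t) = ContinuousLinearMap.id ℝ F := by
    intro z
    set a : ℝ → F →L[ℝ] F := fun t => Db t (G t z) with ha
    have hac : Continuous a := hb.contD.comp (continuous_id.prodMk
      (hGc.comp (continuous_id.prodMk continuous_const)))
    have hab : ∀ t, ‖a t‖ ≤ K t := fun t => hb.bound _ _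
    have hN : LipField (fun t (N : F →L[ℝ] F) => -(N.comp (a t))) K :=
      ⟨(continuous_snd.clm_comp (hac.comp continuous_fst)).neg, hb.contK, hb.nonneg, fun t N N' => by
        have : -(N.comp (a t)) - -(N'.comp (a t)) = -((N - N').comp (a t)) := by
          rw [ContinuousLinearMap.sub_comp]; abel
        rw [this, norm_neg, mul_comm]
        exact (ContinuousLinearMap.opNorm_comp_le _ _).trans (by gcongr; exact hab t)⟩
    obtain ⟨N, hN0, hNd⟩ := hN.exists_sol 0 (ContinuousLinearMap.id ℝ F)
    refine ⟨N, fun t => ⟨?_, ?_⟩⟩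
    · have hd : ∀ t, HasDerivAt (fun t => (N t).comp (J t z)) 0 t := by
        intro t
        have := (hNd t).clm_comp (hJd t z)
        convert! this using 1
        ext w; simp [ha]
      have := is_const_of_deriv_eq_zero (fun t => (hd t).differentiableAt) (fun t => (hd t).deriv) t 0
      rw [this, hN0]; simp [hJ, hM0]
    · have hY : LipField (fun t (Y : F →L[ℝ] F) => (a t).comp Y - Y.comp (a t)) (fun t => 2 * K t) :=
        ⟨((hac.comp continuous_fst).clm_comp continuous_snd).sub
          (continuous_snd.clm_comp (hac.comp continuous_fst)), hb.contK.const_mul 2,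
          fun t => mul_nonneg zero_le_two (hb.nonneg t), fun t N N' => by
          have : ((a t).comp N - N.comp (a t)) - ((a t).comp N' - N'.comp (a t))
            = (a t).comp (N - N') - (N - N').comp (a t) := by
            rw [ContinuousLinearMap.sub_comp, ContinuousLinearMap.comp_sub]; abel
          rw [this]
          have h1 := ContinuousLinearMap.opNorm_comp_le (a t) (N - N')
          have h2 := ContinuousLinearMap.opNorm_comp_le (N - N') (a t)
          have h3 := norm_sub_le ((a t).comp (N - N')) ((N - N').comp (a t))
          nlinarith [hab t, norm_nonneg (N - N')]⟩
      have := hY.unique (u := fun t => (J t z).comp (N t)) (v := fun _ => ContinuousLinearMap.id ℝ F)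
        (t₀ := 0) (fun t => by
          have := (hJd t z).clm_comp (hNd t)
          convert! this using 1
          ext w; simp [ha, sub_eq_add_neg]) (fun t => by
          have : (a t).comp (ContinuousLinearMap.id ℝ F) - (ContinuousLinearMap.id ℝ F).comp (a t) = 0 := by
            ext; simp
          rw [this]; exact hasDerivAt_const _ _) (by simp [hJ, hM0, hN0])
      exact congrFun this t
  choose N hN1 hN2 using fun z t => (hinv z).imp fun N hN => hN t
  have hΨC1 : ContDiff ℝ 1 (Function.uncurry Ψ) := by
    set H : ℝ × F ≃ ℝ × F :=
      { toFun := fun q => (q.1, G q.1 q.2)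
        invFun := fun q => (q.1, Ψ q.1 q.2)
        left_inv := fun q => by simp [hΨG]
        right_inv := fun q => by simp [hGΨ] } with hH
    have hHd : ∀ q : ℝ × F, ∃ e : (ℝ × F) ≃L[ℝ] (ℝ × F),
        HasStrictFDerivAt H (e : (ℝ × F) →L[ℝ] (ℝ × F)) q := by
      intro q
      obtain ⟨N, hN⟩ := hinv q.2
      obtain ⟨hN1, hN2⟩ := hN q.1
      have hN1' : ∀ w, N q.1 (J q.1 q.2 w) = w := fun w => by
        have := DFunLike.congr_fun hN1 w; simpa using this
      have hN2' : ∀ w, J q.1 q.2 (N q.1 w) = w := fun w => by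
        have := DFunLike.congr_fun hN2 w; simpa using this
      refine ⟨ContinuousLinearEquiv.equivOfInverse
        ((ContinuousLinearMap.fst ℝ ℝ F).prod ((f₁ q.1 q.2).coprod (J q.1 q.2)))
        ((ContinuousLinearMap.fst ℝ ℝ F).prod ((N q.1).comp
          ((ContinuousLinearMap.snd ℝ ℝ F) - (f₁ q.1 q.2).comp (ContinuousLinearMap.fst ℝ ℝ F))))
        (fun w => by
          ext
          · simp
          · simp [hN1'])
        (fun w => by
          ext
          · simp
          · simp [hN2']), ?_⟩
      exact hasStrictFDerivAt_fst.prodMk (hstrict q)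
    choose e he using hHd
    have hHc : Continuous H := continuous_fst.prodMk hGc
    have hHo : IsOpenMap H := by
      apply isOpenMap_of_hasStrictFDerivAt_equiv (f' := e)
      exact he
    have hs : ContDiff ℝ 1 (H.toHomeomorphOfContinuousOpen hHc hHo).symm := by
      apply Homeomorph.contDiff_symm (f₀' := e)
      · exact fun q => (he q).hasFDerivAt
      · exact contDiff_fst.prodMk hGC1
    exact contDiff_snd.comp hs
  exact ⟨G, Ψ, J, hu0, fun t z => hu z t, fun z => hM0 _, hJd, hGd, hGC1, hΨC1, hΨG, hGΨ⟩

end flow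
end VP

namespace VP

open Set Filter Topology

abbrev Ph := E3 × E3

instance instHaarPh : (volume : Measure Ph).IsAddHaarMeasure :=
  Measure.prod.instIsAddHaarMeasure (volume : Measure E3) (volume : Measure E3)

section meas

/-- vector field in phase space -/
def phb (Ef : ℝ → E3 → E3) (t : ℝ) (z : Ph) : Ph := (z.2, Ef t z.1)

def phDb (DE : ℝ → E3 → E3 →L[ℝ] E3) (t : ℝ) (z : Ph) : Ph →L[ℝ] Ph :=
  (ContinuousLinearMap.snd ℝ E3 E3).prod ((DE t z.1).comp (ContinuousLinearMap.fst ℝ E3 E3))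

lemma phField {Ef : ℝ → E3 → E3} {DE : ℝ → E3 → E3 →L[ℝ] E3} {K : ℝ → ℝ}
    (hE : C1Field Ef DE K) : C1Field (phb Ef) (phDb DE) (fun t => K t + 1) := by
  refine ⟨?_, hE.contK.add continuous_const, fun t => add_nonneg (hE.nonneg t) zero_le_one, ?_, ?_, ?_⟩
  · exact (continuous_snd.comp continuous_snd).prodMk
      (hE.cont.comp (continuous_fst.prodMk (continuous_fst.comp continuous_snd)))
  · intro t z
    exact (hasFDerivAt_snd).prodMk ((hE.hasFDeriv t z.1).comp z hasFDerivAt_fst)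
  · have h1 : Continuous fun q : ℝ × Ph => (DE q.1 q.2.1).comp (ContinuousLinearMap.fst ℝ E3 E3) :=
      (hE.contD.comp (continuous_fst.prodMk (continuous_fst.comp continuous_snd))).clm_comp
        continuous_const
    exact (ContinuousLinearMap.prodₗᵢ (𝕜 := ℝ) (E := Ph) (F := E3) (G := E3) ℝ).continuous.comp
      (continuous_const.prodMk h1)
  · intro t z
    have h0 := hE.nonneg t
    refine ContinuousLinearMap.opNorm_le_bound _ (by positivity) fun w => ?_
    simp only [phDb, ContinuousLinearMap.prod_apply, ContinuousLinearMap.comp_apply,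
      ContinuousLinearMap.coe_fst', ContinuousLinearMap.coe_snd']
    rw [Prod.norm_def]
    have h2 := norm_snd_le w
    have h1 := norm_fst_le w
    have h3 := ((DE t z.1).le_opNorm w.1).trans
      (mul_le_mul (hE.bound t z.1) h1 (norm_nonneg _) h0)
    have := norm_nonneg w
    refine max_le ?_ ?_ <;> nlinarith [mul_nonneg h0 this]

/-- symplectic form -/
def omegaF : LinearMap.BilinForm ℝ Ph :=
  LinearMap.mk₂ ℝ (fun a b : Ph => inner ℝ a.1 b.2 - inner ℝ a.2 b.1)
    (fun a a' b => by simp [inner_add_left]; ring)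
    (fun c a b => by simp [inner_smul_left]; ring)
    (fun a b b' => by simp [inner_add_right]; ring)
    (fun c a b => by simp [inner_smul_right]; ring)

lemma omegaF_apply (a b : Ph) : omegaF a b = inner ℝ a.1 b.2 - inner ℝ a.2 b.1 := rfl

lemma omegaF_nondeg : omegaF.Nondegenerate := by
  rw [LinearMap.BilinForm.nondegenerate_iff_ker_eq_bot, LinearMap.ker_eq_bot'] 
  intro a h
  have h1 : omegaF a (-a.2, a.1) = 0 := by rw [h]; rfl
  simp only [omegaF_apply, inner_neg_right, sub_neg_eq_add, real_inner_self_eq_norm_sq] at h1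
  have e1 : ‖a.1‖ = 0 := by nlinarith [norm_nonneg a.1, norm_nonneg a.2]
  have e2 : ‖a.2‖ = 0 := by nlinarith [norm_nonneg a.1, norm_nonneg a.2]
  exact Prod.ext (norm_eq_zero.1 e1) (norm_eq_zero.1 e2)

lemma abs_det_one (L : Ph →L[ℝ] Ph) (h : ∀ a b, omegaF (L a) (L b) = omegaF a b) :
    |L.det| = 1 := by
  set bs := Module.finBasis ℝ Ph
  have hc : omegaF.comp (L : Ph →ₗ[ℝ] Ph) (L : Ph →ₗ[ℝ] Ph) = omegaF := by
    ext a b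
    all_goals simp [h]
  have h1 := LinearMap.BilinForm.toMatrix_comp bs bs omegaF (L : Ph →ₗ[ℝ] Ph) (L : Ph →ₗ[ℝ] Ph)
  rw [hc] at h1
  have h2 := congrArg Matrix.det h1
  rw [Matrix.det_mul, Matrix.det_mul, Matrix.det_transpose, LinearMap.det_toMatrix] at h2
  have h3 : (LinearMap.BilinForm.toMatrix bs omegaF).det ≠ 0 :=
    (LinearMap.BilinForm.nondegenerate_iff_det_ne_zero bs).1 omegaF_nondeg
  have h4 : L.det * L.det = 1 := by
    have : (LinearMap.BilinForm.toMatrix bs omegaF).det * (L.det * L.det) = (LinearMap.BilinForm.toMatrix bs omegaF).det * 1 := by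
      rw [mul_one]
      conv_rhs => rw [h2]
      simp only [ContinuousLinearMap.det]; ring
    exact mul_left_cancel₀ h3 this
  have : |L.det| ^ 2 = 1 := by rw [sq_abs, sq, h4]
  have h0 := abs_nonneg L.det
  nlinarith

lemma flow_mp {DE : ℝ → E3 → E3 →L[ℝ] E3}
    (hsym : ∀ t x a b, inner ℝ (DE t x a) b = inner ℝ a (DE t x b))
    {G Ψ : ℝ → Ph → Ph} {J : ℝ → Ph → Ph →L[ℝ] Ph}
    (hJ0 : ∀ z, J 0 z = ContinuousLinearMap.id ℝ Ph)
    (hJd : ∀ t z, HasDerivAt (fun t => J t z) ((phDb DE t (G t z)).comp (J t z)) t)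
    (hG : ∀ t z, HasFDerivAt (G t) (J t z) z)
    (h1 : ∀ t z, Ψ t (G t z) = z) (h2 : ∀ t z, G t (Ψ t z) = z) (t : ℝ) :
    MeasurePreserving (G t) (volume : Measure Ph) volume := by
  have hom : ∀ t z a b, omegaF (J t z a) (J t z b) = omegaF a b := by
    intro t z a b
    have hd : ∀ t, HasDerivAt (fun t => omegaF (J t z a) (J t z b)) 0 t := by
      intro t
      have ha := (hJd t z).clm_apply (hasDerivAt_const t a)
      have hb := (hJd t z).clm_apply (hasDerivAt_const t b)
      simp only [map_zero, add_zero] at ha hb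
      have ha1 := hasFDerivAt_fst.comp_hasDerivAt t ha
      have ha2 := hasFDerivAt_snd.comp_hasDerivAt t ha
      have hb1 := hasFDerivAt_fst.comp_hasDerivAt t hb
      have hb2 := hasFDerivAt_snd.comp_hasDerivAt t hb
      have := (ha1.inner ℝ hb2).sub (ha2.inner ℝ hb1)
      convert! this using 1
      simp only [Function.comp, phDb, ContinuousLinearMap.comp_apply, ContinuousLinearMap.prod_apply,
        ContinuousLinearMap.coe_fst', ContinuousLinearMap.coe_snd', hsym]
      ring
    have := is_const_of_deriv_eq_zero (fun t => (hd t).differentiableAt) (fun t => (hd t).deriv) t 0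
    simpa [hJ0] using this
  have hdet : ∀ z, |(J t z).det| = 1 := fun z => abs_det_one _ (hom t z)
  have hc : Continuous (G t) := continuous_iff_continuousAt.2 fun z => (hG t z).continuousAt
  refine ⟨hc.measurable, ?_⟩
  ext s hs
  rw [Measure.map_apply hc.measurable hs]
  have := lintegral_abs_det_fderiv_eq_addHaar_image (volume : Measure Ph) (hc.measurable hs)
    (fun z _ => (hG t z).hasFDerivWithinAt) (fun a _ b _ hab => by rw [← h1 t a, hab, h1])
  simp only [hdet] at this
  rw [image_preimage_eq s (fun z => ⟨Ψ t z, h2 t z⟩)] at this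
  rw [← this]; simp

end meas
end VP

namespace VP

open Set Filter Topology
open scoped ENNReal

section radial

/-- area of the unit sphere -/
def cS : ℝ := ((volume : Measure E3).toSphere univ).toReal

lemma cS_nonneg : 0 ≤ cS := ENNReal.toReal_nonneg

lemma lradial {φ : ℝ → ℝ≥0∞} (hφ : Measurable φ) :
    ∫⁻ y : E3, φ ‖y‖ = ENNReal.ofReal cS * ∫⁻ r in Ioi (0:ℝ), ENNReal.ofReal (r ^ 2) * φ r := by
  have hmp := (volume : Measure E3).measurePreserving_homeomorphUnitSphereProd
  have h1 : ∫⁻ y : E3, φ ‖y‖ = ∫⁻ y : ({0}ᶜ : Set E3), φ ‖(y:E3)‖ ∂(volume.comap Subtype.val) := by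
    rw [lintegral_subtype_comap (measurableSet_singleton _).compl (fun y : E3 => φ ‖y‖),
      restrict_compl_singleton]
  have h2 := hmp.lintegral_comp (f := fun q => φ (q.2 : ℝ))
    (hφ.comp (measurable_subtype_coe.comp measurable_snd))
  simp only [homeomorphUnitSphereProd_apply_snd_coe] at h2
  rw [h1, h2]
  rw [lintegral_prod (fun q : Metric.sphere (0:E3) 1 × Ioi (0:ℝ) => φ (q.2 : ℝ)) ((hφ.comp (measurable_subtype_coe.comp measurable_snd)).aemeasurable)]
  simp only []
  rw [lintegral_const, mul_comm]
  congr 1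
  · rw [cS, ENNReal.ofReal_toReal (measure_ne_top _ _)]
  · have hd : Module.finrank ℝ E3 - 1 = 2 := by simp
    have hw := lintegral_withDensity_eq_lintegral_mul
      (Measure.comap (Subtype.val : Ioi (0:ℝ) → ℝ) volume)
      (f := fun r : Ioi (0:ℝ) => ENNReal.ofReal (r.1 ^ 2)) (by fun_prop)
      (g := fun r : Ioi (0:ℝ) => φ r.1) (hφ.comp measurable_subtype_coe)
    rw [hd, Measure.volumeIoiPow, hw]
    have := lintegral_subtype_comap (μ := (volume : Measure ℝ)) (measurableSet_Ioi (a := (0:ℝ)))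
      (fun r => ENNReal.ofReal (r ^ 2) * φ r)
    rw [← this]
    rfl

lemma lrad_le {ψ : ℝ → ℝ} (hψ : Measurable ψ) {g : ℝ → ℝ} {c : ℝ}
    (h : ∀ r, 0 < r → r ^ 2 * ψ r ≤ g r)
    (hg : ∫⁻ r in Ioi (0:ℝ), ENNReal.ofReal (g r) ≤ ENNReal.ofReal c) :
    ∫⁻ y : E3, ENNReal.ofReal (ψ ‖y‖) ≤ ENNReal.ofReal (cS * c) := by
  rw [lradial hψ.ennreal_ofReal, ENNReal.ofReal_mul cS_nonneg]
  gcongr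
  refine (setLIntegral_mono' measurableSet_Ioi fun r hr => ?_).trans hg
  rw [← ENNReal.ofReal_mul (sq_nonneg r)]
  exact ENNReal.ofReal_le_ofReal (h r hr)

lemma lint_indicator_const (a c : ℝ) (ha : 0 ≤ a) (hc : 0 ≤ c) :
    ∫⁻ r in Ioi (0:ℝ), ENNReal.ofReal ((Iio a).indicator (fun _ => c) r) ≤ ENNReal.ofReal (a * c) := by
  have : ∀ r : ℝ, ENNReal.ofReal ((Iio a).indicator (fun _ => c) r) =
    (Iio a).indicator (fun _ => ENNReal.ofReal c) r := by
    intro r; by_cases h : r ∈ Iio a <;> simp [h]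
  simp only [this]
  rw [lintegral_indicator_const measurableSet_Iio, Measure.restrict_apply measurableSet_Iio,
    mul_comm, ENNReal.ofReal_mul ha]
  gcongr
  rw [inter_comm, Ioi_inter_Iio, Real.volume_Ioo, sub_zero]

/-- ∫_{|y|<a} |y|⁻² -/
lemma rad_N1 {a : ℝ} (ha : 0 ≤ a) :
    ∫⁻ y : E3, ENNReal.ofReal ((Iio a).indicator (fun r => (r^2)⁻¹) ‖y‖) ≤ ENNReal.ofReal (cS * a) := by
  refine lrad_le (g := (Iio a).indicator (fun _ => 1)) (Measurable.indicator (by fun_prop) measurableSet_Iio) ?_ ?_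
  · intro r hr
    by_cases h : r ∈ Iio a
    · simp only [indicator_of_mem h]; rw [mul_inv_cancel₀ (by positivity)]
    · simp [indicator_of_notMem h]
  · simpa using lint_indicator_const a 1 ha zero_le_one

lemma rad_N3 {a : ℝ} (ha : 0 ≤ a) :
    ∫⁻ y : E3, ENNReal.ofReal ((Iio a).indicator (fun r => r⁻¹) ‖y‖) ≤ ENNReal.ofReal (cS * (a * a)) := by
  refine lrad_le (g := (Iio a).indicator (fun _ => a)) (Measurable.indicator (by fun_prop) measurableSet_Iio) ?_ ?_
  · intro r hr
    by_cases h : r ∈ Iio a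
    · simp only [indicator_of_mem h]
      rw [sq, mul_assoc, mul_inv_cancel₀ hr.ne', mul_one]; exact (mem_Iio.1 h).le
    · simp [indicator_of_notMem h]
  · exact lint_indicator_const a a ha ha

lemma lint_inv (a b : ℝ) (ha : 0 < a) (hab : a ≤ b) :
    ∫⁻ r in Ioi (0:ℝ), ENNReal.ofReal ((Icc a b).indicator (fun r => r⁻¹) r)
      ≤ ENNReal.ofReal (log (b / a)) := by
  have : ∀ r : ℝ, ENNReal.ofReal ((Icc a b).indicator (fun r => r⁻¹) r) =
    (Icc a b).indicator (fun r => ENNReal.ofReal r⁻¹) r := by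
    intro r; by_cases h : r ∈ Icc a b <;> simp [h]
  simp only [this]
  rw [← integral_inv_of_pos ha (ha.trans_le hab), intervalIntegral.integral_of_le hab,
    ofReal_integral_eq_lintegral_ofReal]
  · refine (setLIntegral_le_lintegral _ _).trans ?_
    rw [lintegral_indicator measurableSet_Icc, Measure.restrict_congr_set Ioc_ae_eq_Icc]
  · have : IntervalIntegrable (fun r : ℝ => r⁻¹) volume a b := by
      apply intervalIntegral.intervalIntegrable_inv (fun x hx => ?_) continuousOn_id
      rw [uIcc_of_le hab] at hx
      exact (ha.trans_le hx.1).ne'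
    exact this.1
  · filter_upwards [ae_restrict_mem measurableSet_Ioc] with x hx
    exact inv_nonneg.2 (ha.trans hx.1).le

/-- ∫_{a≤|w|≤b} |w|⁻³ -/
lemma rad_N2 {a b : ℝ} (ha : 0 < a) (hab : a ≤ b) :
    ∫⁻ y : E3, ENNReal.ofReal ((Icc a b).indicator (fun r => (r^3)⁻¹) ‖y‖)
      ≤ ENNReal.ofReal (cS * log (b / a)) := by
  refine lrad_le (g := (Icc a b).indicator (fun r => r⁻¹))
    (Measurable.indicator (by fun_prop) measurableSet_Icc) ?_ (lint_inv a b ha hab)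
  intro r hr
  by_cases h : r ∈ Icc a b
  · simp only [indicator_of_mem h]; apply le_of_eq; field_simp
  · simp [indicator_of_notMem h]

lemma lint_arctan (d : ℝ) (hd : 0 < d) :
    ∫⁻ r in Ioi (0:ℝ), ENNReal.ofReal (d^2 / (r^2 + d^2)) ≤ ENNReal.ofReal (d * π) := by
  have hi : Integrable (fun r : ℝ => d^2 / (r^2 + d^2)) := by
    have := (integrable_inv_one_add_sq).comp_div hd.ne'
    refine this.congr (Eventually.of_forall fun r => ?_)
    simp only; field_simp; ring
  have hv : ∫ r : ℝ, d^2 / (r^2 + d^2) = d * π := by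
    have := Measure.integral_comp_div (fun r : ℝ => (1 + r^2)⁻¹) d
    rw [integral_univ_inv_one_add_sq, abs_of_pos hd, smul_eq_mul] at this
    rw [← this]
    congr 1; ext r; field_simp; ring
  rw [← hv, ofReal_integral_eq_lintegral_ofReal hi (Eventually.of_forall fun r => by positivity)]
  exact setLIntegral_le_lintegral _ _

lemma rad_N4 : ∫⁻ w : E3, ENNReal.ofReal (((1 + ‖w‖^2)^2)⁻¹) ≤ ENNReal.ofReal (cS * π) := by
  refine lrad_le (ψ := fun r => ((1 + r^2)^2)⁻¹) (g := fun r => 1^2 / (r^2 + 1^2)) (by fun_prop) ?_ ?_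
  · intro r hr
    rw [← div_eq_mul_inv, div_le_div_iff₀ (by positivity) (by positivity)]
    nlinarith [sq_nonneg r]
  · simpa using lint_arctan 1 one_pos

lemma rad_N5 {d : ℝ} (hd : 0 < d) :
    ∫⁻ y : E3, ENNReal.ofReal (3 * d^2 / (‖y‖^2 * (‖y‖^2 + d^2))) ≤ ENNReal.ofReal (cS * (3 * (d * π))) := by
  refine lrad_le (ψ := fun r => 3 * d^2 / (r^2 * (r^2 + d^2))) (g := fun r => 3 * (d^2 / (r^2 + d^2))) 
    (by fun_prop) ?_ ?_
  · intro r hr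
    apply le_of_eq; field_simp
  · simp only [ENNReal.ofReal_mul zero_le_three]
    rw [lintegral_const_mul _ (by fun_prop)]
    gcongr
    exact lint_arctan d hd

lemma rad_N6 {d A : ℝ} (hd : 0 < d) (hA : d ≤ A) :
    ∫⁻ y : E3, ENNReal.ofReal ((Iio A).indicator (fun r => ((√(r^2 + d^2))^3)⁻¹) ‖y‖)
      ≤ ENNReal.ofReal (cS * (1 + log (A / d))) := by
  refine lrad_le (g := fun r => (Iio d).indicator (fun _ => d⁻¹) r + (Icc d A).indicator (fun r => r⁻¹) r) 
    (Measurable.indicator (by fun_prop) measurableSet_Iio) ?_ ?_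
  · intro r hr
    have hs : 0 < √(r^2+d^2) := by positivity
    by_cases h : r < d
    · have hd' : d ≤ √(r^2 + d^2) := Real.le_sqrt_of_sq_le (by nlinarith)
      rw [indicator_of_mem (mem_Iio.2 (h.trans_le hA)), indicator_of_mem (mem_Iio.2 h),
        indicator_of_notMem (by simp [h]), add_zero, ← div_eq_mul_inv, ← one_div,
        div_le_div_iff₀ (by positivity) hd]
      have : d^3 ≤ √(r^2 + d^2)^3 := by gcongr
      nlinarith [mul_le_mul h.le h.le hr.le hd.le]
    · by_cases h2 : r < A
      · have hd' : r ≤ √(r^2 + d^2) := Real.le_sqrt_of_sq_le (by nlinarith)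
        rw [indicator_of_mem (mem_Iio.2 h2), indicator_of_notMem (by simpa using h),
          indicator_of_mem (mem_Icc.2 ⟨not_lt.1 h, h2.le⟩), zero_add, ← div_eq_mul_inv, ← one_div,
          div_le_div_iff₀ (by positivity) hr]
        have : r^3 ≤ √(r^2 + d^2)^3 := by gcongr
        nlinarith
      · rw [indicator_of_notMem (by simpa using h2), mul_zero]
        refine add_nonneg (indicator_nonneg (fun _ _ => by positivity) _)
          (indicator_nonneg (fun x hx => inv_nonneg.2 (hd.le.trans hx.1)) _)
  · refine (lintegral_mono fun r => ENNReal.ofReal_add_le).trans ?_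
    rw [lintegral_add_left ((Measurable.indicator measurable_const measurableSet_Iio).ennreal_ofReal),
      ENNReal.ofReal_add zero_le_one (log_nonneg ((one_le_div hd).2 hA))]
    refine add_le_add ?_ (lint_inv d A hd hA)
    have := lint_indicator_const d d⁻¹ hd.le (by positivity)
    rwa [mul_inv_cancel₀ hd.ne'] at this

end radial
end VP

namespace VP

open Set Filter Topology
open scoped ENNReal

section kernel

/-- regularised norm -/
def nn (ε : ℝ) (x : E3) : ℝ := √(‖x‖^2 + ε^2)

/-- regularised kernel -/
def kk (ε : ℝ) (x : E3) : E3 := ((nn ε x)^3)⁻¹ • x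

def Dkk (ε : ℝ) (x : E3) : E3 →L[ℝ] E3 :=
  ((nn ε x)^3)⁻¹ • ContinuousLinearMap.id ℝ E3 -
    (3 * ((nn ε x)^5)⁻¹) • (innerSL ℝ x).smulRight x

lemma nn_nonneg (ε : ℝ) (x : E3) : 0 ≤ nn ε x := Real.sqrt_nonneg _

lemma nn_sq (ε : ℝ) (x : E3) : nn ε x ^ 2 = ‖x‖^2 + ε^2 := Real.sq_sqrt (by positivity)

lemma norm_le_nn (ε : ℝ) (x : E3) : ‖x‖ ≤ nn ε x := Real.le_sqrt_of_sq_le (by nlinarith [sq_nonneg ε])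

lemma le_nn {ε : ℝ} (x : E3) : ε ≤ nn ε x := Real.le_sqrt_of_sq_le (by nlinarith [sq_nonneg ‖x‖])

lemma nn_pos {ε : ℝ} (hε : 0 < ε) (x : E3) : 0 < nn ε x := hε.trans_le (le_nn x)

lemma nn_cont (ε : ℝ) : Continuous (nn ε) := by unfold nn; fun_prop

lemma nn_neg (ε : ℝ) (x : E3) : nn ε (-x) = nn ε x := by simp [nn]

lemma kk_neg (ε : ℝ) (x : E3) : kk ε (-x) = - kk ε x := by simp [kk, nn_neg]

lemma kk_meas (ε : ℝ) : Measurable (kk ε) := by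
  unfold kk
  exact (((nn_cont ε).measurable.pow_const 3).inv).smul measurable_id

lemma kk_norm (ε : ℝ) (x : E3) : ‖kk ε x‖ ≤ (‖x‖^2)⁻¹ := by
  by_cases hx : x = 0
  · simp [kk, hx]
  have hx : 0 < ‖x‖ := norm_pos_iff.2 hx
  have h := norm_le_nn ε x
  have h' := nn_nonneg ε x
  have hn : 0 < nn ε x := hx.trans_le h
  rw [kk, norm_smul, norm_inv, norm_pow, Real.norm_of_nonneg h', ← div_eq_inv_mul, ← one_div,
    div_le_div_iff₀ (by positivity) (by positivity), one_mul]
  calc ‖x‖ * ‖x‖^2 = ‖x‖^3 := by ring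
    _ ≤ _ := by gcongr

lemma kk_norm' {ε : ℝ} (hε : 0 < ε) (x : E3) : ‖kk ε x‖ ≤ (ε^2)⁻¹ := by
  have hn := nn_pos hε x
  have h := norm_le_nn ε x
  have h2 := le_nn (ε := ε) x
  rw [kk, norm_smul, norm_inv, norm_pow, Real.norm_of_nonneg hn.le, ← div_eq_inv_mul, ← one_div,
    div_le_div_iff₀ (by positivity) (by positivity), one_mul]
  calc ‖x‖ * ε^2 ≤ nn ε x * nn ε x ^2 := by gcongr
    _ = _ := by ring

lemma nn_hasFDeriv {ε : ℝ} (hε : 0 < ε) (x : E3) :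
    HasFDerivAt (nn ε) ((nn ε x)⁻¹ • innerSL ℝ x) x := by
  have h1 : HasFDerivAt (fun x : E3 => ‖x‖^2 + ε^2) (2 • innerSL ℝ x) x :=
    (hasStrictFDerivAt_norm_sq x).hasFDerivAt.add_const _
  have h2 := h1.sqrt (by positivity)
  convert! h2 using 1
  ext w
  simp [nn]
  field_simp

lemma nn_inv_hasFDeriv {ε : ℝ} (hε : 0 < ε) (x : E3) :
    HasFDerivAt (fun x => (nn ε x)⁻¹) (-(innerSL ℝ (kk ε x))) x := by
  have hn := nn_pos hε x
  have := (hasDerivAt_inv hn.ne').comp_hasFDerivAt x (nn_hasFDeriv hε x)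
  convert! this using 1
  ext w
  simp [kk, inner_smul_left]
  field_simp

lemma kk_hasFDeriv {ε : ℝ} (hε : 0 < ε) (x : E3) : HasFDerivAt (kk ε) (Dkk ε x) x := by
  have hn := nn_pos hε x
  have h1 : HasFDerivAt (fun x => ((nn ε x)^3)⁻¹) (-((3 * ((nn ε x)^5)⁻¹)) • innerSL ℝ x) x := by
    have := ((hasDerivAt_pow 3 (nn ε x)).fun_inv (by positivity)).comp_hasFDerivAt x (nn_hasFDeriv hε x)
    convert! this using 1
    ext w
    simp
    field_simp
  have h2 := h1.smul (hasFDerivAt_id x)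
  convert! h2 using 1
  ext w
  simp [Dkk]
  ring

lemma Dkk_cont {ε : ℝ} (hε : 0 < ε) : Continuous (Dkk ε) := by
  unfold Dkk
  have hn := nn_cont ε
  have h3 : Continuous fun x => ((nn ε x)^3)⁻¹ := (hn.pow 3).inv₀ fun x => (pow_pos (nn_pos hε x) 3).ne'
  have h5 : Continuous fun x => ((nn ε x)^5)⁻¹ := (hn.pow 5).inv₀ fun x => (pow_pos (nn_pos hε x) 5).ne'
  refine (h3.smul continuous_const).sub ((continuous_const.mul h5).smul ?_)
  have := (ContinuousLinearMap.smulRightL ℝ E3 E3)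
  exact (((ContinuousLinearMap.smulRightL ℝ E3 E3).continuous.comp (innerSL ℝ).continuous).clm_apply
    continuous_id)

lemma Dkk_norm {ε : ℝ} (hε : 0 < ε) (x : E3) : ‖Dkk ε x‖ ≤ 4 * ((nn ε x)^3)⁻¹ := by
  have hn := nn_pos hε x
  have h := norm_le_nn ε x
  refine ContinuousLinearMap.opNorm_le_bound _ (by positivity) fun w => ?_
  simp only [Dkk, _root_.sub_apply, _root_.smul_apply,
    ContinuousLinearMap.id_apply, ContinuousLinearMap.smulRight_apply, innerSL_apply_apply]
  refine (norm_sub_le _ _).trans ?_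
  rw [norm_smul, norm_smul, norm_smul, Real.norm_of_nonneg (by positivity : 0 ≤ ((nn ε x)^3)⁻¹),
    Real.norm_of_nonneg (by positivity : 0 ≤ 3 * ((nn ε x)^5)⁻¹)]
  have hi : ‖inner ℝ x w‖ ≤ nn ε x * ‖w‖ := (norm_inner_le_norm x w).trans (by gcongr)
  have h2 : ‖inner ℝ x w‖ * ‖x‖ ≤ (nn ε x * ‖w‖) * nn ε x := by gcongr
  calc _ ≤ ((nn ε x)^3)⁻¹ * ‖w‖ + 3 * ((nn ε x)^5)⁻¹ * ((nn ε x * ‖w‖) * nn ε x) := by gcongr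
    _ = _ := by field_simp; ring

lemma Dkk_norm' {ε : ℝ} (hε : 0 < ε) (x : E3) : ‖Dkk ε x‖ ≤ 4 * (ε^3)⁻¹ := by
  refine (Dkk_norm hε x).trans ?_
  have := le_nn (ε := ε) x
  gcongr

lemma Dkk_symm (ε : ℝ) (x a b : E3) : inner ℝ (Dkk ε x a) b = inner ℝ a (Dkk ε x b) := by
  simp only [Dkk, _root_.sub_apply, _root_.smul_apply,
    ContinuousLinearMap.id_apply, ContinuousLinearMap.smulRight_apply, innerSL_apply_apply,
    inner_sub_left, inner_sub_right, inner_smul_left, inner_smul_right, real_inner_comm a x]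
  simp
  left; ring

lemma kk_lip {ε : ℝ} (hε : 0 < ε) (x y : E3) : ‖kk ε x - kk ε y‖ ≤ 4 * (ε^3)⁻¹ * ‖x - y‖ :=
  convex_univ.norm_image_sub_le_of_norm_hasFDerivWithin_le
      (fun z _ => (kk_hasFDeriv hε z).hasFDerivWithinAt) (fun z _ => Dkk_norm' hε z) (mem_univ y)
      (mem_univ x)

lemma kk_uc {ε : ℝ} (hε : 0 < ε) : UniformContinuous (kk ε) := by
  have : LipschitzWith ⟨4 * (ε^3)⁻¹, by positivity⟩ (kk ε) :=
    LipschitzWith.of_dist_le_mul fun x y => by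
      rw [dist_eq_norm, dist_eq_norm]; exact kk_lip hε x y
  exact this.uniformContinuous

lemma Dkk_uc {ε : ℝ} (hε : 0 < ε) : UniformContinuous (Dkk ε) := by
  refine (Dkk_cont hε).uniformContinuous_of_tendsto_cocompact (x := 0) ?_
  rw [tendsto_zero_iff_norm_tendsto_zero]
  have h1 : Tendsto (nn ε) (cocompact E3) atTop :=
    tendsto_atTop_mono (norm_le_nn ε) (tendsto_norm_cocompact_atTop)
  have h2 : Tendsto (fun x => 4 * ((nn ε x)^3)⁻¹) (cocompact E3) (𝓝 (4 * 0)) :=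
    ((tendsto_pow_atTop three_ne_zero).comp h1).inv_tendsto_atTop.const_mul 4
  rw [mul_zero] at h2
  exact squeeze_zero (fun _ => norm_nonneg _) (Dkk_norm hε) h2

lemma kk_diff {ε d : ℝ} (hε : 0 ≤ ε) (hd : 0 < d) (hεd : ε ≤ d) (x : E3) :
    ‖kk ε x - kk d x‖ ≤ 3 * d^2 / (‖x‖^2 * (‖x‖^2 + d^2)) := by
  by_cases hx : x = 0
  · simp [kk, hx]
  have ha : 0 < ‖x‖ := norm_pos_iff.2 hx
  have h1 := norm_le_nn ε x
  have h2 := norm_le_nn d x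
  have h3 : nn ε x ≤ nn d x := Real.sqrt_le_sqrt (by nlinarith)
  have hn : 0 < nn ε x := ha.trans_le h1
  have hN : 0 < nn d x := nn_pos hd x
  rw [kk, kk, ← sub_smul, norm_smul, Real.norm_of_nonneg (by
    rw [sub_nonneg]; gcongr), ← nn_sq]
  set a := ‖x‖
  set n := nn d x with hndef
  have hsq : n^2 = a^2 + d^2 := nn_sq d x
  calc ((nn ε x ^ 3)⁻¹ - (n^3)⁻¹) * a ≤ ((a^3)⁻¹ - (n^3)⁻¹) * a := by gcongr
    _ = (n^3 - a^3) / (a^2 * n^3) := by field_simp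
    _ ≤ 3 * d^2 / (a^2 * n^2) := by
      rw [div_le_div_iff₀ (by positivity) (by positivity)]
      have h5 : n^3 - a^3 ≤ 3 * d^2 * n := by
        have : d^2 = (n - a) * (n + a) := by nlinarith
        rw [this]
        have e : 3 * ((n - a) * (n + a)) * n - (n^3 - a^3) = (n - a) * (2 * n^2 + 2*n*a - a^2) := by ring
        have : 0 ≤ (n - a) * (2 * n^2 + 2*n*a - a^2) :=
          mul_nonneg (by linarith) (by nlinarith)
        linarith
      calc (n^3 - a^3) * (a^2 * n^2) ≤ (3 * d^2 * n) * (a^2 * n^2) := by gcongr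
        _ = _ := by ring

lemma kk_diff_lint {ε d : ℝ} (hε : 0 ≤ ε) (hd : 0 < d) (hεd : ε ≤ d) :
    ∫⁻ x : E3, ‖kk ε x - kk d x‖ₑ ≤ ENNReal.ofReal (cS * (3 * (d * π))) := by
  refine (lintegral_mono fun x => ?_).trans (rad_N5 hd)
  rw [← ofReal_norm]
  exact ENNReal.ofReal_le_ofReal (kk_diff hε hd hεd x)

end kernel
end VP

namespace VP

open Set Filter Topology
open scoped ENNReal BoundedContinuousFunction

structure Data (f₀ : Ph → ℝ) (γ R M ℓ : ℝ) : Prop where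
  cont : Continuous f₀
  nonneg : ∀ z, 0 ≤ f₀ z
  Rpos : 0 < R
  supp : ∀ z, f₀ z ≠ 0 → ‖z‖ ≤ R
  le : ∀ z, f₀ z ≤ M
  lip : ∀ z z', |f₀ z - f₀ z'| ≤ ℓ * ‖z - z'‖
  gam : |γ| ≤ 1

/-- total mass -/
def mass (f₀ : Ph → ℝ) : ℝ := ∫ z, f₀ z

section
variable {f₀ : Ph → ℝ} {γ R M ℓ : ℝ} (D : Data f₀ γ R M ℓ)
include D

lemma Data.Mnn : 0 ≤ M := (D.nonneg 0).trans (D.le 0)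

lemma Data.cs : HasCompactSupport f₀ :=
  HasCompactSupport.intro (isCompact_closedBall (0 : Ph) R) fun z hz => by
    by_contra h
    exact hz (by simpa using D.supp z h)

lemma Data.integrable : Integrable f₀ := D.cont.integrable_of_hasCompactSupport D.cs

lemma Data.mass_nonneg : 0 ≤ mass f₀ := integral_nonneg D.nonneg

variable {V : Type*} [NormedAddCommGroup V] [NormedSpace ℝ V]

lemma Data.int_w {a : Ph → V} (ha : Continuous a) : Integrable fun z => f₀ z • a z :=
  (D.cont.smul ha).integrable_of_hasCompactSupport D.cs.smul_right

lemma Data.norm_int_le {a : Ph → V} {c : ℝ} (h : ∀ z, f₀ z ≠ 0 → ‖a z‖ ≤ c) :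
    ‖∫ z, f₀ z • a z‖ ≤ mass f₀ * c := by
  rw [mass, ← integral_mul_const]
  refine norm_integral_le_of_norm_le (D.integrable.mul_const c) (Eventually.of_forall fun z => ?_)
  rw [norm_smul, Real.norm_of_nonneg (D.nonneg z)]
  by_cases hz : f₀ z = 0
  · simp [hz]
  · exact mul_le_mul_of_nonneg_left (h z hz) (D.nonneg z)

lemma Data.norm_int_sub_le {a b : Ph → V} (ha : Continuous a) (hb : Continuous b) {c : ℝ}
    (h : ∀ z, f₀ z ≠ 0 → ‖a z - b z‖ ≤ c) :
    ‖(∫ z, f₀ z • a z) - ∫ z, f₀ z • b z‖ ≤ mass f₀ * c := by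
  rw [← integral_sub (D.int_w ha) (D.int_w hb)]
  simp only [← smul_sub]
  exact D.norm_int_le h

lemma Data.exists_conv {κ : E3 → V} (hκ : UniformContinuous κ) {C : ℝ} (hC : ∀ x, ‖κ x‖ ≤ C) :
    ∃ Φ : (Ph →ᵇ Ph) → (E3 →ᵇ V), Continuous Φ ∧
      ∀ u x, Φ u x = ∫ z, f₀ z • κ (x - (u z).1) := by
  have hm := D.mass_nonneg
  have hcont : ∀ (u : Ph →ᵇ Ph) (x : E3), Continuous fun z => κ (x - (u z).1) := fun u x =>
    hκ.continuous.comp (continuous_const.sub (continuous_fst.comp u.continuous))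
  have key : ∀ e, 0 < e → ∃ δ > 0, ∀ (u u' : Ph →ᵇ Ph) (x x' : E3),
      (∀ z, ‖(x - (u z).1) - (x' - (u' z).1)‖ < δ) →
      ‖(∫ z, f₀ z • κ (x - (u z).1)) - ∫ z, f₀ z • κ (x' - (u' z).1)‖ < e := by
    intro e he
    obtain ⟨δ, hδ, h⟩ := Metric.uniformContinuous_iff.1 hκ (e / (mass f₀ + 1)) (by positivity)
    refine ⟨δ, hδ, fun u u' x x' hd => ?_⟩
    refine (D.norm_int_sub_le (hcont u x) (hcont u' x') (c := e / (mass f₀ + 1))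
      fun z _ => ?_).trans_lt ?_
    · rw [← dist_eq_norm]; exact (h (by rw [dist_eq_norm]; exact hd z)).le
    · rw [mul_div_assoc', div_lt_iff₀ (by positivity)]; nlinarith
  refine ⟨fun u => BoundedContinuousFunction.ofNormedAddCommGroup
    (fun x => ∫ z, f₀ z • κ (x - (u z).1)) ?_ (mass f₀ * C) (fun x => D.norm_int_le fun z _ => hC _),
    ?_, fun u x => rfl⟩
  · rw [Metric.continuous_iff]
    intro x e he
    obtain ⟨δ, hδ, h⟩ := key e he
    refine ⟨δ, hδ, fun x' hx' => ?_⟩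
    rw [dist_eq_norm] at hx' ⊢
    exact h _ _ _ _ fun z => by simpa using hx'
  · rw [Metric.continuous_iff]
    intro u e he
    obtain ⟨δ, hδ, h⟩ := key (e/2) (by positivity)
    refine ⟨δ, hδ, fun u' hu' => ?_⟩
    refine lt_of_le_of_lt ?_ (half_lt_self he)
    rw [BoundedContinuousFunction.dist_le (by positivity)]
    intro x
    rw [dist_eq_norm]
    refine (h u' u x x fun z => ?_).le
    have h1 : ‖(u' z).1 - (u z).1‖ ≤ dist u' u := by
      rw [← dist_eq_norm]
      exact (le_max_left _ (dist (u' z).2 (u z).2)).trans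
        (BoundedContinuousFunction.dist_coe_le_dist (f := u') (g := u) z)
    rw [sub_sub_sub_cancel_left, norm_sub_rev]
    exact h1.trans_lt hu'

end

/-- A solution of the regularised system. -/
structure Reg (f₀ : Ph → ℝ) (γ ε : ℝ) where
  G : ℝ → Ph → Ph
  Ψ : ℝ → Ph → Ph
  E : ℝ → E3 →ᵇ E3
  DE : ℝ → E3 →ᵇ (E3 →L[ℝ] E3)
  contE : Continuous E
  contDE : Continuous DE
  G0 : ∀ z, G 0 z = z
  ode : ∀ t z, HasDerivAt (fun t => G t z) ((G t z).2, E t (G t z).1) t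
  Eeq : ∀ t x, E t x = γ • ∫ z, f₀ z • kk ε (x - (G t z).1)
  hasD : ∀ t x, HasFDerivAt (E t) (DE t x) x
  contG : Continuous (Function.uncurry G)
  contΨ : Continuous (Function.uncurry Ψ)
  ΨG : ∀ t z, Ψ t (G t z) = z
  GΨ : ∀ t z, G t (Ψ t z) = z
  mp : ∀ t, MeasurePreserving (G t) (volume : Measure Ph) volume

lemma exists_init {R : ℝ} (hR : 0 < R) : ∃ c : Ph →ᵇ Ph, ∀ z, ‖z‖ ≤ R → c z = z := by
  have hp : ∀ z : Ph, 0 < max R ‖z‖ := fun z => lt_max_of_lt_left hR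
  refine ⟨BoundedContinuousFunction.ofNormedAddCommGroup (fun z => (R / max R ‖z‖) • z) ?_ R ?_, ?_⟩
  · exact (continuous_const.div (continuous_const.max continuous_norm) fun z => (hp z).ne').smul
      continuous_id
  · intro z
    rw [norm_smul, Real.norm_of_nonneg (by have := hp z; positivity), div_mul_eq_mul_div,
      div_le_iff₀ (hp z)]
    exact mul_le_mul_of_nonneg_left (le_max_right _ _) hR.le
  · intro z hz
    simp [hz, hR.ne']

lemma C1Field.ofBCF {E : ℝ → E3 →ᵇ E3} {DE : ℝ → E3 →ᵇ (E3 →L[ℝ] E3)} (hE : Continuous E)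
    (hDE : Continuous DE) (hasD : ∀ t x, HasFDerivAt (E t) (DE t x) x) :
    C1Field (fun t x => E t x) (fun t x => DE t x) (fun t => ‖DE t‖) where
  cont := ContinuousEval.continuous_eval.comp (hE.prodMap continuous_id)
  contK := by
    have h : Continuous fun t => dist (DE t) 0 := hDE.dist continuous_const
    exact h
  nonneg := fun t => norm_nonneg (DE t)
  hasFDeriv := hasD
  contD := ContinuousEval.continuous_eval.comp (hDE.prodMap continuous_id)
  bound := fun t x => (DE t).norm_coe_le_norm x

theorem Data.exists_reg {f₀ : Ph → ℝ} {γ R M ℓ : ℝ} (D : Data f₀ γ R M ℓ) {ε : ℝ} (hε : 0 < ε) :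
    Nonempty (Reg f₀ γ ε) := by
  obtain ⟨Φ, hΦc, hΦ⟩ := D.exists_conv (kk_uc hε) (kk_norm' hε)
  obtain ⟨Φ', hΦ'c, hΦ'⟩ := D.exists_conv (Dkk_uc hε) (Dkk_norm' hε)
  have hm := D.mass_nonneg
  -- the field
  set b : (Ph →ᵇ Ph) → (Ph →ᵇ Ph) := fun u => BoundedContinuousFunction.ofNormedAddCommGroup
    (fun z => ((u z).2, γ • Φ u (u z).1))
    ((continuous_snd.comp u.continuous).prodMk
      (((Φ u).continuous.comp (continuous_fst.comp u.continuous)).const_smul γ))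
    (‖u‖ + ‖Φ u‖) (fun z => by
      refine max_le ?_ ?_
      · exact (norm_snd_le _).trans ((u.norm_coe_le_norm z).trans (by simp))
      · rw [norm_smul]
        refine (mul_le_mul D.gam ((Φ u).norm_coe_le_norm _) (norm_nonneg _) zero_le_one).trans (by simp))
    with hb
  have hbapp : ∀ u z, b u z = ((u z).2, γ • Φ u (u z).1) := fun u z => rfl
  set K : ℝ := 1 + mass f₀ * (4 * (ε^3)⁻¹ * 2) with hK
  have hK0 : 0 ≤ K := by positivity
  have hlip : ∀ u u', ‖b u - b u'‖ ≤ K * ‖u - u'‖ := by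
    intro u u'
    rw [BoundedContinuousFunction.norm_le (by positivity)]
    intro z
    have hzz : ∀ z, ‖u z - u' z‖ ≤ ‖u - u'‖ := fun z => (u - u').norm_coe_le_norm z
    have hd := norm_nonneg (u - u')
    rw [BoundedContinuousFunction.coe_sub, Pi.sub_apply, hbapp, hbapp]
    refine max_le ?_ ?_
    · refine ((norm_snd_le (u z - u' z)).trans (hzz z)).trans ?_
      rw [hK, add_mul, one_mul]
      have : 0 ≤ mass f₀ * (4 * (ε^3)⁻¹ * 2) := by positivity
      nlinarith
    · simp only [Prod.snd_sub, ← smul_sub, norm_smul, hΦ]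
      have h1 : ‖(∫ z', f₀ z' • kk ε ((u z).1 - (u z').1)) - ∫ z', f₀ z' • kk ε ((u' z).1 - (u' z').1)‖
        ≤ mass f₀ * (4 * (ε^3)⁻¹ * (2 * ‖u - u'‖)) := by
        refine D.norm_int_sub_le ?_ ?_ fun z' _ => (kk_lip hε _ _).trans ?_
        · exact (kk_uc hε).continuous.comp (continuous_const.sub (continuous_fst.comp u.continuous))
        · exact (kk_uc hε).continuous.comp (continuous_const.sub (continuous_fst.comp u'.continuous))
        · gcongr
          have e : (u z).1 - (u z').1 - ((u' z).1 - (u' z').1) = (u z - u' z).1 - (u z' - u' z').1 := by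
            simp only [Prod.fst_sub]; abel
          rw [e]
          refine (norm_sub_le _ _).trans ?_
          linarith [(norm_fst_le (u z - u' z)).trans (hzz z), (norm_fst_le (u z' - u' z')).trans (hzz z')]
      refine (mul_le_mul D.gam h1 (norm_nonneg _) zero_le_one).trans ?_
      rw [hK]; nlinarith
  have hbc : Continuous b := by
    have : LipschitzWith ⟨K, hK0⟩ b := LipschitzWith.of_dist_le_mul fun x y => by
      rw [dist_eq_norm, dist_eq_norm]; exact hlip x y
    exact this.continuous
  have hL : LipField (fun (_ : ℝ) u => b u) (fun _ => K) :=
    ⟨hbc.comp continuous_snd, continuous_const, fun _ => hK0, fun _ => hlip⟩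
  obtain ⟨c, hc⟩ := exists_init D.Rpos
  obtain ⟨u, hu0, hu⟩ := hL.exists_sol 0 c
  have huc : Continuous u := continuous_iff_continuousAt.2 fun t => (hu t).continuousAt
  have huz : ∀ t z, HasDerivAt (fun t => u t z) ((u t z).2, γ • Φ (u t) (u t z).1) t := by
    intro t z
    exact (BoundedContinuousFunction.evalCLM ℝ z).hasFDerivAt.comp_hasDerivAt t (hu t)
  set E : ℝ → E3 →ᵇ E3 := fun t => γ • Φ (u t) with hE
  set DE : ℝ → E3 →ᵇ (E3 →L[ℝ] E3) := fun t => γ • Φ' (u t) with hDE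
  have hEc : Continuous E := (hΦc.comp huc).const_smul γ
  have hDEc : Continuous DE := (hΦ'c.comp huc).const_smul γ
  have hkc : ∀ t x, Continuous fun z => kk ε (x - (u t z).1) := fun t x =>
    (kk_uc hε).continuous.comp (continuous_const.sub (continuous_fst.comp (u t).continuous))
  have hDkc : ∀ t x, Continuous fun z => Dkk ε (x - (u t z).1) := fun t x =>
    (Dkk_uc hε).continuous.comp (continuous_const.sub (continuous_fst.comp (u t).continuous))
  have hasD : ∀ t x, HasFDerivAt (E t) (DE t x) x := by
    intro t x
    have : HasFDerivAt (fun x => ∫ z, f₀ z • kk ε (x - (u t z).1))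
        (∫ z, f₀ z • Dkk ε (x - (u t z).1)) x := by
      refine hasFDerivAt_integral_of_dominated_of_fderiv_le (s := univ)
        (F := fun x z => f₀ z • kk ε (x - (u t z).1))
        (F' := fun x z => f₀ z • Dkk ε (x - (u t z).1))
        (bound := fun z => f₀ z * (4 * (ε^3)⁻¹)) univ_mem
        (Eventually.of_forall fun x => (D.int_w (hkc t x)).aestronglyMeasurable)
        (D.int_w (hkc t x)) (D.int_w (hDkc t x)).aestronglyMeasurable
        (Eventually.of_forall fun z x _ => ?_) (D.integrable.mul_const _)
        (Eventually.of_forall fun z x _ => ?_)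
      · rw [norm_smul, Real.norm_of_nonneg (D.nonneg z)]
        exact mul_le_mul_of_nonneg_left (Dkk_norm' hε _) (D.nonneg z)
      · have h1 := (kk_hasFDeriv hε (x - (u t z).1)).comp x ((hasFDerivAt_id x).sub_const (u t z).1)
        exact h1.const_smul (f₀ z)
    have h2 := this.const_smul γ
    have e1 : (E t : E3 → E3) = fun x => γ • ∫ z, f₀ z • kk ε (x - (u t z).1) := by
      funext x; simp [hE, hΦ]
    have e2 : DE t x = γ • ∫ z, f₀ z • Dkk ε (x - (u t z).1) := by
      simp [hDE, hΦ']
    rw [e1, e2]; exact h2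
  have hsym : ∀ t x a b, inner ℝ (DE t x a) b = inner ℝ a (DE t x b) := by
    intro t x a b
    have e2 : DE t x = γ • ∫ z, f₀ z • Dkk ε (x - (u t z).1) := by
      simp [hDE, hΦ']
    have hi := D.int_w (hDkc t x)
    rw [e2, _root_.smul_apply, _root_.smul_apply, inner_smul_left, inner_smul_right,
      ContinuousLinearMap.integral_apply hi, ContinuousLinearMap.integral_apply hi,
      ← integral_inner (hi.apply_continuousLinearMap b), real_inner_comm,
      ← integral_inner (hi.apply_continuousLinearMap a)]
    simp only [_root_.smul_apply, inner_smul_right, conj_trivial]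
    congr 2; funext z
    rw [real_inner_comm, Dkk_symm]
  have hC1 := C1Field.ofBCF hEc hDEc hasD
  obtain ⟨G, Ψ, J, hG0, hGd, hJ0, hJd, hGJ, hGC, hΨC, h1, h2⟩ := (phField hC1).exists_flow
  have hGu : ∀ z, ‖z‖ ≤ R → ∀ t, G t z = u t z := by
    intro z hz t
    have := (phField hC1).lipField.unique (u := fun t => G t z) (v := fun t => u t z)
      (fun t => hGd t z) (fun t => huz t z) (t₀ := 0) (by simp [hG0, hu0, hc z hz])
    exact congrFun this t
  refine ⟨⟨G, Ψ, E, DE, hEc, hDEc, hG0, hGd, ?_, hasD, hGC.continuous, hΨC.continuous, h1, h2,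
    flow_mp hsym hJ0 hJd hGJ h1 h2⟩⟩
  intro t x
  have e1 : E t x = γ • ∫ z, f₀ z • kk ε (x - (u t z).1) := by simp [hE, hΦ]
  rw [e1]
  congr 2; funext z
  by_cases hz : f₀ z = 0
  · simp [hz]
  · rw [hGu z (D.supp z hz)]

end VP

namespace VP

open Set Filter Topology
open scoped ENNReal BoundedContinuousFunction

lemma rad_N3' {a ε : ℝ} (ha : 0 ≤ a) :
    ∫⁻ y : E3, ENNReal.ofReal ((Iio a).indicator (fun r => (√(r^2 + ε^2))⁻¹) ‖y‖)
      ≤ ENNReal.ofReal (cS * (a * a)) := by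
  refine lrad_le (g := (Iio a).indicator (fun _ => a)) (Measurable.indicator (by fun_prop) measurableSet_Iio) ?_ ?_
  · intro r hr
    by_cases h : r ∈ Iio a
    · simp only [indicator_of_mem h]
      have h1 : r ≤ √(r^2 + ε^2) := Real.le_sqrt_of_sq_le (by nlinarith [sq_nonneg ε])
      have h2 : (√(r^2 + ε^2))⁻¹ ≤ r⁻¹ := by gcongr
      calc r^2 * (√(r^2 + ε^2))⁻¹ ≤ r^2 * r⁻¹ := by gcongr
        _ = r := by field_simp
        _ ≤ a := (mem_Iio.1 h).le
    · simp [indicator_of_notMem h]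
  · exact lint_indicator_const a a ha ha

/-- derivative under the integral sign -/
lemma hasDerivAt_int_w {Z : Type*} [TopologicalSpace Z] [T2Space Z] [MeasurableSpace Z]
    [OpensMeasurableSpace Z]
    {μ : Measure Z} [IsFiniteMeasureOnCompacts μ] {w : Z → ℝ} (hw : Continuous w)
    (hc : HasCompactSupport w) {g g' : ℝ → Z → ℝ}
    (hg : Continuous (Function.uncurry g)) (hg' : Continuous (Function.uncurry g'))
    (hd : ∀ t z, HasDerivAt (fun t => g t z) (g' t z) t) (t : ℝ) :
    HasDerivAt (fun t => ∫ z, w z * g t z ∂μ) (∫ z, w z * g' t z ∂μ) t := by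
  have hintg : ∀ h : Z → ℝ, Continuous h → Integrable (fun z => w z * h z) μ := fun h hh =>
    (hw.mul hh).integrable_of_hasCompactSupport hc.mul_right
  have cg : ∀ t, Continuous (g t) := fun t => hg.comp (continuous_const.prodMk continuous_id)
  have cg' : ∀ t, Continuous (g' t) := fun t => hg'.comp (continuous_const.prodMk continuous_id)
  obtain ⟨C, hC⟩ := ((isCompact_Icc (a := t - 1) (b := t + 1)).prod hc.isCompact).exists_bound_of_continuousOn
    hg'.continuousOn
  refine (hasDerivAt_integral_of_dominated_loc_of_deriv_le (F := fun t z => w z * g t z)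
    (F' := fun t z => w z * g' t z) (s := Icc (t-1) (t+1)) (bound := fun z => ‖w z‖ * C)
    (Icc_mem_nhds (by linarith) (by linarith))
    (Eventually.of_forall fun t => (hintg _ (cg t)).aestronglyMeasurable) (hintg _ (cg t))
    (hintg _ (cg' t)).aestronglyMeasurable (Eventually.of_forall fun z s hs => ?_) ?_
    (Eventually.of_forall fun z s _ => (hd s z).const_mul (w z))).2
  · rw [norm_mul]
    by_cases hz : w z = 0
    · simp [hz]
    · exact mul_le_mul_of_nonneg_left (hC (s, z) ⟨hs, subset_tsupport _ hz⟩) (norm_nonneg _)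
  · exact (hw.integrable_of_hasCompactSupport hc).norm.mul_const C

section
variable {f₀ : Ph → ℝ} {γ R M ℓ : ℝ} (D : Data f₀ γ R M ℓ) {ε : ℝ} 
  (S : Reg f₀ γ ε)

lemma Reg.contGt (t : ℝ) : Continuous (S.G t) := S.contG.comp (continuous_const.prodMk continuous_id)

lemma Reg.contΨt (t : ℝ) : Continuous (S.Ψ t) := S.contΨ.comp (continuous_const.prodMk continuous_id)

include D in
lemma Reg.lint_le {φ : Ph → ℝ≥0∞} (hφ : Measurable φ) (t : ℝ) :
    ∫⁻ z, ENNReal.ofReal (f₀ z) * φ (S.G t z) ≤ ENNReal.ofReal M * ∫⁻ w : E3, ∫⁻ y : E3, φ (y, w) := by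
  calc _ ≤ ∫⁻ z, ENNReal.ofReal M * φ (S.G t z) :=
        lintegral_mono fun z => mul_le_mul_left (ENNReal.ofReal_le_ofReal (D.le z)) _
    _ = ENNReal.ofReal M * ∫⁻ z, φ (S.G t z) :=
        lintegral_const_mul _ (hφ.comp (S.contGt t).measurable)
    _ = ENNReal.ofReal M * ∫⁻ z, φ z := by rw [(S.mp t).lintegral_comp hφ]
    _ = _ := by
      rw [Measure.volume_eq_prod, lintegral_prod_symm' _ hφ]

/-- kinetic energy -/
def Reg.kin (t : ℝ) : ℝ := ∫ z, f₀ z * ‖(S.G t z).2‖^2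

include D in
lemma Reg.kin_int (t : ℝ) : Integrable fun z => f₀ z * ‖(S.G t z).2‖^2 :=
  D.int_w (V := ℝ) (((continuous_snd.comp (S.contGt t)).norm).pow 2)

include D in
lemma Reg.kin_nonneg (t : ℝ) : 0 ≤ S.kin t :=
  integral_nonneg fun z => mul_nonneg (D.nonneg z) (by positivity)

include D in
lemma Reg.pot_le (t : ℝ) (a : E3) {η : ℝ} (hη : 0 < η) :
    ∫⁻ z, ENNReal.ofReal (f₀ z) * ENNReal.ofReal ((nn ε (a - (S.G t z).1))⁻¹) ≤
      ENNReal.ofReal (M * (cS * (cS * π) / η^2) + η * (mass f₀ + S.kin t)) := by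
  have hM := D.Mnn
  have hcS := cS_nonneg
  set r : E3 → ℝ := fun w => (η * (1 + ‖w‖^2))⁻¹ with hr
  have hr0 : ∀ w, 0 < r w := fun w => by positivity
  have hrm : Measurable r := by simp only [hr]; fun_prop
  set φ : Ph → ℝ≥0∞ := fun p => ENNReal.ofReal ((Iio (r p.2)).indicator (fun s => (√(s^2 + ε^2))⁻¹) ‖a - p.1‖)
    with hφdef
  have hφ : Measurable φ := by
    simp only [hφdef, indicator_apply, mem_Iio]
    refine (Measurable.ite ?_ (by fun_prop) measurable_const).ennreal_ofReal
    exact measurableSet_lt (by fun_prop) (hrm.comp measurable_snd)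
  have h1 : ∀ z, ENNReal.ofReal (f₀ z) * ENNReal.ofReal ((nn ε (a - (S.G t z).1))⁻¹) ≤
      ENNReal.ofReal (f₀ z) * φ (S.G t z) +
        ENNReal.ofReal (η * (f₀ z + f₀ z * ‖(S.G t z).2‖^2)) := by
    intro z
    have hf := D.nonneg z
    have : η * (f₀ z + f₀ z * ‖(S.G t z).2‖^2) = f₀ z * (η * (1 + ‖(S.G t z).2‖^2)) := by ring
    rw [this, ENNReal.ofReal_mul hf, ← mul_add]
    gcongr
    by_cases h : ‖a - (S.G t z).1‖ < r (S.G t z).2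
    · refine le_add_right ?_
      simp only [hφdef]
      rw [indicator_of_mem (by exact h)]
      rfl
    · refine le_add_left (ENNReal.ofReal_le_ofReal ?_)
      rw [← inv_inv (η * _)]
      have h2 := (not_lt.1 h).trans (norm_le_nn ε _)
      exact inv_anti₀ (hr0 _) h2
  have hm : Integrable fun z => η * (f₀ z + f₀ z * ‖(S.G t z).2‖^2) :=
    (D.integrable.add (S.kin_int D t)).const_mul η
  have hk := S.kin_nonneg D t
  have hmm := D.mass_nonneg
  refine (lintegral_mono h1).trans ?_
  have hmeas : Measurable fun z => ENNReal.ofReal (f₀ z) * φ (S.G t z) :=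
    (ENNReal.measurable_ofReal.comp D.cont.measurable).mul (hφ.comp (S.contGt t).measurable)
  rw [lintegral_add_left hmeas, ENNReal.ofReal_add (by positivity) (by positivity)]
  refine add_le_add ?_ ?_
  · refine (S.lint_le D hφ t).trans ?_
    rw [ENNReal.ofReal_mul hM]
    gcongr
    calc ∫⁻ w, ∫⁻ y, φ (y, w) ≤ ∫⁻ w, ENNReal.ofReal (cS / η^2) * ENNReal.ofReal (((1 + ‖w‖^2)^2)⁻¹) := by
          refine lintegral_mono fun w => ?_
          have h3 := rad_N3' (ε := ε) (hr0 w).le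
          have h4 := lintegral_sub_left_eq_self (μ := (volume : Measure E3)) (fun y : E3 =>
            ENNReal.ofReal ((Iio (r w)).indicator (fun s => (√(s^2 + ε^2))⁻¹) ‖y‖)) a
          rw [← h4] at h3
          refine h3.trans (le_of_eq ?_)
          rw [← ENNReal.ofReal_mul (by positivity)]
          congr 1
          simp only [hr]; field_simp
      _ = ENNReal.ofReal (cS / η^2) * ∫⁻ w : E3, ENNReal.ofReal (((1 + ‖w‖^2)^2)⁻¹) :=
          lintegral_const_mul _ (by fun_prop)
      _ ≤ ENNReal.ofReal (cS / η^2) * ENNReal.ofReal (cS * π) := by gcongr; exact rad_N4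
      _ = _ := by rw [← ENNReal.ofReal_mul (by positivity)]; congr 1; ring
  · rw [← ofReal_integral_eq_lintegral_ofReal hm (Eventually.of_forall fun z => by
      have := D.nonneg z; positivity), integral_const_mul, integral_add D.integrable (S.kin_int D t)]
    exact le_rfl

/-- potential energy -/
def Reg.pot (t : ℝ) : ℝ :=
  ∫ p : Ph × Ph, (f₀ p.1 * f₀ p.2) * (nn ε ((S.G t p.1).1 - (S.G t p.2).1))⁻¹

include D in
lemma Data.ww_cont : Continuous fun p : Ph × Ph => f₀ p.1 * f₀ p.2 :=
  (D.cont.comp continuous_fst).mul (D.cont.comp continuous_snd)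

include D in
lemma Data.ww_cs : HasCompactSupport fun p : Ph × Ph => f₀ p.1 * f₀ p.2 :=
  HasCompactSupport.intro (D.cs.isCompact.prod D.cs.isCompact) fun p hp => by
    by_contra h
    exact hp ⟨subset_tsupport _ (left_ne_zero_of_mul h), subset_tsupport _ (right_ne_zero_of_mul h)⟩

include D in
lemma Data.ww_int {h : Ph × Ph → ℝ} (hh : Continuous h) :
    Integrable fun p : Ph × Ph => (f₀ p.1 * f₀ p.2) * h p :=
  (D.ww_cont.mul hh).integrable_of_hasCompactSupport D.ww_cs.mul_right

include D in
lemma Reg.pot_bound (hε : 0 < ε) (t : ℝ) {η : ℝ} (hη : 0 < η) :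
    0 ≤ S.pot t ∧ S.pot t ≤ mass f₀ * (M * (cS * (cS * π) / η^2) + η * (mass f₀ + S.kin t)) := by
  have hM := D.Mnn
  have hcS := cS_nonneg
  have hk := S.kin_nonneg D t
  have hmm := D.mass_nonneg
  refine ⟨integral_nonneg fun p => mul_nonneg (mul_nonneg (D.nonneg _) (D.nonneg _))
    (inv_nonneg.2 (nn_nonneg _ _)), ?_⟩
  set C := M * (cS * (cS * π) / η^2) + η * (mass f₀ + S.kin t) with hC
  have hC0 : 0 ≤ C := by positivity
  have hXc : Continuous fun z => (S.G t z).1 := continuous_fst.comp (S.contGt t)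
  have hnc : Continuous fun p : Ph × Ph => (nn ε ((S.G t p.1).1 - (S.G t p.2).1))⁻¹ :=
    ((nn_cont ε).comp ((hXc.comp continuous_fst).sub (hXc.comp continuous_snd))).inv₀
      fun p => (nn_pos hε _).ne'
  have hintg : Integrable fun p : Ph × Ph =>
      (f₀ p.1 * f₀ p.2) * (nn ε ((S.G t p.1).1 - (S.G t p.2).1))⁻¹ :=
    (D.ww_cont.mul hnc).integrable_of_hasCompactSupport D.ww_cs.mul_right
  have hmeas : Measurable fun p : Ph × Ph => ENNReal.ofReal
      ((f₀ p.1 * f₀ p.2) * (nn ε ((S.G t p.1).1 - (S.G t p.2).1))⁻¹) :=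
    (D.ww_cont.mul hnc).measurable.ennreal_ofReal
  rw [Reg.pot, ← ENNReal.ofReal_le_ofReal_iff (by positivity),
    ofReal_integral_eq_lintegral_ofReal hintg (Eventually.of_forall fun p =>
      mul_nonneg (mul_nonneg (D.nonneg _) (D.nonneg _)) (inv_nonneg.2 (nn_nonneg _ _))),
    Measure.volume_eq_prod,
    lintegral_prod _ hmeas.aemeasurable]
  calc _ ≤ ∫⁻ z, ENNReal.ofReal (f₀ z) * ENNReal.ofReal C := by
        refine lintegral_mono fun z => ?_
        have h1 : ∀ z', ENNReal.ofReal (f₀ z * f₀ z' * (nn ε ((S.G t z).1 - (S.G t z').1))⁻¹) =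
          ENNReal.ofReal (f₀ z) * (ENNReal.ofReal (f₀ z') *
            ENNReal.ofReal ((nn ε ((S.G t z).1 - (S.G t z').1))⁻¹)) := by
          intro z'
          rw [mul_assoc, ENNReal.ofReal_mul (D.nonneg z), ENNReal.ofReal_mul (D.nonneg z')]
        simp only [h1]
        rw [lintegral_const_mul' _ _ ENNReal.ofReal_ne_top]
        gcongr
        exact S.pot_le D t _ hη
    _ = ENNReal.ofReal (mass f₀) * ENNReal.ofReal C := by
        rw [lintegral_mul_const' _ _ ENNReal.ofReal_ne_top, mass,
          ofReal_integral_eq_lintegral_ofReal D.integrable (Eventually.of_forall D.nonneg)]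
    _ = _ := by rw [← ENNReal.ofReal_mul hmm]

lemma Reg.contV : Continuous fun q : ℝ × Ph => (S.G q.1 q.2).2 := continuous_snd.comp S.contG
lemma Reg.contX : Continuous fun q : ℝ × Ph => (S.G q.1 q.2).1 := continuous_fst.comp S.contG

lemma Reg.odeX (t : ℝ) (z : Ph) : HasDerivAt (fun t => (S.G t z).1) ((S.G t z).2) t :=
by
  have := (hasFDerivAt_fst (𝕜 := ℝ) (p := S.G t z)).comp_hasDerivAt t (S.ode t z)
  exact this

lemma Reg.odeV (t : ℝ) (z : Ph) : HasDerivAt (fun t => (S.G t z).2) (S.E t (S.G t z).1) t :=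
by
  have := (hasFDerivAt_snd (𝕜 := ℝ) (p := S.G t z)).comp_hasDerivAt t (S.ode t z)
  exact this

include D in
lemma Reg.kin_deriv (t : ℝ) :
    HasDerivAt S.kin (∫ z, f₀ z * (2 * inner ℝ (S.G t z).2 (S.E t (S.G t z).1))) t := by
  have hcE : Continuous fun q : ℝ × Ph => S.E q.1 (S.G q.1 q.2).1 :=
    ContinuousEval.continuous_eval.comp ((S.contE.comp continuous_fst).prodMk S.contX)
  refine hasDerivAt_int_w D.cont D.cs (g := fun t z => ‖(S.G t z).2‖^2) (g' := fun t z =>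
    (2 * inner ℝ (S.G t z).2 (S.E t (S.G t z).1))) ?_ ?_ (fun t z => ?_) t
  · exact S.contV.norm.pow 2
  · exact continuous_const.mul (S.contV.inner hcE)
  · exact (S.odeV t z).norm_sq

def Reg.kt (t : ℝ) (p : Ph × Ph) : E3 := kk ε ((S.G t p.1).1 - (S.G t p.2).1)

def Reg.Id (t : ℝ) : ℝ := ∫ p : Ph × Ph, (f₀ p.1 * f₀ p.2) * inner ℝ (S.kt t p) (S.G t p.1).2

lemma Reg.hX1 : Continuous fun q : ℝ × Ph × Ph => (S.G q.1 q.2.1).1 :=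
  S.contX.comp (continuous_fst.prodMk (continuous_fst.comp continuous_snd))
lemma Reg.hX2 : Continuous fun q : ℝ × Ph × Ph => (S.G q.1 q.2.2).1 :=
  S.contX.comp (continuous_fst.prodMk (continuous_snd.comp continuous_snd))
lemma Reg.hV1 : Continuous fun q : ℝ × Ph × Ph => (S.G q.1 q.2.1).2 :=
  S.contV.comp (continuous_fst.prodMk (continuous_fst.comp continuous_snd))
lemma Reg.hV2 : Continuous fun q : ℝ × Ph × Ph => (S.G q.1 q.2.2).2 :=
  S.contV.comp (continuous_fst.prodMk (continuous_snd.comp continuous_snd))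
lemma Reg.hktc (hε : 0 < ε) : Continuous fun q : ℝ × Ph × Ph => S.kt q.1 q.2 :=
  (kk_uc hε).continuous.comp (S.hX1.sub S.hX2)

include D in
lemma Reg.pot_deriv (hε : 0 < ε) (t : ℝ) : HasDerivAt S.pot (∫ p : Ph × Ph, (f₀ p.1 * f₀ p.2) *
      (- inner ℝ (S.kt t p) ((S.G t p.1).2 - (S.G t p.2).2))) t := by
  have hcm : IsFiniteMeasureOnCompacts (volume : Measure (Ph × Ph)) := inferInstance
  refine hasDerivAt_int_w D.ww_cont D.ww_cs
    (g := fun t p => (nn ε ((S.G t p.1).1 - (S.G t p.2).1))⁻¹) 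
    (g' := fun t p => - inner ℝ (S.kt t p) ((S.G t p.1).2 - (S.G t p.2).2)) ?_ ?_ (fun t p => ?_) t
  · exact ((nn_cont ε).comp (S.hX1.sub S.hX2)).inv₀ fun p => (nn_pos hε _).ne'
  · exact ((S.hktc hε).inner (S.hV1.sub S.hV2)).neg
  · exact (nn_inv_hasFDeriv hε _).comp_hasDerivAt t ((S.odeX t p.1).sub (S.odeX t p.2))

include D in
lemma Reg.hi1 (hε : 0 < ε) (t : ℝ) :
    Integrable (fun p : Ph × Ph => (f₀ p.1 * f₀ p.2) * inner ℝ (S.kt t p) (S.G t p.1).2) := by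
  have h1 : Continuous fun p : Ph × Ph => S.kt t p :=
    (kk_uc hε).continuous.comp ((continuous_fst.comp ((S.contGt t).comp continuous_fst)).sub
      (continuous_fst.comp ((S.contGt t).comp continuous_snd)))
  have h2 : Continuous fun p : Ph × Ph => (S.G t p.1).2 :=
    continuous_snd.comp ((S.contGt t).comp continuous_fst)
  have h3 : Continuous fun p : Ph × Ph => (inner ℝ (S.kt t p) (S.G t p.1).2 : ℝ) := Continuous.inner h1 h2
  exact D.ww_int h3

include D in
lemma Reg.hi2 (hε : 0 < ε) (t : ℝ) :
    Integrable (fun p : Ph × Ph => (f₀ p.1 * f₀ p.2) * inner ℝ (S.kt t p) (S.G t p.2).2) := by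
  have h1 : Continuous fun p : Ph × Ph => S.kt t p :=
    (kk_uc hε).continuous.comp ((continuous_fst.comp ((S.contGt t).comp continuous_fst)).sub
      (continuous_fst.comp ((S.contGt t).comp continuous_snd)))
  have h2 : Continuous fun p : Ph × Ph => (S.G t p.2).2 :=
    continuous_snd.comp ((S.contGt t).comp continuous_snd)
  have h3 : Continuous fun p : Ph × Ph => (inner ℝ (S.kt t p) (S.G t p.2).2 : ℝ) := Continuous.inner h1 h2
  exact D.ww_int h3

include D in
lemma Reg.en1 (hε : 0 < ε) (t : ℝ) :
    (∫ z, f₀ z * (2 * inner ℝ (S.G t z).2 (S.E t (S.G t z).1))) = 2 * γ * S.Id t := by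
  have hi := S.hi1 D hε t
  rw [Measure.volume_eq_prod] at hi
  rw [Reg.Id, Measure.volume_eq_prod Ph Ph, integral_prod _ hi, ← integral_const_mul]
  congr 1; funext z
  have hXc : Continuous fun z => (S.G t z).1 := continuous_fst.comp (S.contGt t)
  have hkz : Continuous fun z' => kk ε ((S.G t z).1 - (S.G t z').1) :=
    (kk_uc hε).continuous.comp (continuous_const.sub hXc)
  rw [S.Eeq, inner_smul_right, ← integral_inner (D.int_w hkz), ← integral_const_mul,
    ← integral_const_mul, ← integral_const_mul, ← integral_const_mul]
  congr 1; funext z'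
  rw [inner_smul_right, real_inner_comm, Reg.kt]
  ring

include D in
lemma Reg.en2 (hε : 0 < ε) (t : ℝ) :
    (∫ p : Ph × Ph, (f₀ p.1 * f₀ p.2) *
      (- inner ℝ (S.kt t p) ((S.G t p.1).2 - (S.G t p.2).2))) = - (2 * S.Id t) := by
  have h1 : ∀ p : Ph × Ph, (f₀ p.1 * f₀ p.2) *
    (- inner ℝ (S.kt t p) ((S.G t p.1).2 - (S.G t p.2).2)) = 
     (f₀ p.1 * f₀ p.2) * inner ℝ (S.kt t p) (S.G t p.2).2 - 
      (f₀ p.1 * f₀ p.2) * inner ℝ (S.kt t p) (S.G t p.1).2 := by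
    intro p; rw [inner_sub_right]; ring
  simp only [h1]
  rw [integral_sub (S.hi2 D hε t) (S.hi1 D hε t)]
  have h2 : ∫ p : Ph × Ph, (f₀ p.1 * f₀ p.2) * inner ℝ (S.kt t p) (S.G t p.2).2 = - S.Id t := by
    have hsw := integral_prod_swap (μ := (volume : Measure Ph)) (ν := (volume : Measure Ph))
      (fun p : Ph × Ph => (f₀ p.1 * f₀ p.2) * inner ℝ (S.kt t p) (S.G t p.2).2)
    rw [← Measure.volume_eq_prod] at hsw
    rw [← hsw, Reg.Id, ← integral_neg]
    congr 1; funext p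
    have : S.kt t p.swap = - S.kt t p := by
      simp only [Reg.kt, Prod.fst_swap, Prod.snd_swap]
      rw [← kk_neg, neg_sub]
    rw [this, inner_neg_left]
    simp only [Prod.fst_swap, Prod.snd_swap]; ring
  rw [h2, Reg.Id]; ring

include D in
lemma Reg.energy (hε : 0 < ε) (t : ℝ) : S.kin t + γ * S.pot t = S.kin 0 + γ * S.pot 0 := by
  have hd : ∀ t, HasDerivAt (fun t => S.kin t + γ * S.pot t) 0 t := by
    intro t
    have := (S.kin_deriv D t).add ((S.pot_deriv D hε t).const_mul γ)
    rw [S.en1 D hε, S.en2 D hε] at this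
    convert! this using 1
    ring
  exact is_const_of_deriv_eq_zero (fun t => (hd t).differentiableAt) (fun t => (hd t).deriv) t 0

end

/-- kinetic energy bound uniform in time and ε -/
lemma Data.exists_kin_bound {f₀ : Ph → ℝ} {γ R M ℓ : ℝ} (D : Data f₀ γ R M ℓ) :
    ∃ Ks : ℝ, 0 ≤ Ks ∧ ∀ ε, 0 < ε → ∀ (S : Reg f₀ γ ε) (t : ℝ), S.kin t ≤ Ks := by
  have hm := D.mass_nonneg
  have hM := D.Mnn
  have hcS := cS_nonneg
  set η : ℝ := (2 * (mass f₀ + 1))⁻¹ with hη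
  have hη0 : 0 < η := by positivity
  set k0 : ℝ := ∫ z, f₀ z * ‖z.2‖^2 with hk0
  set A : ℝ := M * (cS * (cS * π) / η^2) with hA
  have hA0 : 0 ≤ A := by positivity
  have hk00 : 0 ≤ k0 := integral_nonneg fun z => mul_nonneg (D.nonneg z) (by positivity)
  have hme : mass f₀ * η ≤ 1 / 2 := by
    rw [hη, ← div_eq_mul_inv, div_le_div_iff₀ (by positivity) (by positivity)]; nlinarith
  refine ⟨2 * (k0 + mass f₀ * (A + η * (mass f₀ + k0)) + mass f₀ * A + mass f₀), by positivity, 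
    fun ε hε S t => ?_⟩
  have hS0 : S.kin 0 = k0 := by simp only [Reg.kin, S.G0, hk0]
  have h1 := S.pot_bound D hε t hη0
  have h2 := S.pot_bound D hε 0 hη0
  have h3 := S.energy D hε t
  have hk := S.kin_nonneg D t
  rw [hS0] at h2 h3
  rw [← hA] at h1 h2
  have h4 : γ * S.pot 0 - γ * S.pot t ≤ S.pot 0 + S.pot t := by
    have := abs_le.1 D.gam
    nlinarith
  have h5 : mass f₀ * (A + η * (mass f₀ + S.kin t)) ≤ mass f₀ * A + 1/2 * (mass f₀ + S.kin t) := by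
    have : mass f₀ * η * (mass f₀ + S.kin t) ≤ 1/2 * (mass f₀ + S.kin t) := by gcongr
    nlinarith
  linarith [h1.2, h2.2]

end VP

namespace VP

open Set Filter Topology
open scoped ENNReal BoundedContinuousFunction

section
variable {f₀ : Ph → ℝ} {γ R M ℓ : ℝ} (D : Data f₀ γ R M ℓ) {ε : ℝ} 
  (S : Reg f₀ γ ε)

open Classical in
/-- near interaction with particles whose velocity lies in `A` -/
def nearφ (a : E3) (A : Set E3) (r : E3 → ℝ) (p : Ph) : ℝ :=
  if p.2 ∈ A ∧ ‖a - p.1‖ < r p.2 then (‖a - p.1‖^2)⁻¹ else 0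

lemma nearφ_meas (a : E3) {A : Set E3} {r : E3 → ℝ} (hA : MeasurableSet A) (hr : Measurable r) :
    Measurable (nearφ a A r) := by
  unfold nearφ
  refine Measurable.ite ?_ (by fun_prop) measurable_const
  exact (measurable_snd hA).inter (measurableSet_lt (by fun_prop) (hr.comp measurable_snd))

include D in
lemma Reg.near_le (t : ℝ) (a : E3) {A : Set E3} {r : E3 → ℝ} (hA : MeasurableSet A)
    (hr : Measurable r) (hr0 : ∀ w, 0 ≤ r w) :
    ∫⁻ z, ENNReal.ofReal (f₀ z) * ENNReal.ofReal (nearφ a A r (S.G t z)) ≤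
      ENNReal.ofReal M * ∫⁻ w in A, ENNReal.ofReal (cS * r w) := by
  refine (S.lint_le D (nearφ_meas a hA hr).ennreal_ofReal t).trans ?_
  refine mul_le_mul_right ?_ _
  rw [← lintegral_indicator hA]
  refine lintegral_mono fun w => ?_
  by_cases hw : w ∈ A
  · rw [indicator_of_mem hw]
    have h3 := rad_N1 (hr0 w)
    have h4 := lintegral_sub_left_eq_self (μ := (volume : Measure E3)) (fun y : E3 =>
            ENNReal.ofReal ((Iio (r w)).indicator (fun s => (s^2)⁻¹) ‖y‖)) a
    rw [← h4] at h3
    refine le_trans (le_of_eq ?_) h3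
    congr 1; funext y
    simp only [nearφ, hw, true_and, indicator_apply, mem_Iio]
  · simp [nearφ, hw]

def vB : ℝ := (volume (Metric.ball (0 : E3) 2)).toReal

include D in
lemma Reg.good_le (t : ℝ) (a c : E3) :
    ∫⁻ z, ENNReal.ofReal (f₀ z) * ENNReal.ofReal
      (nearφ a (Metric.ball 0 2 ∪ Metric.ball c 2) (fun _ => 1) (S.G t z)) ≤
      ENNReal.ofReal (M * (cS * (2 * vB))) := by
  have hM := D.Mnn
  refine (S.near_le D t a (Metric.isOpen_ball.union Metric.isOpen_ball).measurableSet
    measurable_const (fun _ => zero_le_one)).trans ?_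
  rw [ENNReal.ofReal_mul hM]
  gcongr
  rw [lintegral_const, Measure.restrict_apply_univ, mul_one, ENNReal.ofReal_mul cS_nonneg]
  gcongr
  refine (measure_union_le _ _).trans ?_
  have h1 : volume (Metric.ball c 2) = ENNReal.ofReal vB := by
    rw [vB, ENNReal.ofReal_toReal Metric.isBounded_ball.measure_lt_top.ne, Measure.addHaar_ball_center]
  have h2 : volume (Metric.ball (0:E3) 2) = ENNReal.ofReal vB := by
    rw [vB, ENNReal.ofReal_toReal Metric.isBounded_ball.measure_lt_top.ne]
  have hvB : 0 ≤ vB := ENNReal.toReal_nonneg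
  rw [h1, h2, ← ENNReal.ofReal_add hvB hvB]
  exact le_of_eq (by congr 1; ring)

def WW (c w : E3) : ℝ := (‖w‖^3)⁻¹ + (‖w - c‖^3)⁻¹

def badA (P : ℝ) (c : E3) : Set E3 := {w | 2 ≤ ‖w‖ ∧ ‖w‖ ≤ P ∧ 2 ≤ ‖w - c‖ ∧ ‖w - c‖ ≤ 2 * P}

lemma badA_meas (P : ℝ) (c : E3) : MeasurableSet (badA P c) := by
  have c1 : Continuous fun w : E3 => ‖w‖ := continuous_norm
  have c2 : Continuous fun w : E3 => ‖w - c‖ := (continuous_id.sub continuous_const).norm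
  exact ((isClosed_le continuous_const c1).inter ((isClosed_le c1 continuous_const).inter
    ((isClosed_le continuous_const c2).inter (isClosed_le c2 continuous_const)))).measurableSet

lemma WW_nonneg (c w : E3) : 0 ≤ WW c w := by unfold WW; positivity

include D in
lemma Reg.bad_le (t : ℝ) (a c : E3) {P Q : ℝ} (hP : 2 ≤ P) (hQ : 0 < Q) :
    ∫⁻ z, ENNReal.ofReal (f₀ z) * ENNReal.ofReal
      (nearφ a (badA P c) (fun w => 4 * Q * WW c w) (S.G t z)) ≤
      ENNReal.ofReal (M * (cS * (4 * Q) * (cS * (2 * log P)))) := by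
  have hM := D.Mnn
  have hcS := cS_nonneg
  refine (S.near_le D t a (badA_meas P c) (by unfold WW; fun_prop) 
    (fun w => by have := WW_nonneg c w; positivity)).trans ?_
  have hlog : 0 ≤ log P := log_nonneg (by linarith)
  rw [ENNReal.ofReal_mul hM, ENNReal.ofReal_mul (by positivity : 0 ≤ cS * (4 * Q))]
  gcongr
  have m1 : Measurable fun w : E3 => ENNReal.ofReal ((Icc 2 P).indicator (fun r => (r^3)⁻¹) ‖w‖) :=
    ((Measurable.indicator (by fun_prop) measurableSet_Icc).comp measurable_norm).ennreal_ofReal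
  have m2 : Measurable fun w : E3 => ENNReal.ofReal ((Icc 2 (2*P)).indicator (fun r => (r^3)⁻¹) ‖w - c‖) :=
    ((Measurable.indicator (f := fun r : ℝ => (r^3)⁻¹) (by fun_prop) measurableSet_Icc).comp
      (measurable_norm.comp (measurable_id.sub_const c))).ennreal_ofReal
  calc ∫⁻ w in badA P c, ENNReal.ofReal (cS * (4 * Q * WW c w))
      ≤ ∫⁻ w, ENNReal.ofReal (cS * (4 * Q)) * (
          ENNReal.ofReal ((Icc 2 P).indicator (fun r => (r^3)⁻¹) ‖w‖) +
          ENNReal.ofReal ((Icc 2 (2*P)).indicator (fun r => (r^3)⁻¹) ‖w - c‖)) := by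
        rw [← lintegral_indicator (badA_meas P c)]
        refine lintegral_mono fun w => ?_
        by_cases hw : w ∈ badA P c
        · rw [indicator_of_mem hw, indicator_of_mem (by exact ⟨hw.1, hw.2.1⟩),
            indicator_of_mem (by exact ⟨hw.2.2.1, hw.2.2.2⟩), ← ENNReal.ofReal_add (by positivity) (by positivity),
            ← ENNReal.ofReal_mul (by positivity)]
          exact le_of_eq (by congr 1; unfold WW; ring)
        · rw [indicator_of_notMem hw]; exact zero_le
    _ = ENNReal.ofReal (cS * (4 * Q)) * ((∫⁻ w : E3, 
          ENNReal.ofReal ((Icc 2 P).indicator (fun r => (r^3)⁻¹) ‖w‖)) +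
          ∫⁻ w : E3, ENNReal.ofReal ((Icc 2 (2*P)).indicator (fun r => (r^3)⁻¹) ‖w - c‖)) := by
        rw [lintegral_const_mul' _ _ ENNReal.ofReal_ne_top, lintegral_add_left m1]
    _ ≤ _ := by
        gcongr
        rw [lintegral_sub_right_eq_self (μ := (volume : Measure E3)) (fun w : E3 =>
          ENNReal.ofReal ((Icc 2 (2*P)).indicator (fun r => (r^3)⁻¹) ‖w‖)) c]
        refine (add_le_add (rad_N2 (by norm_num) hP) (rad_N2 (by norm_num) (by linarith))).trans ?_
        have h1 : log (P / 2) ≤ log P := log_le_log (by linarith) (by linarith)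
        have h2 : log (2 * P / 2) = log P := by congr 1; ring
        have h3 : 0 ≤ log (P / 2) := log_nonneg (by linarith)
        rw [h2, ← ENNReal.ofReal_add (by positivity) (by positivity)]
        refine ENNReal.ofReal_le_ofReal ?_
        nlinarith
end

/-- arctan estimate -/
lemma ugly_time {t1 t2 r u : ℝ} (ht : t1 ≤ t2) (hr : 0 < r) (hu : 0 < u) {y y' : ℝ → ℝ} 
    (hy : ∀ s, HasDerivAt y (y' s) s) (hc : Continuous y')
    (hy' : ∀ s ∈ Icc t1 t2, u / 2 ≤ y' s) :
    ∫⁻ s in Icc t1 t2, ENNReal.ofReal (2 / (r^2 + y s ^ 2)) ≤ ENNReal.ofReal (4 * π / (u * r)) := by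
  have hyc : Continuous y := continuous_iff_continuousAt.2 fun s => (hy s).continuousAt
  set F : ℝ → ℝ := fun s => 4 / (u * r) * arctan (y s / r) with hF
  set F' : ℝ → ℝ := fun s => 4 / (u * r) * (1 / (1 + (y s / r)^2) * (y' s / r)) with hF'
  have hd : ∀ s, HasDerivAt F (F' s) s := fun s => by
    exact (((hy s).div_const r).arctan).const_mul _
  have hF'c : Continuous F' := by
    refine continuous_const.mul ((continuous_const.div (by fun_prop) fun s => ?_).mul (by fun_prop))
    positivity
  have h1 : ∫ s in t1..t2, F' s = F t2 - F t1 :=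
    intervalIntegral.integral_eq_sub_of_hasDerivAt (fun s _ => hd s) (hF'c.intervalIntegrable _ _)
  have h2 : F t2 - F t1 ≤ 4 * π / (u * r) := by
    have a1 := arctan_lt_pi_div_two (y t2 / r)
    have a2 := neg_pi_div_two_lt_arctan (y t1 / r)
    have : F t2 - F t1 = 4 / (u * r) * (arctan (y t2 / r) - arctan (y t1 / r)) := by simp only [hF]; ring
    rw [this]
    calc _ ≤ 4 / (u * r) * π := by gcongr; linarith
      _ = _ := by ring
  have h3 : ∀ s ∈ Icc t1 t2, 2 / (r^2 + y s ^ 2) ≤ F' s := by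
    intro s hs
    have : F' s = 2 / (r^2 + y s ^ 2) * (y' s / (u / 2)) := by
      simp only [hF']; field_simp; ring
    rw [this]
    have h4 : 1 ≤ y' s / (u / 2) := by rw [one_le_div (by positivity)]; exact hy' s hs
    have : 0 ≤ 2 / (r^2 + y s ^ 2) := by positivity
    nlinarith
  calc _ ≤ ∫⁻ s in Icc t1 t2, ENNReal.ofReal (F' s) :=
        setLIntegral_mono' measurableSet_Icc fun s hs => ENNReal.ofReal_le_ofReal (h3 s hs)
    _ = ENNReal.ofReal (∫ s in Icc t1 t2, F' s) := by
        rw [ofReal_integral_eq_lintegral_ofReal (hF'c.integrableOn_Icc)]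
        filter_upwards [ae_restrict_mem measurableSet_Icc] with s hs
        exact le_trans (by positivity) (h3 s hs)
    _ ≤ _ := by
        rw [integral_Icc_eq_integral_Ioc, ← intervalIntegral.integral_of_le ht, h1]
        exact ENNReal.ofReal_le_ofReal h2

section
variable {f₀ : Ph → ℝ} {γ R M ℓ : ℝ} (D : Data f₀ γ R M ℓ) {ε : ℝ} 
  (S : Reg f₀ γ ε)

open Classical in
def Reg.ugly (t1 Q : ℝ) (zh : Ph) (s : ℝ) (z : Ph) : ℝ :=
  if 1 ≤ ‖(S.G t1 z).2‖ ∧ 1 ≤ ‖(S.G t1 z).2 - (S.G t1 zh).2‖ then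
    2 / ((Q * WW (S.G t1 zh).2 (S.G t1 z).2)^2 +
      (inner ℝ ((S.G s z).1 - (S.G s zh).1) ((S.G t1 z).2 - (S.G t1 zh).2) /
        ‖(S.G t1 z).2 - (S.G t1 zh).2‖)^2) else 0

lemma Reg.ugly_meas (t1 Q : ℝ) (zh : Ph) :
    Measurable (Function.uncurry (S.ugly t1 Q zh)) := by
  have c1 : Continuous fun q : ℝ × Ph => (S.G t1 q.2).2 :=
    continuous_snd.comp ((S.contGt t1).comp continuous_snd)
  have c2 : Continuous fun q : ℝ × Ph => (S.G q.1 q.2).1 := S.contX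
  have c3 : Continuous fun q : ℝ × Ph => (S.G q.1 zh).1 :=
    S.contX.comp (continuous_fst.prodMk continuous_const)
  have c4 : Continuous fun q : ℝ × Ph => (inner ℝ ((S.G q.1 q.2).1 - (S.G q.1 zh).1)
      ((S.G t1 q.2).2 - (S.G t1 zh).2) : ℝ) := Continuous.inner (c2.sub c3) (c1.sub continuous_const)
  have m5 : Measurable fun q : ℝ × Ph => ‖(S.G t1 q.2).2‖ := c1.norm.measurable
  have m6 : Measurable fun q : ℝ × Ph => ‖(S.G t1 q.2).2 - (S.G t1 zh).2‖ :=
    (c1.sub continuous_const).norm.measurable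
  have m4 := c4.measurable
  simp only [Function.uncurry_def, Reg.ugly, WW]
  refine Measurable.ite ?_ ?_ measurable_const
  · exact (measurableSet_le measurable_const m5).inter (measurableSet_le measurable_const m6)
  · fun_prop

lemma Reg.ugly_time {t1 t2 Q : ℝ} (ht : t1 ≤ t2) (hQ : 0 < Q) (zh z : Ph)
    (h1 : ∀ s ∈ Icc t1 t2, ‖(S.G s zh).2 - (S.G t1 zh).2‖ ≤ 1/4)
    (h2 : ∀ s ∈ Icc t1 t2, ‖(S.G s z).2 - (S.G t1 z).2‖ ≤ 1/4) :
    ∫⁻ s in Icc t1 t2, ENNReal.ofReal (S.ugly t1 Q zh s z) ≤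
      ENNReal.ofReal (4 * π / Q * ‖(S.G t1 z).2‖^2) := by
  by_cases hc : 1 ≤ ‖(S.G t1 z).2‖ ∧ 1 ≤ ‖(S.G t1 z).2 - (S.G t1 zh).2‖
  swap
  · simp [Reg.ugly, hc]
  set v := (S.G t1 z).2 with hv
  set c := (S.G t1 zh).2 with hcc
  simp only [Reg.ugly, ← hv, ← hcc, hc, and_self, if_true]
  set u := ‖v - c‖ with hu
  have hu0 : 0 < u := by linarith [hc.2]
  have hv0 : 0 < ‖v‖ := by linarith [hc.1]
  have hW : 0 < WW c v := by unfold WW; positivity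
  have hr : 0 < Q * WW c v := by positivity
  refine (VP.ugly_time (y' := fun s => inner ℝ ((S.G s z).2 - (S.G s zh).2) (v - c) / u)
    ht hr hu0 (fun s => ?_) ?_ ?_).trans ?_
  · have := (((S.odeX s z).sub (S.odeX s zh)).inner ℝ (hasDerivAt_const s (v - c))).div_const u
    simp only [inner_zero_right, zero_add] at this
    exact this
  · have c1 : Continuous fun s => (S.G s z).2 := S.contV.comp (continuous_id.prodMk continuous_const)
    have c2 : Continuous fun s => (S.G s zh).2 := S.contV.comp (continuous_id.prodMk continuous_const)
    exact (Continuous.inner (c1.sub c2) continuous_const).div_const u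
  · intro s hs
    rw [le_div_iff₀ hu0]
    have e1 : (inner ℝ ((S.G s z).2 - (S.G s zh).2) (v - c) : ℝ) = u * u +
        inner ℝ (((S.G s z).2 - v) - ((S.G s zh).2 - c)) (v - c) := by
      rw [hu, ← real_inner_self_eq_norm_mul_norm, ← inner_add_left]
      congr 1; abel
    have e2 := abs_real_inner_le_norm (((S.G s z).2 - v) - ((S.G s zh).2 - c)) (v - c)
    have e3 : ‖((S.G s z).2 - v) - ((S.G s zh).2 - c)‖ ≤ 1/2 :=
      (norm_sub_le _ _).trans (by linarith [h1 s hs, h2 s hs])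
    have e4 : ‖((S.G s z).2 - v) - ((S.G s zh).2 - c)‖ * u ≤ 1/2 * u := by gcongr
    have e5 := neg_abs_le (inner ℝ (((S.G s z).2 - v) - ((S.G s zh).2 - c)) (v - c))
    rw [e1]
    nlinarith [hc.2]
  · refine ENNReal.ofReal_le_ofReal ?_
    rw [div_mul_eq_mul_div, div_le_div_iff₀ (by positivity) hQ]
    have hk : 1 ≤ ‖v‖^2 * (u * WW c v) := by
      unfold WW
      rcases le_total ‖v‖ u with h | h
      · have : ‖v‖^2 * (‖v‖ * (‖v‖^3)⁻¹) ≤ ‖v‖^2 * (u * ((‖v‖^3)⁻¹ + (‖v - c‖^3)⁻¹)) := by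
          gcongr
          exact le_add_of_nonneg_right (by positivity)
        refine le_trans (le_of_eq ?_) this
        field_simp
      · have : u^2 * (u * (u^3)⁻¹) ≤ ‖v‖^2 * (u * ((‖v‖^3)⁻¹ + (‖v - c‖^3)⁻¹)) := by
          rw [← hu]
          gcongr
          exact le_add_of_nonneg_left (by positivity)
        refine le_trans (le_of_eq ?_) this
        field_simp
    calc 4 * π * Q = 4 * π * Q * 1 := by ring
      _ ≤ 4 * π * Q * (‖v‖^2 * (u * WW c v)) := by gcongr
      _ = _ := by ring

lemma cube_cmp {a b : ℝ} (ha : 0 < a) (h : 3 / 4 * a ≤ b) : (b^3)⁻¹ ≤ 4 * (a^3)⁻¹ := by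
  have hb : 0 < b := by linarith
  have h1 : (3/4 * a)^3 ≤ b^3 := by gcongr
  rw [← div_eq_mul_inv, inv_eq_one_div, div_le_div_iff₀ (by positivity) (by positivity)]
  have : 0 < a^3 := by positivity
  nlinarith

lemma Reg.pointwise {t1 s P Q : ℝ} (hQ : 0 < Q) (zh z : Ph)
    (h1 : ‖(S.G s zh).2 - (S.G t1 zh).2‖ ≤ 1/4)
    (h2 : ‖(S.G s z).2 - (S.G t1 z).2‖ ≤ 1/4)
    (h3 : ‖(S.G s zh).2‖ ≤ P) (h4 : ‖(S.G s z).2‖ ≤ P) :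
    (‖(S.G s zh).1 - (S.G s z).1‖^2)⁻¹ ≤
      1 + nearφ (S.G s zh).1 (Metric.ball 0 2 ∪ Metric.ball (S.G s zh).2 2) (fun _ => 1) (S.G s z) +
      nearφ (S.G s zh).1 (badA P (S.G s zh).2) (fun w => 4 * Q * WW (S.G s zh).2 w) (S.G s z) +
      S.ugly t1 Q zh s z := by
  have hn : ∀ a A r p, 0 ≤ nearφ a A r p := fun a A r p => by
    unfold nearφ; split_ifs
    · positivity
    · exact le_rfl
  have hU : 0 ≤ S.ugly t1 Q zh s z := by
    unfold Reg.ugly; split_ifs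
    · positivity
    · exact le_rfl
  have n1 := hn (S.G s zh).1 (Metric.ball 0 2 ∪ Metric.ball (S.G s zh).2 2) (fun _ => 1) (S.G s z)
  have n2 := hn (S.G s zh).1 (badA P (S.G s zh).2) (fun w => 4 * Q * WW (S.G s zh).2 w) (S.G s z)
  by_cases hg : (S.G s z).2 ∈ Metric.ball (0:E3) 2 ∪ Metric.ball (S.G s zh).2 2
  · by_cases hy : ‖(S.G s zh).1 - (S.G s z).1‖ < 1
    · have : nearφ (S.G s zh).1 (Metric.ball 0 2 ∪ Metric.ball (S.G s zh).2 2) (fun _ => 1) (S.G s z)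
        = (‖(S.G s zh).1 - (S.G s z).1‖^2)⁻¹ := by
        unfold nearφ; rw [if_pos ⟨hg, hy⟩]
      linarith
    · have : (‖(S.G s zh).1 - (S.G s z).1‖^2)⁻¹ ≤ 1 := by
        apply inv_le_one_of_one_le₀
        exact one_le_pow₀ (not_lt.1 hy)
      linarith
  have hg' : 2 ≤ ‖(S.G s z).2‖ ∧ 2 ≤ ‖(S.G s z).2 - (S.G s zh).2‖ := by
    simp only [mem_union, Metric.mem_ball, dist_eq_norm, sub_zero, not_or, not_lt] at hg
    exact hg
  have hb : (S.G s z).2 ∈ badA P (S.G s zh).2 :=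
    ⟨hg'.1, h4, hg'.2, (norm_sub_le _ _).trans (by linarith)⟩
  set V := (S.G s z).2
  set Vh := (S.G s zh).2
  set v := (S.G t1 z).2 with hv
  set c := (S.G t1 zh).2 with hcc
  have q1 : ‖V‖ - 1/4 ≤ ‖v‖ := by
    have := norm_sub_norm_le V v
    linarith
  have q2 : ‖V - Vh‖ - 1/2 ≤ ‖v - c‖ := by
    have := norm_sub_norm_le (V - Vh) (v - c)
    have e : (V - Vh) - (v - c) = (V - v) - (Vh - c) := by abel
    rw [e] at this
    have := norm_sub_le (V - v) (Vh - c)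
    linarith
  have hW : WW c v ≤ 4 * WW Vh V := by
    have a1 := cube_cmp (a := ‖V‖) (b := ‖v‖) (by linarith) (by linarith)
    have a2 := cube_cmp (a := ‖V - Vh‖) (b := ‖v - c‖) (by linarith) (by linarith)
    unfold WW; linarith
  by_cases hy : ‖(S.G s zh).1 - (S.G s z).1‖ < Q * WW c v
  · have : nearφ (S.G s zh).1 (badA P Vh) (fun w => 4 * Q * WW Vh w) (S.G s z)
        = (‖(S.G s zh).1 - (S.G s z).1‖^2)⁻¹ := by
      unfold nearφ; rw [if_pos ⟨hb, hy.trans_le (by nlinarith)⟩]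
    linarith
  · have hc : 1 ≤ ‖v‖ ∧ 1 ≤ ‖v - c‖ := ⟨by linarith, by linarith⟩
    have hvp : 0 < ‖v‖ := by linarith
    have hup : 0 < ‖v - c‖ := by linarith
    have hWp : 0 < WW c v := by unfold WW; positivity
    have hr : 0 < Q * WW c v := by positivity
    rw [not_lt] at hy
    have hyp : 0 < ‖(S.G s zh).1 - (S.G s z).1‖ := hr.trans_le hy
    have hin : (inner ℝ ((S.G s z).1 - (S.G s zh).1) (v - c) / ‖v - c‖)^2 ≤
        ‖(S.G s zh).1 - (S.G s z).1‖^2 := by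
      rw [sq_le_sq, abs_div, abs_norm, abs_norm, div_le_iff₀ hup, norm_sub_rev (S.G s zh).1]
      exact abs_real_inner_le_norm _ _
    have : (‖(S.G s zh).1 - (S.G s z).1‖^2)⁻¹ ≤ S.ugly t1 Q zh s z := by
      unfold Reg.ugly
      rw [if_pos hc, ← hv, ← hcc, inv_eq_one_div, div_le_div_iff₀ (by positivity) (by positivity)]
      have : (Q * WW c v)^2 ≤ ‖(S.G s zh).1 - (S.G s z).1‖^2 := by gcongr
      linarith
    linarith

end

end VP

namespace VP

open Set Filter Topology
open scoped ENNReal BoundedContinuousFunction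

section
variable {f₀ : Ph → ℝ} {γ R M ℓ : ℝ} (D : Data f₀ γ R M ℓ) {ε : ℝ} 
  (S : Reg f₀ γ ε)

include D in
lemma Reg.E_le {s : ℝ} (x : E3) : ‖S.E s x‖ₑ ≤
    ∫⁻ z, ENNReal.ofReal (f₀ z) * ENNReal.ofReal ((‖x - (S.G s z).1‖^2)⁻¹) := by
  rw [S.Eeq, enorm_smul]
  have h1 : ‖γ‖ₑ ≤ 1 := by
    rw [← ofReal_norm, ← ENNReal.ofReal_one]; exact ENNReal.ofReal_le_ofReal D.gam
  calc _ ≤ 1 * ‖∫ z, f₀ z • kk ε (x - (S.G s z).1)‖ₑ := by gcongr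
    _ ≤ ∫⁻ z, ‖f₀ z • kk ε (x - (S.G s z).1)‖ₑ := by
        rw [one_mul]; exact enorm_integral_le_lintegral_enorm _
    _ ≤ _ := by
        refine lintegral_mono fun z => ?_
        rw [enorm_smul]
        gcongr
        · rw [← ofReal_norm, Real.norm_of_nonneg (D.nonneg z)]
        · rw [← ofReal_norm]; exact ENNReal.ofReal_le_ofReal (kk_norm _ _)

def cA (f₀ : Ph → ℝ) (M P Q : ℝ) : ℝ :=
  mass f₀ + M * (cS * (2 * vB)) + M * (cS * (4 * Q) * (cS * (2 * log P)))

include D in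
lemma Reg.window {t1 t2 P Q Ks : ℝ} (ht : t1 ≤ t2) (hP : 2 ≤ P) (hQ : 0 < Q) (hKs : S.kin t1 ≤ Ks)
    (h1 : ∀ z, ‖z‖ ≤ R → ∀ s ∈ Icc t1 t2, ‖(S.G s z).2 - (S.G t1 z).2‖ ≤ 1/4)
    (h2 : ∀ z, ‖z‖ ≤ R → ∀ s ∈ Icc t1 t2, ‖(S.G s z).2‖ ≤ P) {zh : Ph} (hzh : ‖zh‖ ≤ R) :
    ‖(S.G t2 zh).2 - (S.G t1 zh).2‖ ≤ (t2 - t1) * cA f₀ M P Q + 4 * π / Q * Ks := by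
  have hM := D.Mnn
  have hcS := cS_nonneg
  have hm := D.mass_nonneg
  have hvB : 0 ≤ vB := ENNReal.toReal_nonneg
  have hlog : 0 ≤ log P := log_nonneg (by linarith)
  have hk := S.kin_nonneg D t1
  have hcA : 0 ≤ cA f₀ M P Q := by unfold cA; positivity
  set U : ℝ → ℝ≥0∞ := fun s => ∫⁻ z, ENNReal.ofReal (f₀ z) * ENNReal.ofReal (S.ugly t1 Q zh s z) with hU
  have mf : Measurable fun z => ENNReal.ofReal (f₀ z) := D.cont.measurable.ennreal_ofReal
  have hE : ∀ s ∈ Icc t1 t2, ‖S.E s (S.G s zh).1‖ₑ ≤ ENNReal.ofReal (cA f₀ M P Q) + U s := by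
    intro s hs
    refine (S.E_le D _).trans ?_
    set n1 : Ph → ℝ := fun z => 
      nearφ (S.G s zh).1 (Metric.ball 0 2 ∪ Metric.ball (S.G s zh).2 2) (fun _ => 1) (S.G s z) with hn1
    set n2 : Ph → ℝ := fun z => 
      nearφ (S.G s zh).1 (badA P (S.G s zh).2) (fun w => 4 * Q * WW (S.G s zh).2 w) (S.G s z) with hn2
    have m1 : Measurable fun z => ENNReal.ofReal (f₀ z) * ENNReal.ofReal (n1 z) :=
      mf.mul ((nearφ_meas _ (Metric.isOpen_ball.union Metric.isOpen_ball).measurableSet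
        measurable_const).comp (S.contGt s).measurable).ennreal_ofReal
    have m2 : Measurable fun z => ENNReal.ofReal (f₀ z) * ENNReal.ofReal (n2 z) :=
      mf.mul ((nearφ_meas _ (badA_meas _ _) (by unfold WW; fun_prop)).comp
        (S.contGt s).measurable).ennreal_ofReal
    have g1 : ∫⁻ z, ENNReal.ofReal (f₀ z) * ENNReal.ofReal (n1 z) ≤ _ := S.good_le D s (S.G s zh).1 (S.G s zh).2
    have g2 : ∫⁻ z, ENNReal.ofReal (f₀ z) * ENNReal.ofReal (n2 z) ≤ _ :=
      S.bad_le D s (S.G s zh).1 (S.G s zh).2 hP hQ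
    calc _ ≤ ∫⁻ z, (ENNReal.ofReal (f₀ z) + (ENNReal.ofReal (f₀ z) * ENNReal.ofReal (n1 z) +
          (ENNReal.ofReal (f₀ z) * ENNReal.ofReal (n2 z) + 
          ENNReal.ofReal (f₀ z) * ENNReal.ofReal (S.ugly t1 Q zh s z)))) := by
          refine lintegral_mono fun z => ?_
          by_cases hz : f₀ z = 0
          · simp [hz]
          · have hzR := D.supp z hz
            have hp := S.pointwise (P := P) hQ zh z (h1 zh hzh s hs) (h1 z hzR s hs) (h2 zh hzh s hs) (h2 z hzR s hs)
            rw [← mul_add, ← mul_add]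
            nth_rewrite 2 [← mul_one (ENNReal.ofReal (f₀ z))]
            rw [← mul_add]
            gcongr
            refine (ENNReal.ofReal_le_ofReal hp).trans ?_
            refine ENNReal.ofReal_add_le.trans ?_
            rw [← add_assoc, ← add_assoc]
            gcongr
            refine ENNReal.ofReal_add_le.trans ?_
            gcongr
            refine ENNReal.ofReal_add_le.trans ?_
            rw [ENNReal.ofReal_one]
      _ = (∫⁻ z, ENNReal.ofReal (f₀ z)) + ((∫⁻ z, ENNReal.ofReal (f₀ z) * ENNReal.ofReal (n1 z)) +
          ((∫⁻ z, ENNReal.ofReal (f₀ z) * ENNReal.ofReal (n2 z)) + U s)) := by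
          rw [lintegral_add_left mf, lintegral_add_left m1, lintegral_add_left m2]
      _ ≤ ENNReal.ofReal (mass f₀) + (ENNReal.ofReal (M * (cS * (2 * vB))) + 
          (ENNReal.ofReal (M * (cS * (4 * Q) * (cS * (2 * log P)))) + U s)) := by
          gcongr
          rw [mass, ofReal_integral_eq_lintegral_ofReal D.integrable (Eventually.of_forall D.nonneg)]
      _ = _ := by
          unfold cA
          rw [ENNReal.ofReal_add (by positivity) (by positivity), ENNReal.ofReal_add (by positivity) (by positivity)]
          ring
  have hUt : ∫⁻ s in Icc t1 t2, U s ≤ ENNReal.ofReal (4 * π / Q * Ks) := by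
    have hmeas : Measurable (Function.uncurry fun (s : ℝ) (z : Ph) =>
        ENNReal.ofReal (f₀ z) * ENNReal.ofReal (S.ugly t1 Q zh s z)) :=
      (mf.comp measurable_snd).mul (S.ugly_meas t1 Q zh).ennreal_ofReal
    simp only [hU]
    rw [lintegral_lintegral_swap hmeas.aemeasurable]
    calc _ ≤ ∫⁻ z, ENNReal.ofReal (4 * π / Q * (f₀ z * ‖(S.G t1 z).2‖^2)) := by
          refine lintegral_mono fun z => ?_
          rw [lintegral_const_mul' _ _ ENNReal.ofReal_ne_top]
          by_cases hz : f₀ z = 0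
          · simp [hz]
          · have hzR := D.supp z hz
            have := S.ugly_time ht hQ zh z (h1 zh hzh) (h1 z hzR)
            calc _ ≤ ENNReal.ofReal (f₀ z) * ENNReal.ofReal (4 * π / Q * ‖(S.G t1 z).2‖^2) := by gcongr
              _ = _ := by rw [← ENNReal.ofReal_mul (D.nonneg z)]; congr 1; ring
      _ = ENNReal.ofReal (4 * π / Q * S.kin t1) := by
          rw [Reg.kin, ← integral_const_mul, ofReal_integral_eq_lintegral_ofReal
            ((S.kin_int D t1).const_mul _) (Eventually.of_forall fun z => by
              have := D.nonneg z; positivity)]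
      _ ≤ _ := ENNReal.ofReal_le_ofReal (by gcongr)
  have hEc : Continuous fun s => S.E s (S.G s zh).1 :=
    ContinuousEval.continuous_eval.comp (S.contE.prodMk (S.contX.comp (continuous_id.prodMk continuous_const)))
  have hintg := intervalIntegral.integral_eq_sub_of_hasDerivAt (fun s (_ : s ∈ uIcc t1 t2) => S.odeV s zh)
    (hEc.intervalIntegrable _ _)
  have hKs0 : 0 ≤ Ks := hk.trans hKs
  have ht0 : 0 ≤ t2 - t1 := by linarith
  rw [← ENNReal.ofReal_le_ofReal_iff (by positivity), ofReal_norm, ← hintg,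
    intervalIntegral.integral_of_le ht, ← integral_Icc_eq_integral_Ioc]
  calc _ ≤ ∫⁻ s in Icc t1 t2, ‖S.E s (S.G s zh).1‖ₑ := enorm_integral_le_lintegral_enorm _
    _ ≤ ∫⁻ s in Icc t1 t2, (ENNReal.ofReal (cA f₀ M P Q) + U s) := setLIntegral_mono' measurableSet_Icc hE
    _ = ENNReal.ofReal (cA f₀ M P Q) * ENNReal.ofReal (t2 - t1) + ∫⁻ s in Icc t1 t2, U s := by
        rw [lintegral_add_left measurable_const, lintegral_const, Measure.restrict_apply_univ, Real.volume_Icc]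
    _ ≤ ENNReal.ofReal (cA f₀ M P Q) * ENNReal.ofReal (t2 - t1) + ENNReal.ofReal (4 * π / Q * Ks) := by gcongr
    _ = _ := by
        rw [← ENNReal.ofReal_mul hcA, ← ENNReal.ofReal_add (by positivity) (by positivity)]
        congr 1; ring

include D in
lemma Reg.E_unif (hε : 0 < ε) (s : ℝ) (x : E3) : ‖S.E s x‖ ≤ mass f₀ * (ε^2)⁻¹ := by
  rw [S.Eeq, norm_smul]
  have h := D.norm_int_le (a := fun z => kk ε (x - (S.G s z).1)) (c := (ε^2)⁻¹) fun z _ => kk_norm' hε _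
  have := D.gam
  rw [Real.norm_eq_abs]
  calc _ ≤ 1 * ‖∫ z, f₀ z • kk ε (x - (S.G s z).1)‖ := by gcongr
    _ ≤ _ := by rw [one_mul]; exact h

lemma Reg.V_lip {C : ℝ} (hC : ∀ s x, ‖S.E s x‖ ≤ C) (z : Ph) (s s' : ℝ) :
    ‖(S.G s z).2 - (S.G s' z).2‖ ≤ C * |s - s'| := by
  have := convex_univ.norm_image_sub_le_of_norm_hasDerivWithin_le (f := fun s => (S.G s z).2)
    (fun s _ => (S.odeV s z).hasDerivWithinAt) (fun s _ => hC s (S.G s z).1) (mem_univ s') (mem_univ s)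
  simpa using this

include D in
lemma Reg.boot (hε : 0 < ε) {T P Q Ks δ : ℝ} (hP : 2 ≤ P) (hQ : 0 < Q) (hKs : ∀ t, S.kin t ≤ Ks)
    (h2 : ∀ z, ‖z‖ ≤ R → ∀ s ∈ Icc 0 T, ‖(S.G s z).2‖ ≤ P) 
    (hδ : ∀ τ, 0 ≤ τ → τ ≤ δ → τ * cA f₀ M P Q + 4 * π / Q * Ks ≤ 1/8)
    {t1 : ℝ} (ht1 : 0 ≤ t1) :
    ∀ z, ‖z‖ ≤ R → ∀ s, t1 ≤ s → s ≤ T → s ≤ t1 + δ → ‖(S.G s z).2 - (S.G t1 z).2‖ ≤ 1/4 := by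
  have hm := D.mass_nonneg
  set C := mass f₀ * (ε^2)⁻¹ with hC
  have hC0 : 0 ≤ C := by positivity
  set h := (8 * (C + 1))⁻¹ with hh
  have hh0 : 0 < h := by positivity
  have hCh : C * h ≤ 1/8 := by
    rw [hh, ← div_eq_mul_inv, div_le_div_iff₀ (by positivity) (by positivity)]; nlinarith
  have claim : ∀ n : ℕ, ∀ z, ‖z‖ ≤ R → ∀ s, t1 ≤ s → s ≤ T → s ≤ t1 + δ → s ≤ t1 + n * h →
      ‖(S.G s z).2 - (S.G t1 z).2‖ ≤ 1/4 := by
    intro n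
    induction n with
    | zero =>
      intro z _ s h1 _ _ h4
      have : s = t1 := by simp at h4; linarith
      rw [this]; simp
    | succ n ih =>
      intro z hz s h1 hT hd h4
      push_cast at h4
      set s' := max t1 (s - h) with hs'
      have a1 : t1 ≤ s' := le_max_left _ _
      have a2 : s' ≤ s := max_le h1 (by linarith)
      have a3 : s' ≤ t1 + n * h := max_le (by nlinarith [n.cast_nonneg (α := ℝ)]) (by linarith)
      have a4 : s - s' ≤ h := by have := le_max_right t1 (s - h); linarith
      have w := S.window D a1 hP hQ (hKs t1)
        (fun z hz r hr => ih z hz r hr.1 (by linarith [hr.2]) (by linarith [hr.2]) (by linarith [hr.2]))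
        (fun z hz r hr => h2 z hz r ⟨by linarith [hr.1], by linarith [hr.2]⟩) hz
      have w2 := hδ (s' - t1) (by linarith) (by linarith)
      have w3 := S.V_lip (S.E_unif D hε) z s s'
      rw [abs_of_nonneg (by linarith)] at w3
      have w4 : C * (s - s') ≤ C * h := by gcongr
      have w5 := norm_add_le ((S.G s z).2 - (S.G s' z).2) ((S.G s' z).2 - (S.G t1 z).2)
      rw [sub_add_sub_cancel] at w5
      linarith
  intro z hz s h1 hT hd
  obtain ⟨n, hn⟩ := exists_nat_ge ((s - t1) / h)
  rw [div_le_iff₀ hh0] at hn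
  exact claim n z hz s h1 hT hd (by linarith)

include D in
lemma Reg.cover (hε : 0 < ε) {T P Q Ks δ : ℝ} (hP : 2 ≤ P) (hQ : 0 < Q) (hKs : ∀ t, S.kin t ≤ Ks)
    (h2 : ∀ z, ‖z‖ ≤ R → ∀ s ∈ Icc 0 T, ‖(S.G s z).2‖ ≤ P) (hδ0 : 0 < δ)
    (hδ : ∀ τ, 0 ≤ τ → τ ≤ δ → τ * cA f₀ M P Q + 4 * π / Q * Ks ≤ 1/8) :
    ∀ z, ‖z‖ ≤ R → ∀ s ∈ Icc 0 T, ‖(S.G s z).2‖ ≤ R + (T / δ + 1) / 4 := by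
  have claim : ∀ n : ℕ, ∀ z, ‖z‖ ≤ R → ∀ s ∈ Icc 0 T, s ≤ n * δ → ‖(S.G s z).2‖ ≤ R + n / 4 := by
    intro n
    induction n with
    | zero =>
      intro z hz s hs h
      have : s = 0 := by simp at h; linarith [hs.1]
      rw [this, S.G0]
      simpa using (norm_snd_le z).trans hz
    | succ n ih =>
      intro z hz s hs h
      push_cast at h ⊢
      set t1 := max 0 (s - δ) with ht1
      have a1 : 0 ≤ t1 := le_max_left _ _
      have a2 : s - δ ≤ t1 := le_max_right _ _
      have a3 : t1 ≤ s := max_le hs.1 (by linarith)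
      have b := S.boot D hε hP hQ hKs h2 hδ a1 z hz s a3 hs.2 (by linarith)
      have c := ih z hz t1 ⟨a1, by linarith [hs.2]⟩ (max_le (by positivity) (by linarith))
      have d := norm_add_le ((S.G s z).2 - (S.G t1 z).2) (S.G t1 z).2
      rw [sub_add_cancel] at d
      linarith
  intro z hz s hs
  have hT : 0 ≤ T := hs.1.trans hs.2
  obtain h1 := Nat.le_ceil (T / δ)
  have h3 := Nat.ceil_lt_add_one (a := T / δ) (by positivity)
  have h4 := claim ⌈T / δ⌉₊ z hz s hs (by rw [div_le_iff₀ hδ0] at h1; linarith [hs.2])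
  linarith

end

lemma log_self_bound {A0 : ℝ} (hA : 1 ≤ A0) : ∃ C > 0, ∀ T P : ℝ, 0 ≤ T → 1 ≤ P → 
    P ≤ A0 * (1 + T) * (1 + log P) → P ≤ C * (1 + T) * log (2 + T) := by
  have hl2 : 0 < log 2 := log_pos (by norm_num)
  have hlA : 0 ≤ log (9 * A0^2) := log_nonneg (by nlinarith)
  refine ⟨A0 * ((1 + log (9 * A0^2)) / log 2 + 2), by positivity, fun T P hT hP h => ?_⟩
  have hP0 : 0 < P := by linarith
  have hsq : 1 ≤ √P := Real.one_le_sqrt.2 hP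
  have h1 : log P ≤ 2 * √P := by
    have := Real.log_le_sub_one_of_pos (x := √P) (by linarith)
    have h2 := Real.log_sqrt hP0.le
    linarith
  have h2 : P ≤ A0 * (1 + T) * (3 * √P) := h.trans (by gcongr; linarith)
  have h3 : √P ≤ 3 * (A0 * (1 + T)) := by
    have : √P * √P ≤ 3 * (A0 * (1 + T)) * √P := by rw [Real.mul_self_sqrt hP0.le]; linarith
    exact le_of_mul_le_mul_right this (by linarith)
  have h4 : P ≤ 9 * A0^2 * (1 + T)^2 := by
    calc P = √P^2 := (Real.sq_sqrt hP0.le).symm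
      _ ≤ (3 * (A0 * (1 + T)))^2 := by gcongr
      _ = _ := by ring
  have h5 : log P ≤ log (9 * A0^2) + 2 * log (1 + T) := by
    refine (log_le_log hP0 h4).trans (le_of_eq ?_)
    rw [log_mul (by positivity) (by positivity), log_pow]; norm_num
  have h6 : log (1 + T) ≤ log (2 + T) := log_le_log (by linarith) (by linarith)
  have h7 : log 2 ≤ log (2 + T) := log_le_log (by norm_num) (by linarith)
  have h8 : 1 + log (9 * A0^2) ≤ (1 + log (9 * A0^2)) / log 2 * log (2 + T) := by
    rw [div_mul_eq_mul_div, le_div_iff₀ hl2]; gcongr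
  calc P ≤ A0 * (1 + T) * (1 + log P) := h
    _ ≤ A0 * (1 + T) * (((1 + log (9 * A0^2)) / log 2 + 2) * log (2 + T)) := by
        gcongr
        linarith
    _ = _ := by ring

theorem Data.momentum {f₀ : Ph → ℝ} {γ R M ℓ : ℝ} (D : Data f₀ γ R M ℓ) :
    ∃ C > 0, ∀ ε, 0 < ε → ∀ (S : Reg f₀ γ ε) (t : ℝ), 0 ≤ t → ∀ z, ‖z‖ ≤ R →
      ‖(S.G t z).2‖ ≤ C * (1 + t) * log (2 + t) := by
  obtain ⟨Ks, hKs0, hKs⟩ := D.exists_kin_bound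
  have hM := D.Mnn
  have hcS := cS_nonneg
  have hm := D.mass_nonneg
  have hR := D.Rpos
  have hvB : 0 ≤ vB := ENNReal.toReal_nonneg
  set Q := 64 * π * (Ks + 1) with hQ
  have hQ0 : 0 < Q := by positivity
  have hQK : 4 * π / Q * Ks ≤ 1/16 := by
    rw [hQ, div_mul_eq_mul_div, div_le_div_iff₀ (by positivity) (by norm_num)]
    nlinarith [Real.pi_pos]
  set b := mass f₀ + M * (cS * (2 * vB)) with hb
  set c := M * (cS * (4 * Q) * (cS * 2)) with hc
  have hb0 : 0 ≤ b := by positivity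
  have hc0 : 0 ≤ c := by positivity
  obtain ⟨C, hC0, hC⟩ := log_self_bound (A0 := 3 + R + 4 * (b + 1) + 4 * c) (by linarith)
  refine ⟨C, hC0, fun ε hε S T hT z hz => ?_⟩
  obtain ⟨q, hq, hmax⟩ := ((isCompact_Icc (a := (0:ℝ)) (b := T)).prod
    (isCompact_closedBall (0 : Ph) R)).exists_isMaxOn ⟨(0, 0), ⟨le_rfl, hT⟩, by simpa using hR.le⟩ S.contV.norm.continuousOn
  set P := max 2 ‖(S.G q.1 q.2).2‖ with hP
  have hP2 : 2 ≤ P := le_max_left _ _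
  have h2 : ∀ z, ‖z‖ ≤ R → ∀ s ∈ Icc 0 T, ‖(S.G s z).2‖ ≤ P := fun z hz s hs =>
    (hmax (show (s, z) ∈ _ from ⟨hs, by simpa using hz⟩)).trans (le_max_right _ _)
  have hlog : 0 ≤ log P := log_nonneg (by linarith)
  have hcA : cA f₀ M P Q = b + c * log P := by unfold cA; simp only [hb, hc]; ring
  set δ := (16 * (b + c * log P + 1))⁻¹ with hδ
  have hden : 0 < b + c * log P + 1 := by positivity
  have hδ0 : 0 < δ := by positivity
  have hcov := S.cover D hε hP2 hQ0 (hKs ε hε S) h2 hδ0 (fun τ h0 h => by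
    rw [hcA]
    have : τ * (b + c * log P) ≤ 1 / 16 := by
      calc _ ≤ δ * (b + c * log P) := by gcongr
        _ ≤ 1/16 := by
          rw [hδ, inv_mul_eq_div, div_le_div_iff₀ (by positivity) (by norm_num)]; linarith
    linarith)
  have hTd : T / δ = T * (16 * (b + c * log P + 1)) := by rw [hδ, div_inv_eq_mul]
  have hPle : P ≤ (3 + R + 4 * (b + 1) + 4 * c) * (1 + T) * (1 + log P) := by
    have hq1 := hcov q.2 (by simpa using hq.2) q.1 hq.1
    rw [hTd] at hq1
    have : P ≤ 2 + (R + (T * (16 * (b + c * log P + 1)) + 1) / 4) := max_le (by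
      have : 0 ≤ T * (16 * (b + c * log P + 1)) := by positivity
      linarith) (by linarith)
    refine this.trans ?_
    have p1 : 0 ≤ T * log P := by positivity
    have p2 : 0 ≤ c * T := by positivity
    have p3 : 0 ≤ b * T := by positivity
    have p4 : 0 ≤ R * T := by positivity
    have p5 : 0 ≤ c * log P := by positivity
    have p6 : 0 ≤ b * log P := by positivity
    have p7 : 0 ≤ R * log P := by positivity
    have p8 : 0 ≤ b * (T * log P) := by positivity
    have p9 : 0 ≤ R * (T * log P) := by positivity
    have p10 : 0 ≤ c * (T * log P) := by positivity
    nlinarith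
  exact (h2 z hz T ⟨hT, le_rfl⟩).trans (hC T P hT (by linarith) hPle)

end VP

namespace VP

open Set Filter Topology
open scoped ENNReal BoundedContinuousFunction

structure Dens (σ : E3 → ℝ) (s ℓ R1 : ℝ) : Prop where
  cont : Continuous σ
  bd : ∀ y, |σ y| ≤ s
  ell : 0 ≤ ℓ
  lip : ∀ y y', |σ y - σ y'| ≤ ℓ * ‖y - y'‖
  supp : ∀ y, σ y ≠ 0 → ‖y‖ ≤ R1

def vR (R1 : ℝ) : ℝ := (volume (Metric.closedBall (0 : E3) R1)).toReal

lemma vR_nonneg (R1 : ℝ) : 0 ≤ vR R1 := ENNReal.toReal_nonneg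

lemma vR_eq (R1 : ℝ) : volume (Metric.closedBall (0 : E3) R1) = ENNReal.ofReal (vR R1) := by
  rw [vR, ENNReal.ofReal_toReal Metric.isBounded_closedBall.measure_lt_top.ne]

/-- convolution with the regularised kernel -/
def cv (ε : ℝ) (σ : E3 → ℝ) (x : E3) : E3 := ∫ y, σ y • kk ε (x - y)

lemma norm_le_of_enorm {V : Type*} [NormedAddCommGroup V] {v : V} {c : ℝ} (hc : 0 ≤ c)
    (h : ‖v‖ₑ ≤ ENNReal.ofReal c) : ‖v‖ ≤ c := by
  rwa [← ofReal_norm, ENNReal.ofReal_le_ofReal_iff hc] at h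

lemma cv_alt (σ : E3 → ℝ) (ε : ℝ) (x : E3) : cv ε σ x = ∫ y, σ (x - y) • kk ε y := by
  rw [cv, ← integral_sub_left_eq_self _ _ x]
  simp

section
variable {σ : E3 → ℝ} {s ℓ R1 : ℝ} (hσ : Dens σ s ℓ R1)
include hσ

lemma Dens.s_nonneg : 0 ≤ s := (abs_nonneg _).trans (hσ.bd 0)

lemma Dens.cs : HasCompactSupport σ :=
  HasCompactSupport.intro (isCompact_closedBall (0 : E3) R1) fun z hz => by
    by_contra h
    exact hz (by simpa using hσ.supp z h)

lemma Dens.integrable : Integrable σ := hσ.cont.integrable_of_hasCompactSupport hσ.cs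

lemma Dens.ker {V : Type*} [NormedAddCommGroup V] [NormedSpace ℝ V] {κ : E3 → V} {a : ℝ → ℝ}
    {m c : ℝ} (ha : Measurable a) (ha0 : ∀ r, 0 ≤ a r)
    (hm : 0 ≤ m) (hc : 0 ≤ c) (hκ : ∀ x, ‖κ x‖ ≤ m * ((Iio 1).indicator a ‖x‖ + 1))
    (hA : ∫⁻ y : E3, ENNReal.ofReal ((Iio 1).indicator a ‖y‖) ≤ ENNReal.ofReal c) (x : E3) :
    ∫⁻ y, ‖σ y • κ (x - y)‖ₑ ≤ ENNReal.ofReal (s * (m * (c + vR R1))) := by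
  have hs := hσ.s_nonneg
  have hv := vR_nonneg R1
  have hA' := hA
  rw [← lintegral_sub_left_eq_self _ x] at hA'
  have hmeas : Measurable fun y : E3 => ENNReal.ofReal ((Iio 1).indicator a ‖x - y‖) :=
    ((ha.indicator measurableSet_Iio).comp (measurable_norm.comp (measurable_const.sub measurable_id))).ennreal_ofReal
  calc _ ≤ ∫⁻ y, ENNReal.ofReal (s * m) * (ENNReal.ofReal ((Iio 1).indicator a ‖x - y‖) +
        (Metric.closedBall (0:E3) R1).indicator (fun _ => 1) y) := by
        refine lintegral_mono fun y => ?_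
        rw [← ofReal_norm]
        by_cases hy : σ y = 0
        · simp [hy]
        · have hyR : y ∈ Metric.closedBall (0:E3) R1 := by simpa using hσ.supp y hy
          rw [indicator_of_mem hyR, ← ENNReal.ofReal_one, 
            ← ENNReal.ofReal_add (indicator_nonneg (fun r _ => ha0 r) _) zero_le_one, 
            ← ENNReal.ofReal_mul (by positivity)]
          refine ENNReal.ofReal_le_ofReal ?_
          rw [norm_smul, mul_assoc]
          exact mul_le_mul (hσ.bd y) (hκ _) (norm_nonneg _) hs
    _ = ENNReal.ofReal (s * m) * ((∫⁻ y, ENNReal.ofReal ((Iio 1).indicator a ‖x - y‖)) +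
        ENNReal.ofReal (vR R1)) := by
        rw [lintegral_const_mul' _ _ ENNReal.ofReal_ne_top, lintegral_add_left hmeas,
          lintegral_indicator Metric.isClosed_closedBall.measurableSet, lintegral_one,
          Measure.restrict_apply_univ, vR_eq]
    _ ≤ ENNReal.ofReal (s * m) * (ENNReal.ofReal c + ENNReal.ofReal (vR R1)) := by gcongr
    _ = _ := by
        rw [← ENNReal.ofReal_add hc hv, ← ENNReal.ofReal_mul (by positivity), mul_assoc]

lemma Dens.kk_lint (ε : ℝ) (x : E3) :
    ∫⁻ y, ‖σ y • kk ε (x - y)‖ₑ ≤ ENNReal.ofReal (s * (cS + vR R1)) := by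
  have := hσ.ker (κ := kk ε) (a := fun r => (r^2)⁻¹) (m := 1) (c := cS * 1) (by fun_prop)
    (fun r => by positivity) zero_le_one (by simpa using cS_nonneg) (fun x => ?_) (rad_N1 zero_le_one) x
  · simpa using this
  · refine (kk_norm ε x).trans ?_
    rw [one_mul]
    by_cases h : ‖x‖ < 1
    · rw [indicator_of_mem (by exact h)]; linarith
    · rw [indicator_of_notMem (by exact h), zero_add]
      exact inv_le_one_of_one_le₀ (one_le_pow₀ (not_lt.1 h))

lemma Dens.kk_int (ε : ℝ) (x : E3) : Integrable fun y => σ y • kk ε (x - y) := by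
  refine ⟨?_, (hσ.kk_lint ε x).trans_lt ENNReal.ofReal_lt_top⟩
  exact (hσ.cont.measurable.smul ((kk_meas ε).comp (measurable_const.sub measurable_id))).aestronglyMeasurable

lemma Dens.cv_bd (ε : ℝ) (x : E3) : ‖cv ε σ x‖ ≤ s * (cS + vR R1) := by
  have hs := hσ.s_nonneg
  have hv := vR_nonneg R1
  have hcS := cS_nonneg
  exact norm_le_of_enorm (by positivity) 
    ((enorm_integral_le_lintegral_enorm _).trans (hσ.kk_lint ε x))

lemma Dens.cv_lip1 {δ : ℝ} (hδ : 0 < δ) (hδ1 : δ ≤ 1) (x x' : E3) :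
    ‖cv δ σ x - cv δ σ x'‖ ≤ s * (4 * (cS * (1 + log (1 / δ)) + vR R1)) * ‖x - x'‖ := by
  have hs := hσ.s_nonneg
  have hv := vR_nonneg R1
  have hcS := cS_nonneg
  have hl : 0 ≤ log (1 / δ) := log_nonneg (by rw [one_le_div hδ]; exact hδ1)
  have hD : ∀ x, HasFDerivAt (cv δ σ) (∫ y, σ y • Dkk δ (x - y)) x := by
    intro x
    have hDi : ∀ x, Integrable fun y => σ y • Dkk δ (x - y) := fun x => by
      have c1 : Continuous fun y => Dkk δ (x - y) := (Dkk_cont hδ).comp (continuous_const.sub continuous_id)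
      have c2 : Continuous fun y => σ y • Dkk δ (x - y) := hσ.cont.smul c1
      have c3 : HasCompactSupport fun y => σ y • Dkk δ (x - y) :=
        HasCompactSupport.smul_right (f := σ) (f' := fun y => Dkk δ (x - y)) hσ.cs
      exact c2.integrable_of_hasCompactSupport c3
    refine hasFDerivAt_integral_of_dominated_of_fderiv_le (s := univ)
        (F := fun x y => σ y • kk δ (x - y))
        (F' := fun x y => σ y • Dkk δ (x - y))
        (bound := fun y => ‖σ y‖ * (4 * (δ^3)⁻¹)) univ_mem
        (Eventually.of_forall fun x => (hσ.kk_int δ x).aestronglyMeasurable)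
        (hσ.kk_int δ x) (hDi x).aestronglyMeasurable
        (Eventually.of_forall fun z x _ => ?_) (hσ.integrable.norm.mul_const _)
        (Eventually.of_forall fun z x _ => ?_)
    · rw [norm_smul]
      exact mul_le_mul_of_nonneg_left (Dkk_norm' hδ _) (norm_nonneg _)
    · have h1 := (kk_hasFDeriv hδ (x - z)).comp x ((hasFDerivAt_id x).sub_const z)
      exact h1.const_smul (σ z)
  refine convex_univ.norm_image_sub_le_of_norm_hasFDerivWithin_le
    (fun x _ => (hD x).hasFDerivWithinAt) (fun x _ => ?_) (mem_univ x') (mem_univ x)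
  refine norm_le_of_enorm (by positivity) ((enorm_integral_le_lintegral_enorm _).trans ?_)
  refine hσ.ker (a := fun r => ((√(r^2 + δ^2))^3)⁻¹) (by fun_prop) (fun r => by positivity) (by norm_num)
    (by positivity) (fun x => ?_) (rad_N6 hδ hδ1) x
  refine (Dkk_norm hδ x).trans ?_
  gcongr
  by_cases h : ‖x‖ < 1
  · rw [indicator_of_mem (by exact h)]
    exact le_add_of_nonneg_right zero_le_one
  · rw [indicator_of_notMem (by exact h), zero_add]
    exact inv_le_one_of_one_le₀ (one_le_pow₀ ((not_lt.1 h).trans (norm_le_nn δ x)))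

lemma Dens.cv_diff {ε δ : ℝ} (hε : 0 ≤ ε) (hδ : 0 < δ) (h : ε ≤ δ) (x : E3) :
    ‖cv ε σ x - cv δ σ x‖ ≤ s * (cS * (3 * (δ * π))) := by
  have hs := hσ.s_nonneg
  have hcS := cS_nonneg
  have hl := kk_diff_lint hε hδ h
  rw [← lintegral_sub_left_eq_self _ x] at hl
  rw [cv, cv, ← integral_sub (hσ.kk_int ε x) (hσ.kk_int δ x)]
  refine norm_le_of_enorm (by positivity) ((enorm_integral_le_lintegral_enorm _).trans ?_)
  rw [ENNReal.ofReal_mul hs]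
  calc _ ≤ ∫⁻ y, ENNReal.ofReal s * ‖kk ε (x - y) - kk δ (x - y)‖ₑ := by
        refine lintegral_mono fun y => ?_
        rw [← smul_sub, enorm_smul]
        gcongr
        rw [← ofReal_norm]; exact ENNReal.ofReal_le_ofReal (hσ.bd y)
    _ ≤ _ := by rw [lintegral_const_mul' _ _ ENNReal.ofReal_ne_top]; gcongr

lemma Dens.cv_lip2 {ε δ : ℝ} (hε : 0 ≤ ε) (hδ : 0 < δ) (h : ε ≤ δ) (x x' : E3) :
    ‖(cv ε σ x - cv δ σ x) - (cv ε σ x' - cv δ σ x')‖ ≤ ℓ * (cS * (3 * (δ * π))) * ‖x - x'‖ := by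
  have hℓ := hσ.ell
  have hcS := cS_nonneg
  have hl := kk_diff_lint hε hδ h
  have hi : ∀ ε x, Integrable fun y => σ (x - y) • kk ε y := fun ε x => by
    have := (hσ.kk_int ε x).comp_sub_left x
    simpa using this
  have hi2 : ∀ x, Integrable fun y => σ (x - y) • kk ε y - σ (x - y) • kk δ y := fun x =>
    (hi ε x).sub (hi δ x)
  rw [cv_alt, cv_alt, cv_alt, cv_alt, ← integral_sub (hi ε x) (hi δ x),
    ← integral_sub (hi ε x') (hi δ x'), ← integral_sub (hi2 x) (hi2 x')]
  refine norm_le_of_enorm (by positivity) ((enorm_integral_le_lintegral_enorm _).trans ?_)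
  have : ℓ * (cS * (3 * (δ * π))) * ‖x - x'‖ = (ℓ * ‖x - x'‖) * (cS * (3 * (δ * π))) := by ring
  rw [this, ENNReal.ofReal_mul (by positivity)]
  calc _ ≤ ∫⁻ y, ENNReal.ofReal (ℓ * ‖x - x'‖) * ‖kk ε y - kk δ y‖ₑ := by
        refine lintegral_mono fun y => ?_
        rw [← smul_sub, ← smul_sub, ← sub_smul, enorm_smul]
        gcongr
        rw [← ofReal_norm]; refine ENNReal.ofReal_le_ofReal ?_
        have := hσ.lip (x - y) (x' - y)
        rwa [sub_sub_sub_cancel_right] at this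
    _ ≤ _ := by rw [lintegral_const_mul' _ _ ENNReal.ofReal_ne_top]; gcongr

/-- log-Lipschitz type bound -/
lemma Dens.cv_lip {ε d : ℝ} (hε : 0 < ε) (hε1 : ε ≤ 1) (hd : 0 < d) (hd1 : d ≤ 1) (x x' : E3) :
    ‖cv ε σ x - cv ε σ x'‖ ≤
      (ℓ * (cS * (3 * (d * π))) + s * (4 * (cS * (1 + log (1 / d)) + vR R1))) * ‖x - x'‖ := by
  have hs := hσ.s_nonneg
  have hℓ := hσ.ell
  have hv := vR_nonneg R1
  have hcS := cS_nonneg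
  have hp := Real.pi_pos
  rcases le_total d ε with h | h
  · refine (hσ.cv_lip1 hε hε1 x x').trans ?_
    have : log (1 / ε) ≤ log (1 / d) := log_le_log (by positivity) (by gcongr)
    have h2 : 0 ≤ ℓ * (cS * (3 * (d * π))) := by positivity
    refine le_trans ?_ (mul_le_mul_of_nonneg_right (le_add_of_nonneg_left h2) (norm_nonneg _))
    gcongr
  · have h1 := hσ.cv_lip1 hd hd1 x x'
    have h2 := hσ.cv_lip2 hε.le hd h x x'
    have e : cv ε σ x - cv ε σ x' = ((cv ε σ x - cv d σ x) - (cv ε σ x' - cv d σ x')) +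
      (cv d σ x - cv d σ x') := by abel
    rw [e, add_mul]
    exact (norm_add_le _ _).trans (add_le_add h2 h1)
end

end VP

namespace VP

open Set Filter Topology
open scoped ENNReal BoundedContinuousFunction

lemma back_gron {N N' a c : ℝ → ℝ} {t : ℝ} (ht : 0 ≤ t) (hN : ∀ s ∈ Icc 0 t, HasDerivAt N (N' s) s)
    (ha : Continuous a) (hc : Continuous c) (ha0 : ∀ s, 0 ≤ a s) (hc0 : ∀ s, 0 ≤ c s)
    (h : ∀ s ∈ Icc 0 t, -(a s * N s + c s) ≤ N' s) :
    N 0 ≤ exp (∫ s in (0:ℝ)..t, a s) * (N t + ∫ s in (0:ℝ)..t, c s) := by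
  set A : ℝ → ℝ := fun s => ∫ r in (0:ℝ)..s, a r with hA
  have hAd : ∀ s, HasDerivAt A (a s) s := fun s => ha.integral_hasStrictDerivAt 0 s |>.hasDerivAt
  have hAc : Continuous A := continuous_iff_continuousAt.2 fun s => (hAd s).continuousAt
  have hce : Continuous fun s => exp (A s) * c s := (hAc.rexp).mul hc
  set Φ : ℝ → ℝ := fun s => exp (A s) * N s + ∫ r in (0:ℝ)..s, exp (A r) * c r with hΦ
  have hΦd : ∀ s ∈ Icc 0 t, HasDerivAt Φ ((exp (A s) * a s * N s + exp (A s) * N' s) + exp (A s) * c s) s :=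
    fun s hs => (((hAd s).exp.mul (hN s hs)).add (hce.integral_hasStrictDerivAt 0 s).hasDerivAt)
  have hmono : MonotoneOn Φ (Icc 0 t) := by
    refine monotoneOn_of_hasDerivWithinAt_nonneg (convex_Icc 0 t)
      (fun s hs => (hΦd s hs).continuousAt.continuousWithinAt)
      (fun s hs => (hΦd s (interior_subset hs)).hasDerivWithinAt) fun s hs => ?_
    have := h s (interior_subset hs)
    have e : exp (A s) * a s * N s + exp (A s) * N' s + exp (A s) * c s =
      exp (A s) * (N' s + (a s * N s + c s)) := by ring
    rw [e]
    exact mul_nonneg (exp_pos _).le (by linarith)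
  have h0 : Φ 0 = N 0 := by simp [hΦ, hA]
  have h1 := hmono ⟨le_rfl, ht⟩ ⟨ht, le_rfl⟩ ht
  rw [h0] at h1
  refine h1.trans ?_
  simp only [hΦ]
  rw [mul_add, ← intervalIntegral.integral_const_mul]
  refine add_le_add_right (intervalIntegral.integral_mono_on ht (hce.intervalIntegrable _ _)
    ((continuous_const.mul hc).intervalIntegrable _ _) fun s hs => ?_) _
  have : A s ≤ A t := by
    simp only [hA]
    exact intervalIntegral.integral_mono_interval le_rfl hs.1 hs.2 (Eventually.of_forall ha0)
      (ha.intervalIntegrable _ _)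
  exact mul_le_mul_of_nonneg_right (exp_le_exp.2 this) (hc0 s)

lemma fwd_gron {L : ℝ → ℝ} {A B T : ℝ} (hL : Continuous L) (hB : 0 ≤ B) (hA : 0 ≤ A)
    (h : ∀ t ∈ Icc 0 T, L t ≤ A + B * ∫ s in (0:ℝ)..t, L s) :
    ∀ t ∈ Icc 0 T, L t ≤ A * exp (B * T) := by
  intro t ht
  set W : ℝ → ℝ := fun t => exp (-B * t) * (A + B * ∫ s in (0:ℝ)..t, L s) with hW
  have hd : ∀ t, HasDerivAt W (exp (-B * t) * (-B * 1) * (A + B * ∫ s in (0:ℝ)..t, L s) +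
      exp (-B * t) * (B * L t)) t := fun t =>
    (((hasDerivAt_id t).const_mul (-B)).exp).mul
      (((hL.integral_hasStrictDerivAt 0 t).hasDerivAt.const_mul B).const_add A)
  have hanti : AntitoneOn W (Icc 0 T) := by
    refine antitoneOn_of_hasDerivWithinAt_nonpos (convex_Icc 0 T)
      (fun s hs => (hd s).continuousAt.continuousWithinAt)
      (fun s hs => (hd s).hasDerivWithinAt) fun s hs => ?_
    have := h s (interior_subset hs)
    have e : exp (-B * s) * (-B * 1) * (A + B * ∫ s in (0:ℝ)..s, L s) + exp (-B * s) * (B * L s) =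
      - (exp (-B * s) * (B * ((A + B * ∫ s in (0:ℝ)..s, L s) - L s))) := by ring
    rw [e]
    exact neg_nonpos.2 (mul_nonneg (exp_pos _).le (mul_nonneg hB (by linarith)))
  have h1 := hanti ⟨le_rfl, ht.1.trans ht.2⟩ ht ht.1
  have h0 : W 0 = A := by simp [hW]
  rw [h0] at h1
  have h2 := h t ht
  have h3 : A + B * ∫ s in (0:ℝ)..t, L s = exp (B * t) * W t := by
    simp only [hW]; rw [← mul_assoc, ← exp_add]; simp
  rw [h3] at h2
  refine h2.trans ?_
  rw [mul_comm A]
  have : exp (B * t) ≤ exp (B * T) := exp_le_exp.2 (mul_le_mul_of_nonneg_left ht.2 hB)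
  calc exp (B * t) * W t ≤ exp (B * t) * A := by gcongr
    _ ≤ _ := by gcongr

/-- comparison of two characteristic systems -/
lemma two_sys {E E' : ℝ → E3 →ᵇ E3} {L : ℝ → ℝ} (hE : Continuous E) (hE' : Continuous E') (hL : Continuous L)
    (hL0 : ∀ s, 0 ≤ L s) {t : ℝ} (ht : 0 ≤ t)
    (hlip : ∀ s ∈ Icc 0 t, ∀ x x', ‖E s x - E s x'‖ ≤ L s * ‖x - x'‖) {z z' : ℝ → Ph}
    (hz : ∀ s ∈ Icc 0 t, HasDerivAt z ((z s).2, E s (z s).1) s)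
    (hz' : ∀ s ∈ Icc 0 t, HasDerivAt z' ((z' s).2, E' s (z' s).1) s) :
    ‖z 0 - z' 0‖^2 ≤ exp (∫ s in (0:ℝ)..t, (2 + L s)) *
      (‖(z t).1 - (z' t).1‖^2 + ‖(z t).2 - (z' t).2‖^2 + ∫ s in (0:ℝ)..t, (dist (E s) (E' s))^2) := by
  set N : ℝ → ℝ := fun s => ‖(z s).1 - (z' s).1‖^2 + ‖(z s).2 - (z' s).2‖^2 with hN
  have d1 : ∀ s ∈ Icc 0 t, HasDerivAt (fun s => (z s).1) (z s).2 s := fun s hs => by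
    have := (hasFDerivAt_fst (𝕜 := ℝ) (p := z s)).comp_hasDerivAt s (hz s hs)
    exact this
  have d2 : ∀ s ∈ Icc 0 t, HasDerivAt (fun s => (z s).2) (E s (z s).1) s := fun s hs => by
    have := (hasFDerivAt_snd (𝕜 := ℝ) (p := z s)).comp_hasDerivAt s (hz s hs)
    exact this
  have d1' : ∀ s ∈ Icc 0 t, HasDerivAt (fun s => (z' s).1) (z' s).2 s := fun s hs => by
    have := (hasFDerivAt_fst (𝕜 := ℝ) (p := z' s)).comp_hasDerivAt s (hz' s hs)
    exact this
  have d2' : ∀ s ∈ Icc 0 t, HasDerivAt (fun s => (z' s).2) (E' s (z' s).1) s := fun s hs => by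
    have := (hasFDerivAt_snd (𝕜 := ℝ) (p := z' s)).comp_hasDerivAt s (hz' s hs)
    exact this
  have hg : Continuous fun s => dist (E s) (E' s) := hE.dist hE'
  have key := back_gron (N := N) (a := fun s => 2 + L s) (c := fun s => (dist (E s) (E' s))^2) ht
    (fun s hs => (((d1 s hs).sub (d1' s hs)).norm_sq).add (((d2 s hs).sub (d2' s hs)).norm_sq))
    (by fun_prop) (hg.pow 2) (fun s => by linarith [hL0 s]) (fun s => by positivity) ?_
  · refine le_trans ?_ key
    simp only [hN]
    have e : ‖z 0 - z' 0‖ = max ‖(z 0).1 - (z' 0).1‖ ‖(z 0).2 - (z' 0).2‖ := rfl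
    rw [e]
    rcases max_choice ‖(z 0).1 - (z' 0).1‖ ‖(z 0).2 - (z' 0).2‖ with h | h <;> rw [h]
    · nlinarith [sq_nonneg ‖(z 0).2 - (z' 0).2‖]
    · nlinarith [sq_nonneg ‖(z 0).1 - (z' 0).1‖]
  · intro s hs
    have c1 := abs_real_inner_le_norm ((z s).1 - (z' s).1) ((z s).2 - (z' s).2)
    have c2 := abs_real_inner_le_norm ((z s).2 - (z' s).2) (E s (z s).1 - E' s (z' s).1)
    have c3 : ‖E s (z s).1 - E' s (z' s).1‖ ≤ L s * ‖(z s).1 - (z' s).1‖ + dist (E s) (E' s) := by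
      have e : E s (z s).1 - E' s (z' s).1 = (E s (z s).1 - E s (z' s).1) + 
        (E s (z' s).1 - E' s (z' s).1) := by abel
      rw [e]
      refine (norm_add_le _ _).trans (add_le_add (hlip s hs _ _) ?_)
      rw [← dist_eq_norm]
      exact BoundedContinuousFunction.dist_coe_le_dist _
    have b1 := neg_abs_le (inner ℝ ((z s).1 - (z' s).1) ((z s).2 - (z' s).2))
    have b2 := neg_abs_le (inner ℝ ((z s).2 - (z' s).2) (E s (z s).1 - E' s (z' s).1))
    have hg0 : 0 ≤ dist (E s) (E' s) := dist_nonneg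
    have hL := hL0 s
    simp only [hN, Pi.sub_apply]
    generalize (inner ℝ ((z s).1 - (z' s).1) ((z s).2 - (z' s).2) : ℝ) = i1 at *
    generalize (inner ℝ ((z s).2 - (z' s).2) (E s (z s).1 - E' s (z' s).1) : ℝ) = i2 at *
    generalize ‖E s (z s).1 - E' s (z' s).1‖ = e at *
    generalize dist (E s) (E' s) = g at *
    have hx : 0 ≤ ‖(z s).1 - (z' s).1‖ := norm_nonneg _
    have hv : 0 ≤ ‖(z s).2 - (z' s).2‖ := norm_nonneg _
    generalize ‖(z s).1 - (z' s).1‖ = x at *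
    generalize ‖(z s).2 - (z' s).2‖ = v at *
    generalize L s = l at *
    have c4 : v * e ≤ v * (l * x + g) := by gcongr
    have q1 := sq_nonneg (x - v)
    have q2 := sq_nonneg (v - g)
    have q3 : 0 ≤ l * (x - v)^2 := by positivity
    nlinarith

end VP

namespace VP

open Set Filter Topology
open scoped ENNReal BoundedContinuousFunction

/-- velocity average -/
def rho (f : Ph → ℝ) (y : E3) : ℝ := ∫ w, f (y, w)

structure PD (f : Ph → ℝ) (μ κ P R1 : ℝ) : Prop where
  cont : Continuous f
  bd : ∀ p, |f p| ≤ μ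
  knn : 0 ≤ κ
  lip : ∀ y y' w, |f (y, w) - f (y', w)| ≤ κ * ‖y - y'‖
  supp : ∀ p, f p ≠ 0 → ‖p.1‖ ≤ R1 ∧ ‖p.2‖ ≤ P

lemma int_ball_le {g : E3 → ℝ} {c P : ℝ} (h : ∀ w, |g w| ≤ c) (hs : ∀ w, g w ≠ 0 → ‖w‖ ≤ P) :
    |∫ w, g w| ≤ c * vR P := by
  rw [← setIntegral_eq_integral_of_forall_compl_eq_zero (s := Metric.closedBall (0:E3) P)
    (fun w hw => by
      by_contra h0
      exact hw (by simpa using hs w h0))]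
  have := norm_setIntegral_le_of_norm_le_const (f := g) (C := c) (μ := volume)
    (Metric.isBounded_closedBall (x := (0:E3)) (r := P)).measure_lt_top (fun w _ => h w)
  exact this

section
variable {f : Ph → ℝ} {μ κ P R1 : ℝ} (h : PD f μ κ P R1)
include h

lemma PD.cs : HasCompactSupport f :=
  HasCompactSupport.intro ((isCompact_closedBall (0 : E3) R1).prod (isCompact_closedBall (0 : E3) P))
    fun z hz => by
      by_contra h0
      exact hz (by simpa using h.supp z h0)

lemma PD.sec_int (y : E3) : Integrable fun w => f (y, w) := by
  have hc : Continuous fun w => f (y, w) := h.cont.comp (Continuous.prodMk continuous_const continuous_id)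
  refine hc.integrable_of_hasCompactSupport ?_
  refine HasCompactSupport.intro (isCompact_closedBall (0 : E3) P) fun z hz => ?_
  by_contra h0
  exact hz (by simpa using (h.supp _ h0).2)

lemma PD.rho_lip (y y' : E3) : |rho f y - rho f y'| ≤ κ * vR P * ‖y - y'‖ := by
  rw [rho, rho, ← integral_sub (h.sec_int y) (h.sec_int y')]
  refine (int_ball_le (P := P) (h.lip y y') ?_).trans_eq (by ring)
  intro w hw
  by_contra hP
  have h1 : f (y, w) = 0 := by
    by_contra h0; exact hP (h.supp _ h0).2
  have h2 : f (y', w) = 0 := by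
    by_contra h0; exact hP (h.supp _ h0).2
  exact hw (by rw [h1, h2, sub_zero])

lemma PD.dens : Dens (rho f) (μ * vR P) (κ * vR P) R1 where
  cont := by
    have hk : 0 ≤ κ * vR P := mul_nonneg h.knn (vR_nonneg P)
    refine (LipschitzWith.of_dist_le_mul (K := ⟨κ * vR P, hk⟩) fun y y' => ?_).continuous
    rw [Real.dist_eq, dist_eq_norm]
    exact h.rho_lip y y'
  bd := fun y => int_ball_le (fun w => h.bd (y, w)) (fun w hw => (h.supp _ hw).2)
  ell := mul_nonneg h.knn (vR_nonneg P)
  lip := h.rho_lip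
  supp := fun y hy => by
    by_contra hR
    refine hy ?_
    rw [rho]
    refine integral_eq_zero_of_ae (Eventually.of_forall fun w => ?_)
    by_contra h0
    exact hR (h.supp _ h0).1

lemma PD.rho_sub {f' : Ph → ℝ} {μ' κ' : ℝ} (h' : PD f' μ' κ' P R1) (y : E3) :
    rho (fun p => f p - f' p) y = rho f y - rho f' y :=
  integral_sub (h.sec_int y) (h'.sec_int y)

lemma PD.sub {f' : Ph → ℝ} {μ' κ' δ : ℝ} (h' : PD f' μ' κ' P R1) (hδ : ∀ p, |f p - f' p| ≤ δ) :
    PD (fun p => f p - f' p) δ (κ + κ') P R1 where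
  cont := h.cont.sub h'.cont
  bd := hδ
  knn := add_nonneg h.knn h'.knn
  lip := fun y y' w => by
    have h1 := h.lip y y' w
    have h2 := h'.lip y y' w
    calc _ = |(f (y, w) - f (y', w)) - (f' (y, w) - f' (y', w))| := by congr 1; ring
      _ ≤ _ := (abs_sub _ _).trans (by linarith)
  supp := fun p hp => by
    by_cases h0 : f p = 0
    · by_cases h1 : f' p = 0
      · exact absurd (by rw [h0, h1, sub_zero]) hp
      · exact h'.supp p h1
    · exact h.supp p h0

end

section
variable {f₀ : Ph → ℝ} {γ R M ℓ : ℝ} (D : Data f₀ γ R M ℓ) {ε : ℝ} (S : Reg f₀ γ ε)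

/-- transported distribution -/
def Reg.f (S : Reg f₀ γ ε) (t : ℝ) (p : Ph) : ℝ := f₀ (S.Ψ t p)

include D

lemma Data.ell_nonneg : 0 ≤ ℓ := by
  have h := D.lip ((EuclideanSpace.single 0 1, 0) : Ph) 0
  have h2 : 0 < ‖((EuclideanSpace.single 0 1, 0) : Ph) - 0‖ := by
    rw [sub_zero, norm_pos_iff]
    intro h
    have := congrArg (fun p : Ph => p.1 0) h
    simp at this
  have := (abs_nonneg _).trans h
  exact nonneg_of_mul_nonneg_left this h2

lemma Data.mom_supp {T P : ℝ} (hP : ∀ t ∈ Icc 0 T, ∀ z, ‖z‖ ≤ R → ‖(S.G t z).2‖ ≤ P)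
    {t : ℝ} (ht : t ∈ Icc 0 T) {p : Ph} (hp : S.f t p ≠ 0) :
    ‖p.1‖ ≤ R + T * P ∧ ‖p.2‖ ≤ P := by
  have hz := D.supp _ hp
  have hPn : 0 ≤ P := (norm_nonneg _).trans (hP t ht _ hz)
  refine ⟨?_, ?_⟩
  · have h1 := (convex_Icc (0:ℝ) t).norm_image_sub_le_of_norm_hasDerivWithin_le
      (f := fun s => (S.G s (S.Ψ t p)).1) (C := P)
      (fun s hs => (S.odeX s (S.Ψ t p)).hasDerivWithinAt)
      (fun s hs => hP s ⟨hs.1, hs.2.trans ht.2⟩ _ hz) (left_mem_Icc.2 ht.1) (right_mem_Icc.2 ht.1)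
    simp only [S.GΨ, S.G0, sub_zero, Real.norm_of_nonneg ht.1] at h1
    have h2 := norm_le_norm_add_norm_sub' p.1 (S.Ψ t p).1
    have h3 := (norm_fst_le (S.Ψ t p)).trans hz
    nlinarith [ht.2]
  · have := hP t ht _ hz
    rwa [S.GΨ] at this

lemma Data.f_cont (t : ℝ) : Continuous (S.f t) := D.cont.comp (S.contΨt t)

lemma Data.E_eq_cv (hε : 0 < ε) (t : ℝ) (hcs : HasCompactSupport (S.f t)) (x : E3) :
    S.E t x = γ • cv ε (rho (S.f t)) x := by
  rw [S.Eeq, cv]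
  congr 1
  have hk : Continuous fun p : Ph => kk ε (x - p.1) :=
    (kk_uc hε).continuous.comp (continuous_const.sub continuous_fst)
  have hc : Continuous fun p : Ph => S.f t p • kk ε (x - p.1) := (D.f_cont S t).smul hk
  have hi : Integrable (fun p : Ph => S.f t p • kk ε (x - p.1)) (volume.prod volume) := by
    rw [← Measure.volume_eq_prod]
    exact hc.integrable_of_hasCompactSupport hcs.smul_right
  calc ∫ z, f₀ z • kk ε (x - (S.G t z).1)
      = ∫ z, (fun p : Ph => S.f t p • kk ε (x - p.1)) (S.G t z) := by
        refine integral_congr_ae (Eventually.of_forall fun z => ?_)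
        simp only [Reg.f, S.ΨG]
    _ = ∫ p, S.f t p • kk ε (x - p.1) := by
        have h1 := integral_map (μ := volume) (S.mp t).measurable.aemeasurable
          (f := fun p : Ph => S.f t p • kk ε (x - p.1)) (by
            rw [(S.mp t).map_eq]; exact hc.aestronglyMeasurable)
        rw [(S.mp t).map_eq] at h1
        exact h1.symm
    _ = ∫ y, ∫ w, S.f t (y, w) • kk ε (x - y) := by
        rw [Measure.volume_eq_prod, integral_prod _ hi]
    _ = _ := by
        refine integral_congr_ae (Eventually.of_forall fun y => ?_)
        simp only [rho, integral_smul_const]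

/-- Lipschitz constant of the field -/
def Reg.L (S : Reg f₀ γ ε) (t : ℝ) : ℝ := dist (S.DE t) 0

end

section
variable {f₀ : Ph → ℝ} {γ R M ℓ : ℝ} {ε : ℝ} (S : Reg f₀ γ ε)

lemma Reg.L_cont : Continuous S.L := S.contDE.dist continuous_const
lemma Reg.L_nonneg (t : ℝ) : 0 ≤ S.L t := dist_nonneg

lemma Reg.DE_le (t : ℝ) (x : E3) : ‖S.DE t x‖ ≤ S.L t := by
  have := (S.DE t).norm_coe_le_norm x
  exact this

lemma Reg.E_lip (t : ℝ) (x x' : E3) : ‖S.E t x - S.E t x'‖ ≤ S.L t * ‖x - x'‖ :=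
  convex_univ.norm_image_sub_le_of_norm_hasFDerivWithin_le
    (fun y _ => (S.hasD t y).hasFDerivWithinAt) (fun y _ => S.DE_le t y) (mem_univ _) (mem_univ _)

lemma Reg.L_le {t c : ℝ} (hc : 0 ≤ c) (h : ∀ x x', ‖S.E t x - S.E t x'‖ ≤ c * ‖x - x'‖) : S.L t ≤ c := by
  refine (BoundedContinuousFunction.dist_le hc).2 fun x => ?_
  rw [dist_eq_norm]
  simp only [BoundedContinuousFunction.coe_zero, Pi.zero_apply, sub_zero]
  exact (S.hasD t x).le_of_lip' hc (Eventually.of_forall fun y => h y x)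

lemma Data.f_diff (D : Data f₀ γ R M ℓ) {ε' : ℝ} (S' : Reg f₀ γ ε') {t : ℝ} (ht : 0 ≤ t) (p p' : Ph) :
    |S.f t p - S'.f t p'| ≤ ℓ * √(exp (∫ s in (0:ℝ)..t, (2 + S.L s)) *
      (‖p.1 - p'.1‖^2 + ‖p.2 - p'.2‖^2 + ∫ s in (0:ℝ)..t, (dist (S.E s) (S'.E s))^2)) := by
  have h := two_sys (z := fun s => S.G s (S.Ψ t p)) (z' := fun s => S'.G s (S'.Ψ t p'))
    S.contE S'.contE S.L_cont S.L_nonneg ht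
    (fun s _ x x' => S.E_lip s x x') (fun s _ => S.ode s _) (fun s _ => S'.ode s _)
  simp only [S.G0, S'.G0, S.GΨ, S'.GΨ] at h
  refine (D.lip _ _).trans ?_
  exact mul_le_mul_of_nonneg_left (Real.le_sqrt_of_sq_le h) D.ell_nonneg

lemma Data.pd (D : Data f₀ γ R M ℓ) {T P : ℝ} (hP : ∀ t ∈ Icc 0 T, ∀ z, ‖z‖ ≤ R → ‖(S.G t z).2‖ ≤ P)
    {t : ℝ} (ht : t ∈ Icc 0 T) :
    PD (S.f t) M (ℓ * exp ((∫ s in (0:ℝ)..t, (2 + S.L s)) / 2)) P (R + T * P) where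
  cont := D.f_cont S t
  bd := fun p => by
    rw [Reg.f, abs_of_nonneg (D.nonneg _)]; exact D.le _
  knn := mul_nonneg D.ell_nonneg (exp_pos _).le
  lip := fun y y' w => by
    refine (D.f_diff S S ht.1 _ _).trans_eq ?_
    simp only [dist_self, sub_self, norm_zero]
    norm_num
    rw [Real.sqrt_eq_rpow, ← Real.exp_mul]
    ring_nf
  supp := fun p hp => D.mom_supp S hP ht hp

lemma Data.exists_P (D : Data f₀ γ R M ℓ) (T : ℝ) (hT : 0 ≤ T) : ∃ P, 0 ≤ P ∧ ∀ ε, 0 < ε →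
    ∀ S : Reg f₀ γ ε, ∀ t ∈ Icc 0 T, ∀ z, ‖z‖ ≤ R → ‖(S.G t z).2‖ ≤ P := by
  obtain ⟨C, hC, h⟩ := D.momentum
  have hl : 0 ≤ log (2 + T) := log_nonneg (by linarith)
  refine ⟨C * (1 + T) * log (2 + T), by positivity, fun ε hε S t ht z hz => (h ε hε S t ht.1 z hz).trans ?_⟩
  have h1 : log (2 + t) ≤ log (2 + T) := log_le_log (by linarith [ht.1]) (by linarith [ht.2])
  have h2 : 0 ≤ log (2 + t) := log_nonneg (by linarith [ht.1])
  have h3 : C * (1 + t) ≤ C * (1 + T) := by nlinarith [ht.2]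
  exact mul_le_mul h3 h1 h2 (by positivity)

lemma Data.exists_L (D : Data f₀ γ R M ℓ) (T : ℝ) (hT : 0 ≤ T) : ∃ Λ, 0 ≤ Λ ∧ ∀ ε, 0 < ε → ε ≤ 1 →
    ∀ S : Reg f₀ γ ε, ∀ t ∈ Icc 0 T, S.L t ≤ Λ := by
  obtain ⟨P, hP0, hP⟩ := D.exists_P T hT
  have hv := vR_nonneg P
  have hw := vR_nonneg (R + T * P)
  have hc := cS_nonneg
  have hM := D.Mnn
  have hl := D.ell_nonneg
  have hpi := Real.pi_pos
  set A : ℝ := ℓ * vR P * (cS * (3 * π)) + M * vR P * (4 * (cS * (1 + T) + vR (R + T * P))) with hA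
  set B : ℝ := M * vR P * (4 * cS) / 2 with hB
  have hA0 : 0 ≤ A := by positivity
  have hB0 : 0 ≤ B := by positivity
  refine ⟨A * exp (B * T), by positivity, fun ε hε hε1 S => ?_⟩
  refine fwd_gron S.L_cont hB0 hA0 fun t ht => ?_
  have hpd := D.pd S (hP ε hε S) ht
  set I : ℝ := ∫ s in (0:ℝ)..t, (2 + S.L s) with hI
  have hIe : I = 2 * t + ∫ s in (0:ℝ)..t, S.L s := by
    rw [hI, intervalIntegral.integral_add (by simp) (S.L_cont.intervalIntegrable _ _)]
    simp [mul_comm]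
  have hI2 : 0 ≤ ∫ s in (0:ℝ)..t, S.L s :=
    intervalIntegral.integral_nonneg ht.1 fun s _ => S.L_nonneg s
  have hI0 : 0 ≤ I := by rw [hIe]; linarith [ht.1]
  have hle : S.L t ≤ A + B * ∫ s in (0:ℝ)..t, S.L s := by
    refine S.L_le (by positivity) fun x x' => ?_
    rw [D.E_eq_cv S hε t hpd.cs, D.E_eq_cv S hε t hpd.cs, ← smul_sub, norm_smul, Real.norm_eq_abs]
    have h1 := hpd.dens.cv_lip hε hε1 (exp_pos (-(I/2))) (exp_le_one_iff.2 (by linarith)) x x'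
    have h2 : log (1 / exp (-(I/2))) = I / 2 := by
      rw [one_div, ← Real.exp_neg, neg_neg, Real.log_exp]
    have h3 : ℓ * exp (I / 2) * vR P * (cS * (3 * (exp (-(I / 2)) * π))) = ℓ * vR P * (cS * (3 * π)) := by
      have : exp (I/2) * exp (-(I/2)) = 1 := by rw [← Real.exp_add]; simp
      linear_combination (ℓ * vR P * (cS * (3 * π))) * this
    rw [h2, h3] at h1
    have h4 : |γ| * ‖cv ε (rho (S.f t)) x - cv ε (rho (S.f t)) x'‖ ≤
        1 * ‖cv ε (rho (S.f t)) x - cv ε (rho (S.f t)) x'‖ :=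
      mul_le_mul_of_nonneg_right D.gam (norm_nonneg _)
    rw [one_mul] at h4
    refine (h4.trans h1).trans (mul_le_mul_of_nonneg_right ?_ (norm_nonneg _))
    rw [hIe, hA, hB]
    have h5 : M * vR P * (4 * (cS * (1 + (2 * t + ∫ s in (0:ℝ)..t, S.L s) / 2) + vR (R + T * P))) ≤
       M * vR P * (4 * (cS * (1 + (2 * T + ∫ s in (0:ℝ)..t, S.L s) / 2) + vR (R + T * P))) := by
      have := ht.2
      gcongr
    linarith
  exact hle

end
end VP

namespace VP

open Set Filter Topology
open scoped ENNReal BoundedContinuousFunction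

lemma Dens.cv_diff' {σ : E3 → ℝ} {s ℓ R1 : ℝ} (hσ : Dens σ s ℓ R1) {ε δ : ℝ} (hε : 0 < ε) (hδ : 0 < δ)
    (x : E3) : ‖cv ε σ x - cv δ σ x‖ ≤ s * (cS * (3 * ((ε + δ) * π))) := by
  have hs := hσ.s_nonneg
  have hc := cS_nonneg
  have hpi := Real.pi_pos
  rcases le_total ε δ with h | h
  · refine (hσ.cv_diff hε.le hδ h x).trans ?_
    gcongr
    linarith
  · rw [norm_sub_rev]
    refine (hσ.cv_diff hδ.le hε h x).trans ?_
    gcongr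
    linarith

lemma Dens.cv_lip2' {σ : E3 → ℝ} {s ℓ R1 : ℝ} (hσ : Dens σ s ℓ R1) {ε δ : ℝ} (hε : 0 < ε) (hδ : 0 < δ)
    (x x' : E3) : ‖(cv ε σ x - cv δ σ x) - (cv ε σ x' - cv δ σ x')‖ ≤
      ℓ * (cS * (3 * ((ε + δ) * π))) * ‖x - x'‖ := by
  have hs := hσ.ell
  have hc := cS_nonneg
  have hpi := Real.pi_pos
  rcases le_total ε δ with h | h
  · refine (hσ.cv_lip2 hε.le hδ h x x').trans ?_
    gcongr
    linarith
  · have e : (cv ε σ x - cv δ σ x) - (cv ε σ x' - cv δ σ x') =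
      - ((cv δ σ x - cv ε σ x) - (cv δ σ x' - cv ε σ x')) := by abel
    rw [e, norm_neg]
    refine (hσ.cv_lip2 hδ.le hε h x x').trans ?_
    gcongr
    linarith

lemma PD.cv_sub {f f' : Ph → ℝ} {μ κ μ' κ' P R1 : ℝ} (h : PD f μ κ P R1) (h' : PD f' μ' κ' P R1)
    (ε : ℝ) (x : E3) :
    cv ε (rho fun p => f p - f' p) x = cv ε (rho f) x - cv ε (rho f') x := by
  rw [cv, cv, cv, ← integral_sub (h.dens.kk_int ε x) (h'.dens.kk_int ε x)]
  refine integral_congr_ae (Eventually.of_forall fun y => ?_)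
  simp only [h.rho_sub h' y, sub_smul]

section
variable {f₀ : Ph → ℝ} {γ R M ℓ : ℝ} (D : Data f₀ γ R M ℓ)
include D

lemma Data.unif (T : ℝ) (hT : 0 ≤ T) : ∃ Λ κ P, 0 ≤ Λ ∧ 0 ≤ κ ∧ 0 ≤ P ∧ ∀ ε, 0 < ε → ε ≤ 1 →
    ∀ S : Reg f₀ γ ε, ∀ t ∈ Icc 0 T, S.L t ≤ Λ ∧ PD (S.f t) M κ P (R + T * P) := by
  obtain ⟨P, hP0, hP⟩ := D.exists_P T hT
  obtain ⟨Λ, hΛ, hL⟩ := D.exists_L T hT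
  have hl := D.ell_nonneg
  refine ⟨Λ, ℓ * exp ((2 + Λ) * T / 2), P, hΛ, by positivity, hP0, fun ε hε hε1 S t ht =>
    ⟨hL ε hε hε1 S t ht, ?_⟩⟩
  have h := D.pd S (hP ε hε S) ht
  refine ⟨h.cont, h.bd, by positivity, fun y y' w => (h.lip y y' w).trans ?_, h.supp⟩
  have h1 : ∫ s in (0:ℝ)..t, (2 + S.L s) ≤ (2 + Λ) * T := by
    calc _ ≤ ∫ s in (0:ℝ)..t, (2 + Λ) := by
          refine intervalIntegral.integral_mono_on ht.1
            ((continuous_const.add S.L_cont).intervalIntegrable _ _) (by simp) fun s hs => ?_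
          linarith [hL ε hε hε1 S s ⟨hs.1, hs.2.trans ht.2⟩]
      _ = (2 + Λ) * t := by rw [intervalIntegral.integral_const, smul_eq_mul]; ring
      _ ≤ _ := by gcongr; exact ht.2
  gcongr

lemma Data.f_diff_le {T Λ : ℝ} (hΛ : 0 ≤ Λ) {ε ε' : ℝ} (S : Reg f₀ γ ε) (S' : Reg f₀ γ ε')
    (hL : ∀ t ∈ Icc 0 T, S.L t ≤ Λ) {t : ℝ} (ht : t ∈ Icc 0 T) (p : Ph) :
    |S.f t p - S'.f t p| ≤ ℓ * √(exp ((2 + Λ) * T) * ∫ s in (0:ℝ)..t, (dist (S.E s) (S'.E s))^2) := by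
  refine (D.f_diff S S' ht.1 p p).trans ?_
  have hl := D.ell_nonneg
  have hI : 0 ≤ ∫ s in (0:ℝ)..t, (dist (S.E s) (S'.E s))^2 :=
    intervalIntegral.integral_nonneg ht.1 fun s _ => sq_nonneg _
  have h1 : ∫ s in (0:ℝ)..t, (2 + S.L s) ≤ (2 + Λ) * T := by
    calc _ ≤ ∫ s in (0:ℝ)..t, (2 + Λ) := by
          refine intervalIntegral.integral_mono_on ht.1
            ((continuous_const.add S.L_cont).intervalIntegrable _ _) (by simp) fun s hs => ?_
          linarith [hL s ⟨hs.1, hs.2.trans ht.2⟩]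
      _ = (2 + Λ) * t := by rw [intervalIntegral.integral_const, smul_eq_mul]; ring
      _ ≤ _ := by gcongr; exact ht.2
  simp only [sub_self, norm_zero]
  norm_num
  gcongr

lemma Data.field_diff {ε ε' : ℝ} (hε : 0 < ε) (hε' : 0 < ε') (S : Reg f₀ γ ε) (S' : Reg f₀ γ ε')
    {t κ P R1 : ℝ} (h : PD (S.f t) M κ P R1) (h' : PD (S'.f t) M κ P R1) (x : E3) :
    S.E t x - S'.E t x = γ • (cv ε (rho fun p => S.f t p - S'.f t p) x +
      (cv ε (rho (S'.f t)) x - cv ε' (rho (S'.f t)) x)) := by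
  rw [D.E_eq_cv S hε t h.cs, D.E_eq_cv S' hε' t h'.cs, h.cv_sub h', ← smul_sub]
  congr 1
  abel

theorem Data.cauchy (T : ℝ) (hT : 0 ≤ T) : ∃ C, 0 ≤ C ∧ ∀ ε ε', 0 < ε → ε ≤ 1 → 0 < ε' → ε' ≤ 1 →
    ∀ (S : Reg f₀ γ ε) (S' : Reg f₀ γ ε'), ∀ t ∈ Icc 0 T, dist (S.E t) (S'.E t) ≤ C * (ε + ε') ∧
      ∀ p, |S.f t p - S'.f t p| ≤ C * (ε + ε') := by
  obtain ⟨Λ, κ, P, hΛ, hκ, hP, hu⟩ := D.unif T hT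
  have hl := D.ell_nonneg
  have hM := D.Mnn
  have hc := cS_nonneg
  have hpi := Real.pi_pos
  have hv := vR_nonneg P
  have hw := vR_nonneg (R + T * P)
  set K0 : ℝ := exp ((2 + Λ) * T) with hK0
  have hK : 0 < K0 := exp_pos _
  set a : ℝ := vR P * (cS + vR (R + T * P)) with ha
  set b : ℝ := M * vR P * (cS * (3 * π)) with hb
  have ha0 : 0 ≤ a := by positivity
  have hb0 : 0 ≤ b := by positivity
  set B : ℝ := 2 * a^2 * (ℓ^2 * K0) with hB
  set C1 : ℝ := √(2 * b^2 * exp (B * T)) with hC1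
  set C2 : ℝ := ℓ * √(K0 * (T * C1^2)) with hC2
  have hC10 : 0 ≤ C1 := Real.sqrt_nonneg _
  have hC20 : 0 ≤ C2 := by positivity
  refine ⟨C1 + C2, by positivity, fun ε ε' hε hε1 hε' hε1' S S' => ?_⟩
  have hgc : Continuous fun t => (dist (S.E t) (S'.E t))^2 := (S.contE.dist S'.contE).pow 2
  have hfd : ∀ t ∈ Icc 0 T, ∀ p, |S.f t p - S'.f t p| ≤
      ℓ * √(K0 * ∫ s in (0:ℝ)..t, (dist (S.E s) (S'.E s))^2) := fun t ht p =>
    D.f_diff_le hΛ S S' (fun t ht => (hu ε hε hε1 S t ht).1) ht p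
  have hg := fwd_gron (T := T) hgc (A := 2 * b^2 * (ε + ε')^2) (B := B) (by positivity) (by positivity) (by
    intro t ht
    have h := (hu ε hε hε1 S t ht).2
    have h' := (hu ε' hε' hε1' S' t ht).2
    set δ : ℝ := ℓ * √(K0 * ∫ s in (0:ℝ)..t, (dist (S.E s) (S'.E s))^2) with hδ
    have hI : 0 ≤ ∫ s in (0:ℝ)..t, (dist (S.E s) (S'.E s))^2 :=
      intervalIntegral.integral_nonneg ht.1 fun s _ => sq_nonneg _
    have hδ0 : 0 ≤ δ := by positivity
    have hδ2 : δ^2 = ℓ^2 * K0 * ∫ s in (0:ℝ)..t, (dist (S.E s) (S'.E s))^2 := by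
      rw [hδ, mul_pow, Real.sq_sqrt (by positivity)]; ring
    have hd : dist (S.E t) (S'.E t) ≤ a * δ + b * (ε + ε') := by
      refine (BoundedContinuousFunction.dist_le (by positivity)).2 fun x => ?_
      rw [dist_eq_norm, D.field_diff hε hε' S S' h h' x, norm_smul, Real.norm_eq_abs]
      have h1 := (h.sub h' (hfd t ht)).dens.cv_bd ε x
      have h2 := h'.dens.cv_diff' hε hε' x
      refine (mul_le_of_le_one_left (norm_nonneg _) D.gam).trans ((norm_add_le _ _).trans ?_)
      rw [ha, hb]
      linarith
    have h0 : (dist (S.E t) (S'.E t))^2 ≤ (a * δ + b * (ε + ε'))^2 := pow_le_pow_left₀ dist_nonneg hd 2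
    have h3 : (a * δ + b * (ε + ε'))^2 ≤ 2 * b^2 * (ε + ε')^2 + 2 * a^2 * δ^2 := by
      nlinarith [sq_nonneg (a * δ - b * (ε + ε'))]
    rw [hδ2] at h3
    rw [hB]
    linarith)
  have hg1 : ∀ t ∈ Icc 0 T, dist (S.E t) (S'.E t) ≤ C1 * (ε + ε') := fun t ht => by
    refine abs_le_of_sq_le_sq' ?_ (by positivity) |>.2
    rw [mul_pow, hC1, Real.sq_sqrt (by positivity)]
    have := hg t ht
    linarith
  refine fun t ht => ⟨(hg1 t ht).trans (by gcongr; linarith), fun p => (hfd t ht p).trans ?_⟩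
  have h1 : ∫ s in (0:ℝ)..t, (dist (S.E s) (S'.E s))^2 ≤ T * C1^2 * (ε + ε')^2 := by
    calc _ ≤ ∫ s in (0:ℝ)..t, C1^2 * (ε + ε')^2 := by
          refine intervalIntegral.integral_mono_on ht.1 (hgc.intervalIntegrable _ _) (by simp) fun s hs => ?_
          rw [← mul_pow]
          exact pow_le_pow_left₀ dist_nonneg (hg1 s ⟨hs.1, hs.2.trans ht.2⟩) 2
      _ = t * (C1^2 * (ε + ε')^2) := by rw [intervalIntegral.integral_const, smul_eq_mul]; ring
      _ ≤ T * (C1^2 * (ε + ε')^2) := by gcongr; exact ht.2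
      _ = _ := by ring
  calc _ ≤ ℓ * √(K0 * (T * C1^2 * (ε + ε')^2)) := by gcongr
    _ = C2 * (ε + ε') := by
      rw [hC2, show K0 * (T * C1^2 * (ε + ε')^2) = K0 * (T * C1^2) * (ε + ε')^2 by ring,
        Real.sqrt_mul (by positivity), Real.sqrt_sq (by positivity), mul_assoc]
    _ ≤ _ := by gcongr; linarith

theorem Data.cauchyD (T : ℝ) (hT : 0 ≤ T) : ∃ C, 0 ≤ C ∧ ∀ ε ε', 0 < ε → 0 < ε' → ε + ε' ≤ 1 →
    ∀ (S : Reg f₀ γ ε) (S' : Reg f₀ γ ε'), ∀ t ∈ Icc 0 T, dist (S.DE t) (S'.DE t) ≤ C * √(ε + ε') := by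
  obtain ⟨Λ, κ, P, hΛ, hκ, hP, hu⟩ := D.unif T hT
  obtain ⟨C, hC, hca⟩ := D.cauchy T hT
  have hc := cS_nonneg
  have hpi := Real.pi_pos
  have hv := vR_nonneg P
  have hw := vR_nonneg (R + T * P)
  refine ⟨(κ + κ) * vR P * (cS * (3 * π)) + C * vR P * (4 * (cS * 2 + vR (R + T * P)))
    + κ * vR P * (cS * (3 * π)), by positivity, fun ε ε' hε hε' hε1 S S' t ht => ?_⟩
  have h := (hu ε hε (by linarith) S t ht).2
  have h' := (hu ε' hε' (by linarith) S' t ht).2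
  set m : ℝ := ε + ε' with hm
  have hm0 : 0 < m := by positivity
  set q : ℝ := √m with hq
  have hq0 : 0 < q := Real.sqrt_pos.2 hm0
  have hq2 : q * q = m := Real.mul_self_sqrt hm0.le
  have hq1 : q ≤ 1 := Real.sqrt_le_one.2 hε1
  have hmq : m ≤ q := by nlinarith
  have hlog : m * (1 + log (1 / m)) ≤ 2 * q := by
    have h1 : log (1 / m) = 2 * log (1 / q) := by
      rw [← hq2, one_div, one_div, Real.log_inv, Real.log_inv, Real.log_mul hq0.ne' hq0.ne']; ring
    have h2 : log (1 / q) ≤ 1 / q - 1 := Real.log_le_sub_one_of_pos (by positivity)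
    have h3 : m * (1 / q) = q := by rw [← hq2]; field_simp
    have h4 : m * log (1 / q) ≤ q - m := by
      have := mul_le_mul_of_nonneg_left h2 hm0.le
      nlinarith
    rw [h1]
    nlinarith
  have hlg : 0 ≤ log (1 / m) := log_nonneg (by rw [le_div_iff₀ hm0]; linarith)
  refine (BoundedContinuousFunction.dist_le (by positivity)).2 fun x => ?_
  rw [dist_eq_norm]
  refine ((S.hasD t x).sub (S'.hasD t x)).le_of_lip' (by positivity) (Eventually.of_forall fun y => ?_)
  simp only [Pi.sub_apply]
  rw [D.field_diff hε hε' S S' h h' y, D.field_diff hε hε' S S' h h' x, ← smul_sub, norm_smul,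
    Real.norm_eq_abs]
  refine (mul_le_of_le_one_left (norm_nonneg _) D.gam).trans ?_
  rw [add_sub_add_comm]
  refine (norm_add_le _ _).trans ?_
  have h1 := (h.sub h' (hca ε ε' hε (by linarith) hε' (by linarith) S S' t ht).2).dens.cv_lip hε
    (by linarith) hm0 hε1 y x
  have h2 := h'.dens.cv_lip2' hε hε' y x
  refine (add_le_add h1 h2).trans ?_
  rw [← add_mul]
  refine mul_le_mul_of_nonneg_right ?_ (norm_nonneg _)
  have e1 : (κ + κ) * vR P * (cS * (3 * (m * π))) ≤ (κ + κ) * vR P * (cS * (3 * π)) * q := by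
    calc _ = (κ + κ) * vR P * (cS * (3 * π)) * m := by ring
      _ ≤ _ := by gcongr
  have e2 : κ * vR P * (cS * (3 * (m * π))) ≤ κ * vR P * (cS * (3 * π)) * q := by
    calc _ = κ * vR P * (cS * (3 * π)) * m := by ring
      _ ≤ _ := by gcongr
  have e3 : C * m * vR P * (4 * (cS * (1 + log (1 / m)) + vR (R + T * P))) ≤
      C * vR P * (4 * (cS * 2 + vR (R + T * P))) * q := by
    calc _ = C * vR P * (4 * (cS * (m * (1 + log (1/m))) + vR (R + T * P) * m)) := by ring
      _ ≤ C * vR P * (4 * (cS * (2 * q) + vR (R + T * P) * q)) := by gcongr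
      _ = _ := by ring
  linarith

end
end VP

namespace VP

open Set Filter Topology
open scoped ENNReal BoundedContinuousFunction

/-- regularisation parameters -/
def ee (n : ℕ) : ℝ := 1 / ((n : ℝ) + 2)

lemma ee_pos (n : ℕ) : 0 < ee n := by unfold ee; positivity
lemma ee_half (n : ℕ) : ee n ≤ 1 / 2 := by
  unfold ee
  exact one_div_le_one_div_of_le (by norm_num) (by linarith [(Nat.cast_nonneg n : (0:ℝ) ≤ n)])
lemma ee_tendsto : Tendsto ee atTop (𝓝 0) := by
  unfold ee
  exact (tendsto_const_nhds (x := (1:ℝ))).div_atTop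
    (tendsto_atTop_add_const_right _ 2 tendsto_natCast_atTop_atTop)
lemma see_tendsto (C : ℝ) : Tendsto (fun n => C * √(ee n)) atTop (𝓝 0) := by
  have := (ee_tendsto.sqrt).const_mul C
  simpa using this

lemma exists_lim {X : Type*} [MetricSpace X] [CompleteSpace X] (u : ℕ → ℝ → X)
    (hc : ∀ n, Continuous (u n))
    (h : ∀ T, 0 ≤ T → ∃ C, ∀ n m, ∀ t ∈ Icc 0 T, dist (u n t) (u m t) ≤ C * √(ee n + ee m)) :
    ∃ U : ℝ → X, Continuous U ∧ (∀ t, U t = U (max t 0)) ∧ ∀ T, 0 ≤ T → ∃ C, 0 ≤ C ∧ ∀ n, ∀ t ∈ Icc 0 T,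
      dist (u n t) (U t) ≤ C * √(ee n) := by
  have hcs : ∀ t, 0 ≤ t → CauchySeq fun n => u n t := by
    intro t ht
    obtain ⟨C, hC⟩ := h t ht
    rw [Metric.cauchySeq_iff]
    intro η hη
    have ht2 : Tendsto (fun p : ℕ × ℕ => C * √(ee p.1 + ee p.2)) (atTop ×ˢ atTop) (𝓝 0) := by
      have h1 : Tendsto (fun p : ℕ × ℕ => ee p.1 + ee p.2) (atTop ×ˢ atTop) (𝓝 (0 + 0)) :=
        (ee_tendsto.comp tendsto_fst).add (ee_tendsto.comp tendsto_snd)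
      have := (h1.sqrt).const_mul C
      simpa using this
    have ev := ht2.eventually (gt_mem_nhds hη)
    rw [prod_atTop_atTop_eq, eventually_atTop] at ev
    obtain ⟨⟨a, b⟩, hab⟩ := ev
    refine ⟨max a b, fun m hm n hn => (hC m n t ⟨ht, le_rfl⟩).trans_lt (hab (m, n) ?_)⟩
    exact ⟨(le_max_left a b).trans hm, (le_max_right a b).trans hn⟩
  choose V hV using fun t : ℝ => cauchySeq_tendsto_of_complete (hcs (max t 0) (le_max_right _ _))
  have hb : ∀ T, 0 ≤ T → ∃ C, 0 ≤ C ∧ ∀ n, ∀ t, t ≤ T →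
      dist (u n (max t 0)) (V t) ≤ C * √(ee n) := by
    intro T hT
    obtain ⟨C, hC⟩ := h T hT
    refine ⟨|C|, abs_nonneg _, fun n t ht => ?_⟩
    have h1 : Tendsto (fun m => dist (u n (max t 0)) (u m (max t 0))) atTop
        (𝓝 (dist (u n (max t 0)) (V t))) := tendsto_const_nhds.dist (hV t)
    have h2 : Tendsto (fun m => C * √(ee n + ee m)) atTop (𝓝 (C * √(ee n + 0))) :=
      ((tendsto_const_nhds.add ee_tendsto).sqrt).const_mul C
    have h3 := le_of_tendsto_of_tendsto' h1 h2 fun m => hC n m _ ⟨le_max_right _ _, max_le ht hT⟩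
    rw [add_zero] at h3
    exact h3.trans (mul_le_mul_of_nonneg_right (le_abs_self C) (Real.sqrt_nonneg _))
  refine ⟨V, ?_, fun t => ?_, fun T hT => ?_⟩
  · refine TendstoLocallyUniformly.continuous (F := fun n t => u n (max t 0)) (p := atTop) ?_
      (Frequently.of_forall fun n => (hc n).comp (continuous_id.max continuous_const))
    rw [Metric.tendstoLocallyUniformly_iff]
    intro η hη t
    obtain ⟨C, hC0, hC⟩ := hb (max (t + 1) 0) (le_max_right _ _)
    refine ⟨Iio (t + 1), Iio_mem_nhds (by linarith), ?_⟩
    filter_upwards [(see_tendsto C).eventually (gt_mem_nhds hη)] with n hn s hs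
    rw [dist_comm]
    exact (hC n s ((le_of_lt hs).trans (le_max_left _ _))).trans_lt hn
  · refine tendsto_nhds_unique (hV t) ?_
    have := hV (max t 0)
    rwa [max_eq_left (le_max_right t 0)] at this
  · obtain ⟨C, hC0, hC⟩ := hb T hT
    refine ⟨C, hC0, fun n t ht => ?_⟩
    have := hC n t ht.2
    rwa [max_eq_left ht.1] at this

section
variable {f₀ : Ph → ℝ} {γ R M ℓ : ℝ} (D : Data f₀ γ R M ℓ)
include D

/-- The limiting flow, together with the convergence of the approximations. -/
theorem Data.limit : ∃ (S : ∀ n, Reg f₀ γ (ee n)) (E : ℝ → E3 →ᵇ E3) (G Ψ : ℝ → Ph → Ph),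
    Continuous E ∧ (∀ z, G 0 z = z) ∧
    (∀ t z, HasDerivAt (fun t => G t z) ((G t z).2, E t (G t z).1) t) ∧
    ContDiff ℝ 1 (Function.uncurry Ψ) ∧ (∀ t z, Ψ t (G t z) = z) ∧ (∀ t z, G t (Ψ t z) = z) ∧
    ∀ T, 0 ≤ T → ∃ C, 0 ≤ C ∧ ∀ n, ∀ t ∈ Icc 0 T, dist ((S n).E t) (E t) ≤ C * √(ee n) := by
  have hS : ∀ n, Nonempty (Reg f₀ γ (ee n)) := fun n => D.exists_reg (ee_pos n)
  let S : ∀ n, Reg f₀ γ (ee n) := fun n => (hS n).some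
  have hsum : ∀ n m, ee n + ee m ≤ 1 := fun n m => by linarith [ee_half n, ee_half m]
  obtain ⟨E, hE, hEm, hEc⟩ := exists_lim (fun n => (S n).E) (fun n => (S n).contE) (by
    intro T hT
    obtain ⟨C, hC, h⟩ := D.cauchy T hT
    refine ⟨C, fun n m t ht => ((h (ee n) (ee m) (ee_pos n) (by linarith [ee_half n]) (ee_pos m)
      (by linarith [ee_half m]) (S n) (S m) t ht).1).trans ?_⟩
    have h0 : 0 ≤ ee n + ee m := by linarith [ee_pos n, ee_pos m]
    refine mul_le_mul_of_nonneg_left (Real.le_sqrt_of_sq_le ?_) hC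
    nlinarith [hsum n m])
  obtain ⟨DE, hDE, hDEm, hDEc⟩ := exists_lim (fun n => (S n).DE) (fun n => (S n).contDE) (by
    intro T hT
    obtain ⟨C, hC, h⟩ := D.cauchyD T hT
    exact ⟨C, fun n m t ht => h (ee n) (ee m) (ee_pos n) (ee_pos m) (hsum n m) (S n) (S m) t ht⟩)
  have hasD : ∀ t x, HasFDerivAt (E t) (DE t x) x := by
    intro t x
    rw [hEm t, hDEm t]
    have ht : max t 0 ∈ Icc 0 (max t 0) := ⟨le_max_right _ _, le_rfl⟩
    obtain ⟨C, hC0, hC⟩ := hEc _ (le_max_right t 0)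
    obtain ⟨C', hC0', hC'⟩ := hDEc _ (le_max_right t 0)
    refine hasFDerivAt_of_tendstoUniformly (l := atTop) (f := fun n x => (S n).E (max t 0) x)
      (f' := fun n x => (S n).DE (max t 0) x) (g' := fun x => DE (max t 0) x) ?_ 
      (fun n x => (S n).hasD _ x) ?_ x
    · rw [Metric.tendstoUniformly_iff]
      intro η hη
      filter_upwards [(see_tendsto C').eventually (gt_mem_nhds hη)] with n hn y
      rw [dist_comm]
      exact ((BoundedContinuousFunction.dist_coe_le_dist y).trans (hC' n _ ht)).trans_lt hn
    · intro y
      rw [tendsto_iff_dist_tendsto_zero]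
      exact squeeze_zero (fun _ => dist_nonneg)
        (fun n => (BoundedContinuousFunction.dist_coe_le_dist y).trans (hC n _ ht)) (see_tendsto C)
  obtain ⟨G, Ψ, J, hG0, hode, -, -, -, -, hΨ, hΨG, hGΨ⟩ := (phField (C1Field.ofBCF hE hDE hasD)).exists_flow
  exact ⟨S, E, G, Ψ, hE, hG0, fun t z => hode t z, hΨ, hΨG, hGΨ, hEc⟩

end
end VP

namespace VP

open Set Filter Topology
open scoped ENNReal BoundedContinuousFunction

section
variable {f₀ : Ph → ℝ} {γ R M ℓ : ℝ} (D : Data f₀ γ R M ℓ)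
include D

theorem Data.main : ∃ (E : ℝ → E3 →ᵇ E3) (G Ψ : ℝ → Ph → Ph) (C : ℝ), 0 < C ∧ (∀ z, G 0 z = z) ∧
    (∀ t z, HasDerivAt (fun t => G t z) ((G t z).2, E t (G t z).1) t) ∧
    ContDiff ℝ 1 (Function.uncurry Ψ) ∧ (∀ t z, Ψ t (G t z) = z) ∧ (∀ t z, G t (Ψ t z) = z) ∧
    (∀ t, 0 ≤ t → ∀ x, E t x = γ • cv 0 (rho fun p => f₀ (Ψ t p)) x) ∧
    (∀ t, 0 ≤ t → ∀ p, f₀ (Ψ t p) ≠ 0 → ‖p.2‖ ≤ C * (1 + t) * log (2 + t)) ∧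
    (∀ T, 0 ≤ T → ∃ B, ∀ t ∈ Icc 0 T, ∀ p, f₀ (Ψ t p) ≠ 0 → ‖p.1‖ ≤ B ∧ ‖p.2‖ ≤ B) := by
  obtain ⟨S, E, G, Ψ, hE, hG0, hode, hΨ, hΨG, hGΨ, hEc⟩ := D.limit
  obtain ⟨Cm, hCm, hmom⟩ := D.momentum
  have hl := D.ell_nonneg
  -- convergence of the distribution functions
  have hconv : ∀ T, 0 ≤ T → ∃ C, 0 ≤ C ∧ ∀ n, ∀ t ∈ Icc 0 T, ∀ p,
      |(S n).f t p - f₀ (Ψ t p)| ≤ C * √(ee n) := by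
    intro T hT
    obtain ⟨Λ, κ, P, hΛ, hκ, hP, hu⟩ := D.unif T hT
    obtain ⟨C, hC, hEC⟩ := hEc T hT
    refine ⟨ℓ * √(exp ((2 + Λ) * T) * (T * C^2)), by positivity, fun n t ht p => ?_⟩
    have hLn : ∀ s ∈ Icc 0 T, (S n).L s ≤ Λ := fun s hs =>
      (hu _ (ee_pos n) (by linarith [ee_half n]) (S n) s hs).1
    have h := two_sys (z := fun s => (S n).G s ((S n).Ψ t p)) (z' := fun s => G s (Ψ t p))
      (S n).contE hE (L := fun _ => Λ) continuous_const (fun _ => hΛ) ht.1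
      (fun s hs x x' => ((S n).E_lip s x x').trans
        (mul_le_mul_of_nonneg_right (hLn s ⟨hs.1, hs.2.trans ht.2⟩) (norm_nonneg _)))
      (fun s _ => (S n).ode s _) (fun s _ => hode s _)
    simp only [(S n).G0, (S n).GΨ, hG0, hGΨ, sub_self, norm_zero] at h
    have hI0 : 0 ≤ ∫ s in (0:ℝ)..t, (dist ((S n).E s) (E s))^2 :=
      intervalIntegral.integral_nonneg ht.1 fun s _ => sq_nonneg _
    have h1 : ∫ s in (0:ℝ)..t, (2 + Λ) ≤ (2 + Λ) * T := by
      rw [intervalIntegral.integral_const, smul_eq_mul, sub_zero, mul_comm]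
      exact mul_le_mul_of_nonneg_left ht.2 (by linarith)
    have hgc : Continuous fun s => (dist ((S n).E s) (E s))^2 := ((S n).contE.dist hE).pow 2
    have h2 : ∫ s in (0:ℝ)..t, (dist ((S n).E s) (E s))^2 ≤ T * C^2 * ee n := by
      calc _ ≤ ∫ s in (0:ℝ)..t, C^2 * ee n := by
            refine intervalIntegral.integral_mono_on ht.1 (hgc.intervalIntegrable _ _) (by simp) fun s hs => ?_
            refine (pow_le_pow_left₀ dist_nonneg (hEC n s ⟨hs.1, hs.2.trans ht.2⟩) 2).trans_eq ?_
            rw [mul_pow, Real.sq_sqrt (ee_pos n).le]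
        _ = t * (C^2 * ee n) := by rw [intervalIntegral.integral_const, smul_eq_mul]; ring
        _ ≤ T * (C^2 * ee n) := mul_le_mul_of_nonneg_right ht.2 (mul_nonneg (sq_nonneg _) (ee_pos n).le)
        _ = _ := by ring
    have h3 : ‖(S n).Ψ t p - Ψ t p‖^2 ≤ exp ((2 + Λ) * T) * (T * C^2) * ee n := by
      refine h.trans ?_
      calc _ = exp (∫ s in (0:ℝ)..t, (2 + Λ)) * ∫ s in (0:ℝ)..t, (dist ((S n).E s) (E s))^2 := by
            ring
        _ ≤ exp ((2 + Λ) * T) * (T * C^2 * ee n) := by gcongr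
        _ = _ := by ring
    have h4 := Real.le_sqrt_of_sq_le h3
    rw [Real.sqrt_mul (by positivity)] at h4
    refine (D.lip _ _).trans ?_
    rw [mul_assoc]
    exact mul_le_mul_of_nonneg_left h4 hl
  have htend : ∀ t, 0 ≤ t → ∀ p, Tendsto (fun n => (S n).f t p) atTop (𝓝 (f₀ (Ψ t p))) := by
    intro t ht p
    obtain ⟨C, hC, h⟩ := hconv t ht
    rw [tendsto_iff_dist_tendsto_zero]
    exact squeeze_zero (fun _ => dist_nonneg) (fun n => h n t ⟨ht, le_rfl⟩ p) (see_tendsto C)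
  have hex : ∀ t, 0 ≤ t → ∀ p, f₀ (Ψ t p) ≠ 0 → ∃ n, (S n).f t p ≠ 0 := by
    intro t ht p hp
    exact ((htend t ht p).eventually_ne hp).exists
  -- regularity of the limit distribution
  have hpd : ∀ T, 0 ≤ T → ∃ κ P, 0 ≤ P ∧ (∀ n, ∀ t ∈ Icc 0 T, PD ((S n).f t) M κ P (R + T * P)) ∧
      ∀ t ∈ Icc 0 T, PD (fun p => f₀ (Ψ t p)) M κ P (R + T * P) := by
    intro T hT
    obtain ⟨Λ, κ, P, hΛ, hκ, hP, hu⟩ := D.unif T hT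
    have hSn : ∀ n, ∀ t ∈ Icc 0 T, PD ((S n).f t) M κ P (R + T * P) := fun n t ht =>
      (hu _ (ee_pos n) (by linarith [ee_half n]) (S n) t ht).2
    refine ⟨κ, P, hP, hSn, fun t ht => ⟨?_, fun p => ?_, hκ, fun y y' w => ?_, fun p hp => ?_⟩⟩
    · exact D.cont.comp (hΨ.continuous.comp (Continuous.prodMk continuous_const continuous_id))
    · rw [abs_of_nonneg (D.nonneg _)]; exact D.le _
    · exact le_of_tendsto ((htend t ht.1 (y, w)).sub (htend t ht.1 (y', w))).abs
        (Eventually.of_forall fun n => (hSn n t ht).lip y y' w)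
    · obtain ⟨n, hn⟩ := hex t ht.1 p hp
      exact (hSn n t ht).supp p hn
  refine ⟨E, G, Ψ, Cm, hCm, hG0, hode, hΨ, hΨG, hGΨ, fun t ht x => ?_, fun t ht p hp => ?_, fun T hT => ?_⟩
  · have htt : t ∈ Icc 0 t := ⟨ht, le_rfl⟩
    obtain ⟨κ, P, hP, hSn, hF⟩ := hpd t ht
    obtain ⟨C, hC, hc⟩ := hconv t ht
    obtain ⟨C', hC', hc'⟩ := hEc t ht
    have h1 : Tendsto (fun n => (S n).E t x) atTop (𝓝 (E t x)) := by
      rw [tendsto_iff_dist_tendsto_zero]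
      exact squeeze_zero (fun _ => dist_nonneg)
        (fun n => (BoundedContinuousFunction.dist_coe_le_dist x).trans (hc' n _ htt)) (see_tendsto C')
    refine tendsto_nhds_unique h1 ?_
    have h2 : ∀ n, (S n).E t x = γ • cv (ee n) (rho ((S n).f t)) x := fun n =>
      D.E_eq_cv (S n) (ee_pos n) t (hSn n t htt).cs x
    simp only [h2]
    refine Tendsto.const_smul ?_ γ
    rw [tendsto_iff_dist_tendsto_zero]
    have hb : ∀ n, dist (cv (ee n) (rho ((S n).f t)) x) (cv 0 (rho fun p => f₀ (Ψ t p)) x) ≤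
        (C * √(ee n)) * (vR P * (cS + vR (R + t * P))) + (M * vR P * (cS * (3 * π))) * ee n := by
      intro n
      have e1 := ((hSn n t htt).sub (hF t htt) (hc n t htt)).dens.cv_bd (ee n) x
      rw [(hSn n t htt).cv_sub (hF t htt)] at e1
      have e2 := (hF t htt).dens.cv_diff le_rfl (ee_pos n) (ee_pos n).le x
      rw [dist_eq_norm]
      rw [norm_sub_rev] at e2
      have e3 := norm_sub_le_norm_sub_add_norm_sub (cv (ee n) (rho ((S n).f t)) x)
        (cv (ee n) (rho fun p => f₀ (Ψ t p)) x) (cv 0 (rho fun p => f₀ (Ψ t p)) x)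
      nlinarith
    have hlim : Tendsto (fun n => (C * √(ee n)) * (vR P * (cS + vR (R + t * P))) +
        (M * vR P * (cS * (3 * π))) * ee n) atTop (𝓝 0) := by
      have := ((see_tendsto C).mul_const (vR P * (cS + vR (R + t * P)))).add
        (ee_tendsto.const_mul (M * vR P * (cS * (3 * π))))
      simpa using this
    exact squeeze_zero (fun _ => dist_nonneg) hb hlim
  · obtain ⟨n, hn⟩ := hex t ht p hp
    have := hmom _ (ee_pos n) (S n) t ht _ (D.supp _ hn)
    rwa [(S n).GΨ] at this
  · obtain ⟨κ, P, hP, hSn, hF⟩ := hpd T hT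
    exact ⟨max (R + T * P) P, fun t ht p hp => ⟨((hF t ht).supp p hp).1.trans (le_max_left _ _),
      ((hF t ht).supp p hp).2.trans (le_max_right _ _)⟩⟩

end

lemma kk_zero (x : E3) : kk 0 x = (‖x‖^3)⁻¹ • x := by
  simp [kk, nn, Real.sqrt_sq]

end VP

open VP
theorem horst_momentum_support_bound
    (β : ℝ) (hβ : β = 1 ∨ β = -1)
    (f₀ : E3 × E3 → ℝ) (hf₀_nonneg : ∀ z, 0 ≤ f₀ z)
    (hf₀_smooth : ContDiff ℝ 1 f₀) (hf₀_supp : HasCompactSupport f₀) :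
    ∃ (F : ℝ × E3 × E3 → ℝ) (C : ℝ), 0 < C ∧
      IsGlobalVPSolution β F ∧
      (∀ x v, F (0, x, v) = f₀ (x, v)) ∧
      (∀ t : ℝ, 0 ≤ t → vpQ F t ≤ C * (1 + t) * Real.log (2 + t)) := by
  have hβ1 : |β| = 1 := by rcases hβ with h | h <;> simp [h]
  have hpi := Real.pi_gt_three
  obtain ⟨R0, hR0⟩ := hf₀_supp.isCompact.isBounded.exists_norm_le
  obtain ⟨M, hM⟩ := hf₀_supp.exists_bound_of_continuous hf₀_smooth.continuous
  obtain ⟨K, hK⟩ := hf₀_smooth.lipschitzWith_of_hasCompactSupport hf₀_supp one_ne_zero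
  have D : Data f₀ (β * (4 * π)⁻¹) (max R0 1) M K :=
    { cont := hf₀_smooth.continuous
      nonneg := hf₀_nonneg
      Rpos := lt_max_of_lt_right one_pos
      supp := fun z hz => (hR0 z (subset_tsupport _ hz)).trans (le_max_left _ _)
      le := fun z => (le_abs_self _).trans (hM z)
      lip := fun z z' => by
        have := hK.dist_le_mul z z'
        rwa [Real.dist_eq, dist_eq_norm] at this
      gam := by
        rw [abs_mul, hβ1, one_mul, abs_of_pos (by positivity)]
        exact inv_le_one_of_one_le₀ (by linarith) }
  obtain ⟨E, G, Ψ, C, hC, hG0, hode, hΨ, hΨG, hGΨ, hEeq, hsup, hbd⟩ := D.main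
  have hΨ0 : ∀ z, Ψ 0 z = z := fun z => by
    have := hΨG 0 z
    rwa [hG0] at this
  set F : ℝ × E3 × E3 → ℝ := fun q => f₀ (Function.uncurry Ψ q) with hF
  have hFs : ContDiff ℝ 1 F := hf₀_smooth.comp hΨ
  have hfield : ∀ t, 0 ≤ t → ∀ x, β • vpField F t x = E t x := by
    intro t ht x
    rw [hEeq t ht x, vpField, smul_smul, cv]
    congr 1
    refine integral_congr_ae (Filter.Eventually.of_forall fun y => ?_)
    simp only [kk_zero, smul_smul, div_eq_mul_inv]
    rfl
  refine ⟨F, C, hC, ⟨fun z => hf₀_nonneg _, hFs, fun t x v ht => ?_, fun t ht => ?_⟩, fun x v => ?_,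
    fun t ht => ?_⟩
  · rw [hfield t ht x]
    have h1 : HasDerivAt (fun s => ((s, G s (Ψ t (x, v))) : ℝ × E3 × E3))
        (1, v, E t x) t := by
      have h := (hasDerivAt_id t).prodMk (hode t (Ψ t (x, v)))
      rw [hGΨ] at h
      exact h
    have h2 : HasFDerivAt F (fderiv ℝ F (t, x, v)) (t, G t (Ψ t (x, v))) := by
      rw [hGΨ]
      exact (hFs.differentiable one_ne_zero (t, x, v)).hasFDerivAt
    have h3 := h2.comp_hasDerivAt t h1
    have h4 : (F ∘ fun s => ((s, G s (Ψ t (x, v))) : ℝ × E3 × E3)) = fun _ => f₀ (Ψ t (x, v)) := by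
      funext s
      simp only [Function.comp, hF, Function.uncurry, hΨG]
    rw [h4] at h3
    exact h3.unique (hasDerivAt_const t _)
  · obtain ⟨B, hB⟩ := hbd t ht
    refine (Metric.isBounded_closedBall (x := (0 : ℝ × E3 × E3)) (r := max t B)).subset ?_
    rintro ⟨s, x, v⟩ ⟨h0, h1, h2⟩
    have h3 := hB s ⟨h0, h1⟩ (x, v) h2
    simp only at h0 h1 h3
    rw [mem_closedBall_zero_iff]
    refine norm_prod_le_iff.2 ⟨?_, norm_prod_le_iff.2 ⟨?_, ?_⟩⟩
    · exact (Real.norm_of_nonneg h0).trans_le (h1.trans (le_max_left _ _))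
    · exact h3.1.trans (le_max_right _ _)
    · exact h3.2.trans (le_max_right _ _)
  · simp only [hF, Function.uncurry, hΨ0]
  · have hlog : 0 ≤ Real.log (2 + t) := Real.log_nonneg (by linarith)
    refine Real.sSup_le ?_ (by positivity)
    rintro r ⟨s, x, v, hs0, hst, hne, rfl⟩
    have h1 := hsup s hs0 (x, v) hne
    refine h1.trans ?_
    have h2 : Real.log (2 + s) ≤ Real.log (2 + t) := Real.log_le_log (by linarith) (by linarith)
    have h3 : 0 ≤ Real.log (2 + s) := Real.log_nonneg (by linarith)
    exact mul_le_mul (mul_le_mul_of_nonneg_left (by linarith) hC.le) h2 h3 (by positivity)
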